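/- arXiv:1907.12936 — 3 statements merged into one kernel-verified Lean document; each statement's English description precedes it below -/
import Mathlib

section
/- Let K be a field of characteristic zero and n ≥ 0. For a tuple (m₁,…,m₄) of nonnegative integers summing to n, let M(m₁,m₂,m₃,m₄) = Ind_{S_{m₁}×S_{m₂}×S_{m₃}×S_{m₄}}^{Sₙ} 𝟏 be the associated permutation representation of Sₙ. Then there is an isomorphism of Sₙ-representations (⊕_{λ⊢n, r(λ)≤2} S_λ ⊗ S_λ) ⊕ (⊕_{i,j,k≥0, 2i+1+j+k=n} M(i, i+1, j, k)) ≅ ⊕_{i,j,k≥0, 2i+j+k=n} M(i, i, j, k), where S_λ denotes the Specht module of Sₙ associated to λ and Sₙ acts diagonally on S_λ ⊗ S_λ. -/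
open CategoryTheory MonoidalCategory CategoryTheory.Limits


/-- `listBlock L t` is the index of the block containing `t` when `{0,1,2,…}` is divided
into consecutive blocks of sizes `L = [l₁, l₂, …]`: it is the number of partial sums
`l₁, l₁+l₂, …` that are `≤ t`. -/
def listBlock (L : List ℕ) (t : ℕ) : ℕ :=
  (L.scanl (· + ·) 0).tail.countP fun s => decide (s ≤ t)

/-- `listCol L t` is the position of `t` within its block (the column index of the cell `t`
in the canonical filling of the Young diagram with row lengths `L`). -/
def listCol (L : List ℕ) (t : ℕ) : ℕ :=
  t - ((L.scanl (· + ·) 0).filter fun s => decide (s ≤ t)).foldr max 0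

/-- The parts of a partition, listed in weakly decreasing order. -/
def partsList {m : ℕ} (mu : Nat.Partition m) : List ℕ := (mu.parts.sort (· ≤ ·)).reverse

/-- The subgroup of permutations of `Fin N` preserving the fibers of `f` pointwise on values,
i.e. `{σ | f ∘ σ = f}`. -/
def stabSubgroup (N : ℕ) (f : Fin N → ℕ) : Subgroup (Equiv.Perm (Fin N)) where
  carrier := {σ | ∀ t, f (σ t) = f t}
  one_mem' := fun _ => rfl
  mul_mem' := by
    intro σ τ hσ hτ t
    have h1 : f (σ (τ t)) = f (τ t) := hσ (τ t)
    have h2 : f (τ t) = f t := hτ t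
    simpa [Equiv.Perm.mul_apply, h2] using h1
  inv_mem' := by
    intro σ hσ t
    have h1 : f (σ (σ⁻¹ t)) = f (σ⁻¹ t) := hσ (σ⁻¹ t)
    simpa using h1.symm

instance stabDecidable' (N : ℕ) (f : Fin N → ℕ) : DecidablePred (· ∈ stabSubgroup N f) :=
  fun σ => decidable_of_iff (∀ t, f (σ t) = f t) Iff.rfl

/-- The row function of the canonical tableau of the partition `mu` of `m`, placed on the
block `[o, o+m)` of `{0, …, N−1}`; points outside the block get their own distinct values
(so that the stabilizer of this function consists of the permutations fixing the complement
of the block pointwise and preserving the rows of the tableau). -/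
def shiftedRowFn (N o m : ℕ) (mu : Nat.Partition m) : Fin N → ℕ := fun t =>
  if o ≤ t.val ∧ t.val < o + m then N + listBlock (partsList mu) (t.val - o) else t.val

/-- Column analogue of `shiftedRowFn`. -/
def shiftedColFn (N o m : ℕ) (mu : Nat.Partition m) : Fin N → ℕ := fun t =>
  if o ≤ t.val ∧ t.val < o + m then N + listCol (partsList mu) (t.val - o) else t.val

/-- The Young symmetrizer of the partition `mu` of `m`, for the canonical tableau placed on
the block `[o, o+m)` of `{0, …, N−1}`, as an element of the group algebra `K[S_N]`:
`(Σ_{p ∈ row group} p) · (Σ_{q ∈ column group} sgn(q) q)`. -/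
noncomputable def blockYoungSymmetrizer (K : Type) [Field K] (N o m : ℕ)
    (mu : Nat.Partition m) : MonoidAlgebra K (Equiv.Perm (Fin N)) :=
  (∑ p : stabSubgroup N (shiftedRowFn N o m mu),
      MonoidAlgebra.single (p : Equiv.Perm (Fin N)) (1 : K)) *
  (∑ q : stabSubgroup N (shiftedColFn N o m mu),
      MonoidAlgebra.single (q : Equiv.Perm (Fin N))
        ((Equiv.Perm.sign (q : Equiv.Perm (Fin N)) : ℤ) : K))

/-- The Specht module of the partition `lam` of `n`, realized as the left ideal
`K[Sₙ]·e_lam` of the group algebra generated by the Young symmetrizer of `lam`,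
i.e. as a module over the group algebra `K[Sₙ]` (equivalently, a representation of `Sₙ`). -/
noncomputable def spechtIdeal (K : Type) [Field K] (n : ℕ) (lam : Nat.Partition n) :
    Submodule (MonoidAlgebra K (Equiv.Perm (Fin n))) (MonoidAlgebra K (Equiv.Perm (Fin n))) :=
  Submodule.span _ {blockYoungSymmetrizer K n 0 n lam}

/-- The Specht module of `lam ⊢ n` as an object of the category `Rep K Sₙ` of
representations of the symmetric group, via the equivalence of `Rep K Sₙ` with the category
of modules over the group algebra. -/
noncomputable def specht (K : Type) [Field K] (n : ℕ) (lam : Nat.Partition n) :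
    Rep K (Equiv.Perm (Fin n)) :=
  Rep.equivalenceModuleMonoidAlgebra.inverse.obj
    (ModuleCat.of (MonoidAlgebra K (Equiv.Perm (Fin n))) (spechtIdeal K n lam))

/-- The Kronecker coefficient `g(λ,μ,ν)`: the multiplicity of the Specht module `S_ν` in
`S_λ ⊗ S_μ` (diagonal `Sₙ`-action), computed (over a field of characteristic zero, where
the Specht modules are absolutely irreducible) as `dim Hom_{Sₙ}(S_ν, S_λ ⊗ S_μ)`. -/
noncomputable def kron (K : Type) [Field K] {n : ℕ} (lam mu nu : Nat.Partition n) : ℕ :=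
  Module.finrank K (specht K n nu ⟶ specht K n lam ⊗ specht K n mu)

/-- The permutation representation `M(m₁,…,m₄) = Ind_{S_{m₁}×⋯×S_{m₄}}^{Sₙ} 𝟏` of `Sₙ`
associated to a composition `c = [m₁,…,m₄]` of `n`: the linearization of the action of `Sₙ`
on the cosets of the Young subgroup `S_{m₁}×⋯×S_{m₄}` (the stabilizer of the division of
`{0,…,n−1}` into consecutive blocks of sizes `m₁,…,m₄`). -/
noncomputable def youngPermRep (K : Type) [Field K] (n : ℕ) (c : List ℕ) :
    Rep K (Equiv.Perm (Fin n)) :=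
  Rep.ofMulAction K (Equiv.Perm (Fin n))
    (Equiv.Perm (Fin n) ⧸ stabSubgroup n (fun t => listBlock c t.val))

attribute [local instance] CategoryTheory.Abelian.hasFiniteBiproducts


section IsoClasses

variable {K G : Type} [Field K] [Group G]

/-- Isomorphism classes of representations, an additive monoid under direct sum. -/
def RepClass (K G : Type) [Field K] [Group G] : Type 1 :=
  Quotient (isIsomorphicSetoid (Rep.{0} K G))

/-- The isomorphism class of a representation. -/
def repClass (X : Rep.{0} K G) : RepClass K G := Quotient.mk _ X

theorem repClass_eq_iff {X Y : Rep.{0} K G} : repClass X = repClass Y ↔ Nonempty (X ≅ Y) :=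
  Quotient.eq

theorem repClass_eq_of_iso {X Y : Rep.{0} K G} (e : X ≅ Y) : repClass X = repClass Y :=
  repClass_eq_iff.2 ⟨e⟩

noncomputable instance : Add (RepClass K G) where
  add := Quotient.map₂ (fun X Y => X ⊞ Y) (fun _ _ ⟨e⟩ _ _ ⟨f⟩ => ⟨biprod.mapIso e f⟩)

noncomputable instance : Zero (RepClass K G) where
  zero := repClass (Rep.trivial K G PUnit)

noncomputable instance : AddCommMonoid (RepClass K G) where
  add_assoc := by
    rintro ⟨X⟩ ⟨Y⟩ ⟨Z⟩
    exact repClass_eq_of_iso (biprod.associator X Y Z)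
  zero_add := by
    rintro ⟨X⟩
    exact repClass_eq_of_iso (isoZeroBiprod ((Rep.isZero_iff _ _ _).2 inferInstance)).symm
  add_zero := by
    rintro ⟨X⟩
    exact repClass_eq_of_iso (isoBiprodZero ((Rep.isZero_iff _ _ _).2 inferInstance)).symm
  add_comm := by
    rintro ⟨X⟩ ⟨Y⟩
    exact repClass_eq_of_iso (biprod.braiding X Y)
  nsmul := nsmulRec

theorem repClass_biprod (X Y : Rep.{0} K G) : repClass (X ⊞ Y) = repClass X + repClass Y := rfl

theorem repClass_of_isZero {X : Rep.{0} K G} (h : IsZero X) : repClass X = 0 :=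
  repClass_eq_of_iso (h.iso ((Rep.isZero_iff _ _ _).2 inferInstance))

theorem repClass_biproduct {J : Type} [Fintype J] (f : J → Rep.{0} K G) :
    repClass (⨁ f) = ∑ j, repClass (f j) := by
  classical
  refine Fintype.induction_empty_option
    (P := fun J _ => ∀ f : J → Rep.{0} K G, repClass (⨁ f) = ∑ j, repClass (f j)) ?_ ?_ ?_ J f
  · intro α β _ e ih f
    let _ : Fintype α := Fintype.ofEquiv β e.symm
    rw [← e.sum_comp, ← ih]
    exact repClass_eq_of_iso (biproduct.reindex e f).symm
  · intro f
    simp only [Finset.univ_eq_empty, Finset.sum_empty]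
    apply repClass_of_isZero
    rw [IsZero.iff_id_eq_zero]
    ext j
    exact j.elim
  · intro α _ ih f
    rw [Fintype.sum_option, ← ih, ← repClass_biprod]
    refine repClass_eq_of_iso
      { hom := biprod.lift (biproduct.π f none) (biproduct.lift fun a => biproduct.π f (some a))
        inv := biprod.desc (biproduct.ι f none) (biproduct.desc fun a => biproduct.ι f (some a))
        hom_inv_id := ?_
        inv_hom_id := ?_ }
    · rw [biprod.lift_desc, biproduct.lift_desc, ← biproduct.total, Fintype.sum_option]
    · apply biprod.hom_ext' <;> apply biprod.hom_ext
      · simp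
      · apply biproduct.hom_ext
        simp
      · apply biproduct.hom_ext'
        simp
      · refine biproduct.hom_ext' _ _ fun a => biproduct.hom_ext _ _ fun b => ?_
        simp [biproduct.ι_π]

/-- A representation whose space splits equivariantly as a product is the sum of the factors. -/
theorem repClass_eq_add {Z X Y : Rep.{0} K G} (e : Z.V ≃ₗ[K] X.V × Y.V)
    (he : ∀ g z, e (Z.ρ g z) = (X.ρ g (e z).1, Y.ρ g (e z).2)) :
    repClass Z = repClass X + repClass Y := by
  have he' : ∀ g x y, e.symm (X.ρ g x, Y.ρ g y) = Z.ρ g (e.symm (x, y)) := fun g x y => by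
    rw [LinearEquiv.symm_apply_eq, he]; simp
  rw [← repClass_biprod]
  let p : Z ⟶ X := Rep.ofHom ⟨LinearMap.fst K X.V Y.V ∘ₗ e.toLinearMap, fun g => by
    ext z; simp [he]⟩
  let q : Z ⟶ Y := Rep.ofHom ⟨LinearMap.snd K X.V Y.V ∘ₗ e.toLinearMap, fun g => by
    ext z; simp [he]⟩
  let i : X ⟶ Z := Rep.ofHom ⟨e.symm.toLinearMap ∘ₗ LinearMap.inl K X.V Y.V, fun g => by
    ext x; simpa using he' g x 0⟩
  let j : Y ⟶ Z := Rep.ofHom ⟨e.symm.toLinearMap ∘ₗ LinearMap.inr K X.V Y.V, fun g => by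
    ext y; simpa using he' g 0 y⟩
  have hp : ∀ z, p.hom z = (e z).1 := fun _ => rfl
  have hq : ∀ z, q.hom z = (e z).2 := fun _ => rfl
  have hi : ∀ x, i.hom x = e.symm (x, 0) := fun _ => rfl
  have hj : ∀ y, j.hom y = e.symm (0, y) := fun _ => rfl
  refine repClass_eq_of_iso ⟨biprod.lift p q, biprod.desc i j, ?_, ?_⟩
  · rw [biprod.lift_desc]
    ext z
    simp [Rep.add_hom, hp, hq, hi, hj, ← map_add]
  · have h1 : i ≫ p = 𝟙 X := by ext x; simp [hp, hi]
    have h2 : j ≫ q = 𝟙 Y := by ext x; simp [hq, hj]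
    have h3 : i ≫ q = 0 := by ext x; simp [hq, hi]
    have h4 : j ≫ p = 0 := by ext x; simp [hp, hj]
    apply biprod.hom_ext' <;> apply biprod.hom_ext <;> simp [h1, h2, h3, h4]

theorem repClass_eq_of_linearEquiv {X Y : Rep.{0} K G} (e : X.V ≃ₗ[K] Y.V)
    (he : ∀ g x, e (X.ρ g x) = Y.ρ g (e x)) : repClass X = repClass Y :=
  repClass_eq_of_iso (Rep.mkIso (Representation.Equiv.mk e fun g => by ext x; exact he g x))

theorem repClass_tensor_congr {X X' Y Y' : Rep.{0} K G} (h : repClass X = repClass X')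
    (h' : repClass Y = repClass Y') : repClass (X ⊗ Y) = repClass (X' ⊗ Y') := by
  obtain ⟨e⟩ := repClass_eq_iff.1 h
  obtain ⟨e'⟩ := repClass_eq_iff.1 h'
  exact repClass_eq_of_iso (e ⊗ᵢ e')

theorem repClass_tensor_comm (X Y : Rep.{0} K G) : repClass (X ⊗ Y) = repClass (Y ⊗ X) :=
  repClass_eq_of_iso (β_ X Y)

theorem repClass_tensor_add {X Y Z : Rep.{0} K G} (W : Rep.{0} K G)
    (h : repClass Z = repClass X + repClass Y) :
    repClass (W ⊗ Z) = repClass (W ⊗ X) + repClass (W ⊗ Y) := by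
  rw [← repClass_biprod] at h ⊢
  rw [repClass_tensor_congr rfl h]
  have := preservesBinaryBiproducts_of_preservesBiproducts (tensorLeft W)
  exact repClass_eq_of_iso ((tensorLeft W).mapBiprod X Y)

theorem repClass_add_tensor {X Y Z : Rep.{0} K G} (W : Rep.{0} K G)
    (h : repClass Z = repClass X + repClass Y) :
    repClass (Z ⊗ W) = repClass (X ⊗ W) + repClass (Y ⊗ W) := by
  rw [repClass_tensor_comm Z, repClass_tensor_comm X, repClass_tensor_comm Y,
    repClass_tensor_add W h]

/-- If `P = Z - S` in the representation ring then `Z² + P² = S² + 2PZ`. -/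
theorem repClass_sq_add_sq {P S Z : Rep.{0} K G} (h : repClass Z = repClass P + repClass S) :
    repClass (Z ⊗ Z) + repClass (P ⊗ P) =
      repClass (S ⊗ S) + (repClass (P ⊗ Z) + repClass (P ⊗ Z)) := by
  rw [repClass_add_tensor Z h, repClass_tensor_add S h, repClass_tensor_comm S P]
  rw [show repClass (P ⊗ Z) + (repClass (P ⊗ S) + repClass (S ⊗ S)) + repClass (P ⊗ P) =
      repClass (S ⊗ S) + (repClass (P ⊗ Z) + (repClass (P ⊗ P) + repClass (P ⊗ S))) by abel,
    ← repClass_tensor_add P h]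

/-- `∑ P_k ⊗ P_k` over `k ≤ n` equals `∑ S_j ⊗ S_j + ∑ P_k ⊗ P_{k+1}` when `P` is symmetric
and its first differences up to the middle are the `S_j`. -/
theorem sum_repClass_sq (P S : ℕ → Rep.{0} K G) (n : ℕ) (h0 : repClass (P 0) = repClass (S 0))
    (hs : ∀ k, 2 * (k + 1) ≤ n → repClass (P (k + 1)) = repClass (P k) + repClass (S (k + 1)))
    (hr : ∀ k ≤ n, repClass (P (n - k)) = repClass (P k)) :
    ∑ k ∈ Finset.range (n + 1), repClass (P k ⊗ P k) =
      ∑ j ∈ Finset.range (n / 2 + 1), repClass (S j ⊗ S j) +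
        ∑ k ∈ Finset.range n, repClass (P k ⊗ P (k + 1)) := by
  have key : ∀ m, 2 * m ≤ n →
      ∑ k ∈ Finset.range (m + 1), repClass (P k ⊗ P k) +
        ∑ k ∈ Finset.range m, repClass (P k ⊗ P k) =
      ∑ j ∈ Finset.range (m + 1), repClass (S j ⊗ S j) +
        (∑ k ∈ Finset.range m, repClass (P k ⊗ P (k + 1)) +
          ∑ k ∈ Finset.range m, repClass (P k ⊗ P (k + 1))) := by
    intro m
    induction m with
    | zero => intro _; simp [repClass_tensor_congr h0 h0]
    | succ m ih =>
      intro hm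
      rw [Finset.sum_range_succ _ (m + 1), Finset.sum_range_succ _ (m + 1),
        Finset.sum_range_succ (fun k => repClass (P k ⊗ P (k + 1))) m]
      nth_rw 2 [Finset.sum_range_succ]
      have h1 := ih (by omega)
      have h2 := repClass_sq_add_sq (hs m hm)
      calc _ = (∑ k ∈ Finset.range (m + 1), repClass (P k ⊗ P k) +
            ∑ k ∈ Finset.range m, repClass (P k ⊗ P k)) +
            (repClass (P (m + 1) ⊗ P (m + 1)) + repClass (P m ⊗ P m)) := by abel
        _ = _ := by rw [h1, h2]; abel
  have hsq : ∀ a b, a + b = n →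
      ∑ k ∈ Finset.range a, repClass (P (b + 1 + k) ⊗ P (b + 1 + k)) =
        ∑ k ∈ Finset.range a, repClass (P k ⊗ P k) := by
    intro a b hab
    rw [← Finset.sum_range_reflect]
    refine Finset.sum_congr rfl fun k hk => ?_
    have hk := Finset.mem_range.1 hk
    have := hr k (by omega)
    rw [show b + 1 + (a - 1 - k) = n - k by omega]
    exact repClass_tensor_congr this this
  have hcr : ∀ a b, a + b = n →
      ∑ k ∈ Finset.range a, repClass (P (b + k) ⊗ P (b + k + 1)) =
        ∑ k ∈ Finset.range a, repClass (P k ⊗ P (k + 1)) := by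
    intro a b hab
    rw [← Finset.sum_range_reflect]
    refine Finset.sum_congr rfl fun k hk => ?_
    have hk := Finset.mem_range.1 hk
    have h1 := hr k (by omega)
    have h2 := hr (k + 1) (by omega)
    rw [show b + (a - 1 - k) = n - (k + 1) by omega, show n - (k + 1) + 1 = n - k by omega,
      repClass_tensor_comm]
    exact repClass_tensor_congr h1 h2
  obtain ⟨m, hm⟩ : ∃ m, m = n / 2 := ⟨_, rfl⟩
  have hlast : ∀ a b, a + b = n →
      ∑ k ∈ Finset.range n, repClass (P k ⊗ P (k + 1)) =
        ∑ k ∈ Finset.range b, repClass (P k ⊗ P (k + 1)) +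
          ∑ k ∈ Finset.range a, repClass (P k ⊗ P (k + 1)) := by
    intro a b hab
    rw [← hcr a b hab, ← Finset.sum_range_add, add_comm b a, hab]
  rw [← hm]
  have hk := key m (by omega)
  rcases Nat.even_or_odd' n with ⟨m', h | h⟩
  · obtain rfl : m' = m := by omega
    rw [show n + 1 = (m' + 1) + m' by omega, Finset.sum_range_add, hsq m' m' (by omega), hk]
    rw [hlast m' m' (by omega)]
  · obtain rfl : m' = m := by omega
    rw [show n + 1 = (m' + 1) + (m' + 1) by omega, Finset.sum_range_add,
      hsq (m' + 1) m' (by omega)]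
    nth_rw 2 [Finset.sum_range_succ]
    rw [← add_assoc, hk]
    rw [hlast m' (m' + 1) (by omega),
      Finset.sum_range_succ (fun k => repClass (P k ⊗ P (k + 1))) m']
    have : repClass (P (m' + 1)) = repClass (P m') := by
      rw [← hr m' (by omega)]; congr 2; omega
    rw [repClass_tensor_congr (rfl : repClass (P m') = _) this]
    abel

end IsoClasses

section PermutationRepresentations

variable {K G : Type} [Field K] [Group G]

theorem repClass_eq_sum {J : Type} [Fintype J] {Z : Rep.{0} K G} (X : J → Rep.{0} K G)
    (e : Z.V ≃ₗ[K] ∀ j, (X j).V) (he : ∀ g z j, e (Z.ρ g z) j = (X j).ρ g (e z j)) :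
    repClass Z = ∑ j, repClass (X j) := by
  classical
  have he' : ∀ g j x, e.symm (Pi.single j ((X j).ρ g x)) = Z.ρ g (e.symm (Pi.single j x)) := by
    intro g j x
    rw [LinearEquiv.symm_apply_eq]
    funext i
    rw [he, LinearEquiv.apply_symm_apply]
    exact (Pi.apply_single (fun i => (X i).ρ g) (fun i => map_zero _) j x i).symm
  let p : ∀ j, Z ⟶ X j := fun j => Rep.ofHom ⟨LinearMap.proj j ∘ₗ e.toLinearMap, fun g => by
    ext z; simp [he]⟩
  let i : ∀ j, X j ⟶ Z := fun j =>
    Rep.ofHom ⟨e.symm.toLinearMap ∘ₗ LinearMap.single K (fun j => (X j).V) j, fun g => by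
      ext x; simpa using he' g j x⟩
  have hp : ∀ j z, (p j).hom z = e z j := fun _ _ => rfl
  have hi : ∀ j x, (i j).hom x = e.symm (Pi.single j x) := fun _ _ => rfl
  rw [← repClass_biproduct]
  refine repClass_eq_of_iso ⟨biproduct.lift p, biproduct.desc i, ?_, ?_⟩
  · rw [biproduct.lift_desc]
    ext z
    have : ∑ j, (p j ≫ i j).hom z = z := by
      simp only [Rep.hom_comp, Representation.IntertwiningMap.comp_apply, hp, hi]
      rw [← map_sum, Finset.univ_sum_single, LinearEquiv.symm_apply_apply]
    simpa [Rep.sum_hom, Representation.IntertwiningMap.sum_apply] using this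
  · refine biproduct.hom_ext' _ _ fun a => biproduct.hom_ext _ _ fun b => ?_
    have : i a ≫ p b = biproduct.ι X a ≫ biproduct.π X b := by
      rw [biproduct.ι_π]
      split_ifs with h
      · subst h
        ext x
        simp [hp, hi]
      · ext x
        simp [hp, hi, Pi.single_eq_of_ne (Ne.symm h)]
    simpa using this

theorem repClass_ofMulAction_sigma {J Z : Type} [Fintype J] [MulAction G Z] (Y : J → Type)
    [∀ j, MulAction G (Y j)] (e : (Σ j, Y j) ≃ Z) (he : ∀ (g : G) j y, e ⟨j, g • y⟩ = g • e ⟨j, y⟩) :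
    repClass (Rep.ofMulAction K G Z) = ∑ j, repClass (Rep.ofMulAction K G (Y j)) := by
  refine repClass_eq_sum _ (MonoidAlgebra.coeffLinearEquiv K ≪≫ₗ Finsupp.domLCongr e.symm ≪≫ₗ
    Finsupp.sigmaFinsuppLEquivPiFinsupp K ≪≫ₗ
    LinearEquiv.piCongrRight fun j => (MonoidAlgebra.coeffLinearEquiv K).symm) fun g z j => ?_
  ext y
  have := he g⁻¹ j y
  simp [Representation.coeff_ofMulAction, Finsupp.domLCongr, this]

theorem repClass_ofMulAction_congr {Y Z : Type} [MulAction G Y] [MulAction G Z] (e : Y ≃ Z)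
    (he : ∀ (g : G) y, e (g • y) = g • e y) :
    repClass (Rep.ofMulAction K G Y) = repClass (Rep.ofMulAction K G Z) := by
  refine repClass_eq_of_linearEquiv (MonoidAlgebra.mapDomainLinearEquiv _ _ e) fun g y => ?_
  induction y using MonoidAlgebra.induction_linear with
  | zero => simp
  | add x y hx hy => simp only [map_add, hx, hy]
  | single x r => simp [he]

theorem repClass_ofMulAction_prod (Y Z : Type) [MulAction G Y] [MulAction G Z] :
    repClass (Rep.ofMulAction K G (Y × Z)) =
      repClass (Rep.ofMulAction K G Y ⊗ Rep.ofMulAction K G Z) := by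
  refine repClass_eq_of_linearEquiv
    (Y := Rep.ofMulAction K G Y ⊗ Rep.ofMulAction K G Z)
    (MonoidAlgebra.tensorEquiv K (M := Y) (N := Z)).symm fun g x => ?_
  induction x using MonoidAlgebra.induction_linear with
  | zero => simp
  | add x y hx hy => simp only [map_add, hx, hy]
  | single x r =>
    have : ∀ (x : Y × Z) (r : K), (MonoidAlgebra.tensorEquiv K).symm (MonoidAlgebra.single x r) =
      MonoidAlgebra.single x.1 1 ⊗ₜ MonoidAlgebra.single x.2 r :=
      MonoidAlgebra.tensorEquiv_symm_single_eq_single_one_tmul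
    simp [this]

end PermutationRepresentations

section YoungPermutationRepresentations

open scoped Pointwise

theorem exists_perm_comp_eq {α ι : Type*} [Fintype α] [DecidableEq ι] (c c' : α → ι)
    (h : ∀ i, (Finset.univ.filter fun a => c a = i).card =
      (Finset.univ.filter fun a => c' a = i).card) :
    ∃ σ : Equiv.Perm α, ∀ a, c' (σ a) = c a := by
  have e : ∀ i, Nonempty ({a // c a = i} ≃ {a // c' a = i}) := fun i => by
    rw [← Fintype.card_eq, Fintype.card_subtype, Fintype.card_subtype]
    exact h i
  exact ⟨Equiv.ofFiberEquiv fun i => (e i).some, fun a => Equiv.ofFiberEquiv_map _ a⟩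

theorem exists_perm_smul_pair {α : Type*} [Fintype α] [DecidableEq α] {A B A' B' : Finset α}
    (hA : A.card = A'.card) (hB : B.card = B'.card) (hAB : (A ∩ B).card = (A' ∩ B').card) :
    ∃ σ : Equiv.Perm α, σ • A = A' ∧ σ • B = B' := by
  obtain ⟨σ, hσ⟩ := exists_perm_comp_eq (fun a => (decide (a ∈ A), decide (a ∈ B)))
    (fun a => (decide (a ∈ A'), decide (a ∈ B'))) (by
      have h1 := Finset.card_sdiff_add_card_inter A B
      have h2 := Finset.card_sdiff_add_card_inter A' B'
      have h3 := Finset.card_sdiff_add_card_inter B A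
      have h4 := Finset.card_sdiff_add_card_inter B' A'
      have h5 := Finset.card_union_add_card_inter A B
      have h6 := Finset.card_union_add_card_inter A' B'
      have h7 := Finset.card_add_card_compl (A ∪ B)
      have h8 := Finset.card_add_card_compl (A' ∪ B')
      rw [Finset.inter_comm] at h3 h4
      rintro ⟨_ | _, _ | _⟩
      · convert (by omega : (A ∪ B)ᶜ.card = (A' ∪ B')ᶜ.card) using 2 <;> ext <;> simp
      · convert (by omega : (B \ A).card = (B' \ A').card) using 2 <;> ext <;> simp [and_comm]
      · convert (by omega : (A \ B).card = (A' \ B').card) using 2 <;> ext <;> simp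
      · convert hAB using 2 <;> ext <;> simp)
  simp only [Prod.mk.injEq, decide_eq_decide] at hσ
  refine ⟨σ, ?_, ?_⟩
  · ext a
    rw [← Finset.inv_smul_mem_iff, ← (hσ _).1]
    simp
  · ext a
    rw [← Finset.inv_smul_mem_iff, ← (hσ _).2]
    simp

/-- The `k`-element subsets of `{0, …, n - 1}`, with the action of `Sₙ`. -/
def subsetsOfCard (n k : ℕ) : SubMulAction (Equiv.Perm (Fin n)) (Finset (Fin n)) where
  carrier := {A | A.card = k}
  smul_mem' σ A hA := by simpa using hA

/-- Pairs of subsets `(A, B)` of `{0, …, n - 1}` with `|B| = |A| + d`, with the action of `Sₙ`. -/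
def subsetPairs (n d : ℕ) :
    SubMulAction (Equiv.Perm (Fin n)) (Finset (Fin n) × Finset (Fin n)) where
  carrier := {p | p.2.card = p.1.card + d}
  smul_mem' σ A hA := by simpa using hA

theorem mem_subsetsOfCard {n k : ℕ} {A : Finset (Fin n)} : A ∈ subsetsOfCard n k ↔ A.card = k :=
  Iff.rfl

theorem mem_subsetPairs {n d : ℕ} {p : Finset (Fin n) × Finset (Fin n)} :
    p ∈ subsetPairs n d ↔ p.2.card = p.1.card + d := Iff.rfl

variable (K : Type) [Field K]

/-- The permutation representation of `Sₙ` on `k`-element subsets. -/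
noncomputable abbrev subsetRep (n k : ℕ) : Rep.{0} K (Equiv.Perm (Fin n)) :=
  Rep.ofMulAction K (Equiv.Perm (Fin n)) (subsetsOfCard n k)

theorem repClass_subsetPairs (n d : ℕ) :
    repClass (Rep.ofMulAction K (Equiv.Perm (Fin n)) (subsetPairs n d)) =
      ∑ k ∈ Finset.range (n + 1 - d), repClass (subsetRep K n k ⊗ subsetRep K n (k + d)) := by
  rw [Finset.sum_range]
  simp_rw [← repClass_ofMulAction_prod]
  refine repClass_ofMulAction_sigma
    (fun k : Fin (n + 1 - d) => subsetsOfCard n k × subsetsOfCard n (k + d))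
    { toFun := fun x => ⟨(x.2.1, x.2.2), by
        rw [mem_subsetPairs, x.2.1.2, x.2.2.2]⟩
      invFun := fun p => ⟨⟨p.1.1.card, by
          have := p.2
          rw [mem_subsetPairs] at this
          have := Finset.card_le_univ p.1.2
          rw [Fintype.card_fin] at this
          omega⟩, ⟨p.1.1, rfl⟩, ⟨p.1.2, p.2⟩⟩
      left_inv := ?_
      right_inv := fun _ => rfl } fun _ _ _ => rfl
  rintro ⟨⟨k, hk⟩, ⟨A, hA⟩, ⟨B, hB⟩⟩
  rw [mem_subsetsOfCard] at hA hB
  subst hA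
  rfl

theorem listBlock_quadruple (a b c d x : ℕ) : listBlock [a, b, c, d] x =
    if x < a then 0 else if x < a + b then 1 else if x < a + b + c then 2 else
      if x < a + b + c + d then 3 else 4 := by
  simp only [listBlock, List.scanl_cons, List.scanl_nil, List.tail_cons, List.countP_cons, List.countP_nil,
    decide_eq_true_eq]
  split_ifs <;> omega

/-- The union of the first and third blocks and the union of the second and third blocks of
`{0, …, n - 1}` divided into consecutive blocks of sizes `i, i + d, j, …`. -/
def blockPair (n d i j : ℕ) : Finset (Fin n) × Finset (Fin n) :=
  (Finset.univ.filter fun x => x.val < i ∨ i + (i + d) ≤ x.val ∧ x.val < i + (i + d) + j,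
    Finset.univ.filter fun x => i ≤ x.val ∧ x.val < i + (i + d) + j)

theorem card_filter_val {n : ℕ} (p : ℕ → Prop) [DecidablePred p] {s : Finset ℕ}
    (h : ∀ x, x ∈ s ↔ x < n ∧ p x) :
    (Finset.univ.filter fun x : Fin n => p x.val).card = s.card := by
  rw [← Finset.card_map Fin.valEmbedding]
  congr 1
  ext x
  rw [h]
  simp only [Finset.mem_map, Finset.mem_filter, Finset.mem_univ, true_and, Fin.valEmbedding_apply]
  exact ⟨fun ⟨y, hy, hyx⟩ => hyx ▸ ⟨y.2, hy⟩, fun ⟨hx, hp⟩ => ⟨⟨x, hx⟩, hp, rfl⟩⟩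

theorem card_blockPair {n d i j : ℕ} (h : i + (i + d) + j ≤ n) :
    (blockPair n d i j).1.card = i + j ∧ (blockPair n d i j).2.card = i + d + j ∧
      ((blockPair n d i j).1 ∩ (blockPair n d i j).2).card = j := by
  refine ⟨?_, ?_, ?_⟩
  · refine (card_filter_val (fun x => x < i ∨ i + (i + d) ≤ x ∧ x < i + (i + d) + j)
      (s := Finset.range i ∪ Finset.Ico (i + (i + d)) (i + (i + d) + j))
      (fun x => by simp; omega)).trans ?_
    rw [Finset.card_union_of_disjoint (Finset.disjoint_left.2 fun x => by simp; omega)]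
    simp
  · refine (card_filter_val (fun x => i ≤ x ∧ x < i + (i + d) + j)
      (s := Finset.Ico i (i + (i + d) + j)) (fun x => by simp; omega)).trans ?_
    simp; omega
  · rw [blockPair, ← Finset.filter_and]
    refine (card_filter_val (fun x => (x < i ∨ i + (i + d) ≤ x ∧ x < i + (i + d) + j) ∧
      i ≤ x ∧ x < i + (i + d) + j) (s := Finset.Ico (i + (i + d)) (i + (i + d) + j))
      (fun x => by simp; omega)).trans ?_
    simp

theorem perm_smul_finset_eq_self_iff {α : Type*} [DecidableEq α] (σ : Equiv.Perm α)
    (A : Finset α) : σ • A = A ↔ ∀ x, σ x ∈ A ↔ x ∈ A := by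
  constructor
  · intro h x
    conv_lhs => rw [← h]
    exact Finset.smul_mem_smul_finset_iff σ
  · intro h
    ext x
    rw [← Finset.inv_smul_mem_iff, ← h]
    simp

theorem mem_stabSubgroup_listBlock_iff {n d i j l : ℕ} (h : i + (i + d) + j + l = n)
    (σ : Equiv.Perm (Fin n)) :
    σ ∈ stabSubgroup n (fun x => listBlock [i, i + d, j, l] x.val) ↔
      σ • blockPair n d i j = blockPair n d i j := by
  have h1 : σ ∈ stabSubgroup n (fun x => listBlock [i, i + d, j, l] x.val) ↔
    ∀ x, listBlock [i, i + d, j, l] (σ x).val = listBlock [i, i + d, j, l] x.val := Iff.rfl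
  rw [h1, Prod.ext_iff, Prod.smul_fst, Prod.smul_snd, perm_smul_finset_eq_self_iff,
    perm_smul_finset_eq_self_iff, ← forall_and]
  refine forall_congr' fun x => ?_
  have := (σ x).2
  have := x.2
  simp only [listBlock_quadruple, blockPair, Finset.mem_filter, Finset.mem_univ, true_and]
  grind

theorem repClass_subsetPairs_eq_sum_youngPermRep (n d : ℕ) :
    repClass (Rep.ofMulAction K (Equiv.Perm (Fin n)) (subsetPairs n d)) =
      ∑ t : {t : Fin (n + 1) × Fin (n + 1) × Fin (n + 1) //
            2 * t.1.val + d + t.2.1.val + t.2.2.val = n},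
        repClass (youngPermRep K n [t.1.1.val, t.1.1.val + d, t.1.2.1.val, t.1.2.2.val]) := by

  classical
  let p : {t : Fin (n + 1) × Fin (n + 1) × Fin (n + 1) //
      2 * t.1.val + d + t.2.1.val + t.2.2.val = n} → Finset (Fin n) × Finset (Fin n) :=
    fun t => blockPair n d t.1.1 t.1.2.1
  have hp : ∀ t, (p t).1.card = t.1.1 + t.1.2.1 ∧ (p t).2.card = t.1.1 + d + t.1.2.1 ∧
      ((p t).1 ∩ (p t).2).card = t.1.2.1 := fun t => card_blockPair (by have := t.2; omega)
  have hs : ∀ t σ, σ ∈ stabSubgroup n (fun x => listBlock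
      [t.1.1.val, t.1.1.val + d, t.1.2.1.val, t.1.2.2.val] x.val) ↔ σ • p t = p t :=
    fun t σ => mem_stabSubgroup_listBlock_iff (by have := t.2; omega) σ
  let f : (Σ t : {t : Fin (n + 1) × Fin (n + 1) × Fin (n + 1) //
      2 * t.1.val + d + t.2.1.val + t.2.2.val = n}, Equiv.Perm (Fin n) ⧸
        stabSubgroup n (fun x => listBlock
          [t.1.1.val, t.1.1.val + d, t.1.2.1.val, t.1.2.2.val] x.val)) → subsetPairs n d :=
    fun x => Quotient.liftOn' x.2
      (fun g => g • (⟨p x.1, by rw [mem_subsetPairs, (hp _).1, (hp _).2.1]; omega⟩ :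
        subsetPairs n d)) fun g g' h => by
        rw [QuotientGroup.leftRel_apply, hs, mul_smul, inv_smul_eq_iff] at h
        exact Subtype.ext h.symm
  have hf : ∀ t (g : Equiv.Perm (Fin n)), (f ⟨t, (g : Equiv.Perm (Fin n) ⧸ _)⟩).1 = g • p t :=
    fun _ _ => rfl
  refine repClass_ofMulAction_sigma _ (Equiv.ofBijective f ⟨?_, ?_⟩) ?_
  · rintro ⟨t, x⟩ ⟨t', x'⟩ h
    induction x using QuotientGroup.induction_on with | _ g
    induction x' using QuotientGroup.induction_on with | _ g'
    have h := congrArg Subtype.val h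
    rw [hf, hf] at h
    obtain rfl : t = t' := by
      have h1 := congrArg (fun q => q.1.card) h
      have h2 := congrArg (fun q => (q.1 ∩ q.2).card) h
      simp only [Prod.smul_fst, Prod.smul_snd, ← Finset.smul_finset_inter,
        Finset.card_smul_finset, hp] at h1 h2
      have := t.2
      have := t'.2
      ext <;> omega
    rw [Sigma.mk.inj_iff]
    refine ⟨rfl, heq_of_eq ?_⟩
    rw [QuotientGroup.eq, hs, mul_smul, ← h, inv_smul_smul]
  · rintro ⟨⟨A, B⟩, h⟩
    rw [mem_subsetPairs] at h
    have h1 := Finset.card_sdiff_add_card_inter A B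
    have h2 := Finset.card_union_add_card_inter A B
    have h3 := Finset.card_add_card_compl (A ∪ B)
    have h4 := Finset.card_le_univ (A ∪ B)
    rw [Fintype.card_fin] at h3
    dsimp only at h
    obtain ⟨t, ht⟩ : ∃ t : {t : Fin (n + 1) × Fin (n + 1) × Fin (n + 1) //
        2 * t.1.val + d + t.2.1.val + t.2.2.val = n},
        t.1.1.val = (A \ B).card ∧ t.1.2.1.val = (A ∩ B).card :=
      ⟨⟨(⟨(A \ B).card, by omega⟩, ⟨(A ∩ B).card, by omega⟩, ⟨(A ∪ B)ᶜ.card, by omega⟩),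
        by dsimp only; omega⟩, rfl, rfl⟩
    obtain ⟨σ, hA, hB⟩ := exists_perm_smul_pair (A := (p t).1) (B := (p t).2) (A' := A) (B' := B)
      (by rw [(hp t).1]; omega) (by rw [(hp t).2.1]; omega) (by rw [(hp t).2.2]; omega)
    exact ⟨⟨t, (σ : Equiv.Perm (Fin n) ⧸ _)⟩, Subtype.ext ((hf t σ).trans (Prod.ext hA hB))⟩
  · intro g t x
    induction x using QuotientGroup.induction_on with | _ g'
    exact Subtype.ext (mul_smul g g' (p t))

end YoungPermutationRepresentations

section SubsetLattice

open scoped Pointwise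

section Operators

variable {α K : Type*} [Field K]

/-- The functions on the subset lattice supported on `k`-element subsets. -/
def cardSubmodule (α K : Type*) [Field K] (k : ℕ) : Submodule K (Finset α → K) where
  carrier := {f | ∀ A, A.card ≠ k → f A = 0}
  zero_mem' _ _ := rfl
  add_mem' hf hg A hA := by rw [Pi.add_apply, hf A hA, hg A hA, add_zero]
  smul_mem' c f hf A hA := by rw [Pi.smul_apply, hf A hA, smul_zero]

variable [DecidableEq α]

/-- The raising operator on functions on the subset lattice. -/
def raiseOp (α K : Type*) [DecidableEq α] [Field K] :
    (Finset α → K) →ₗ[K] (Finset α → K) where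
  toFun f A := ∑ b ∈ A, f (A.erase b)
  map_add' f g := by ext A; simp [Finset.sum_add_distrib]
  map_smul' c f := by ext A; simp [Finset.mul_sum]

theorem raiseOp_apply (f : Finset α → K) (A : Finset α) :
    raiseOp α K f A = ∑ b ∈ A, f (A.erase b) := rfl

theorem raiseOp_mem {k : ℕ} {f : Finset α → K} (hf : f ∈ cardSubmodule α K k) :
    raiseOp α K f ∈ cardSubmodule α K (k + 1) := by
  intro A hA
  refine Finset.sum_eq_zero fun b hb => hf _ fun h => hA ?_
  have := Finset.card_erase_add_one hb
  omega

variable [Fintype α]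

/-- The lowering operator on functions on the subset lattice. -/
def lowerOp (α K : Type*) [Fintype α] [DecidableEq α] [Field K] :
    (Finset α → K) →ₗ[K] (Finset α → K) where
  toFun f A := ∑ b ∈ Aᶜ, f (insert b A)
  map_add' f g := by ext A; simp [Finset.sum_add_distrib]
  map_smul' c f := by ext A; simp [Finset.mul_sum]

theorem lowerOp_apply (f : Finset α → K) (A : Finset α) :
    lowerOp α K f A = ∑ b ∈ Aᶜ, f (insert b A) := rfl

theorem lowerOp_mem {k : ℕ} {f : Finset α → K} (hf : f ∈ cardSubmodule α K (k + 1)) :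
    lowerOp α K f ∈ cardSubmodule α K k := by
  intro A hA
  refine Finset.sum_eq_zero fun b hb => hf _ fun h => hA ?_
  rw [Finset.card_insert_of_notMem (Finset.mem_compl.1 hb)] at h
  omega

theorem lowerOp_eq_zero_of_mem_zero {f : Finset α → K} (hf : f ∈ cardSubmodule α K 0) :
    lowerOp α K f = 0 := by
  ext A
  exact Finset.sum_eq_zero fun b _ => hf _ (by simp)

theorem lowerOp_raiseOp (f : Finset α → K) (B : Finset α) :
    lowerOp α K (raiseOp α K f) B + B.card • f B =
      raiseOp α K (lowerOp α K f) B + Bᶜ.card • f B := by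
  have h1 : lowerOp α K (raiseOp α K f) B =
      Bᶜ.card • f B + ∑ b ∈ Bᶜ, ∑ c ∈ B, f (insert b (B.erase c)) := by
    rw [lowerOp_apply, ← Finset.sum_const, ← Finset.sum_add_distrib]
    refine Finset.sum_congr rfl fun b hb => ?_
    rw [Finset.mem_compl] at hb
    rw [raiseOp_apply, Finset.sum_insert hb, Finset.erase_insert hb]
    congr 1
    refine Finset.sum_congr rfl fun c hc => ?_
    rw [Finset.erase_insert_of_ne (by rintro rfl; exact hb hc)]
  have h2 : raiseOp α K (lowerOp α K f) B =
      B.card • f B + ∑ c ∈ B, ∑ b ∈ Bᶜ, f (insert b (B.erase c)) := by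
    rw [raiseOp_apply, ← Finset.sum_const, ← Finset.sum_add_distrib]
    refine Finset.sum_congr rfl fun c hc => ?_
    rw [lowerOp_apply, Finset.compl_erase, Finset.sum_insert (by simpa using hc),
      Finset.insert_erase hc]
  rw [h1, h2, Finset.sum_comm]
  ring

theorem lowerOp_raiseOp_of_mem {k : ℕ} (hk : k ≤ Fintype.card α) {f : Finset α → K}
    (hf : f ∈ cardSubmodule α K k) :
    lowerOp α K (raiseOp α K f) =
      raiseOp α K (lowerOp α K f) + (((Fintype.card α : ℕ) : K) - 2 * (k : K)) • f := by
  ext B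
  have h := lowerOp_raiseOp f B
  by_cases hB : B.card = k
  · rw [Finset.card_compl, hB, nsmul_eq_mul, nsmul_eq_mul, Nat.cast_sub hk] at h
    rw [Pi.add_apply, Pi.smul_apply, smul_eq_mul]
    linear_combination h
  · simp only [hf B hB, smul_zero, add_zero] at h
    simp [h, hf B hB]

theorem eq_zero_of_lowerOp_raiseOp_add [CharZero K] (c k : ℕ) (hk : 2 * k < Fintype.card α)
    {f : Finset α → K} (hf : f ∈ cardSubmodule α K k)
    (h : lowerOp α K (raiseOp α K f) + c • f = 0) : f = 0 := by
  have key : ∀ c k : ℕ, 2 * k < Fintype.card α → ∀ f ∈ cardSubmodule α K k,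
      lowerOp α K (raiseOp α K f) + c • f = 0 → lowerOp α K f = 0 → f = 0 := by
    intro c k hk f hf h h0
    rw [lowerOp_raiseOp_of_mem (by omega) hf, h0, map_zero, zero_add, ← Nat.cast_smul_eq_nsmul K,
      ← add_smul] at h
    refine (smul_eq_zero.1 h).resolve_left ?_
    obtain ⟨d, hd⟩ := Nat.exists_eq_add_of_lt hk
    rw [hd, show ((2 * k + d + 1 : ℕ) : K) - 2 * (k : K) + (c : K) = ((d + 1 + c : ℕ) : K) by
      push_cast; ring]
    exact Nat.cast_ne_zero.2 (by omega)
  induction k generalizing f c with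
  | zero => exact key c 0 hk f hf h (lowerOp_eq_zero_of_mem_zero hf)
  | succ k ih =>
    refine key c _ hk f hf h ?_
    obtain ⟨d, hd⟩ := Nat.exists_eq_add_of_lt hk
    have h' := h
    rw [lowerOp_raiseOp_of_mem (by omega) hf] at h'
    have h2 := congrArg (lowerOp α K) h'
    refine ih (d + 1 + c) (by omega) (lowerOp_mem hf) ?_
    rw [map_zero, map_add, map_add, map_smul, map_nsmul, add_assoc, ← Nat.cast_smul_eq_nsmul K,
      ← add_smul, hd] at h2
    rw [← Nat.cast_smul_eq_nsmul K, ← h2]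
    congr 2
    push_cast
    ring

end Operators

section Representations

variable (K : Type) [Field K] (n : ℕ)

/-- The representation of `Sₙ` on functions on the subset lattice of `{0, …, n - 1}`. -/
noncomputable def subsetFunRho :
    Representation K (Equiv.Perm (Fin n)) (Finset (Fin n) → K) where
  toFun g := LinearMap.funLeft K K (g⁻¹ • ·)
  map_one' := by ext f A; simp [LinearMap.funLeft_apply]
  map_mul' g h := by ext f A; simp [LinearMap.funLeft_apply, mul_smul]

/-- The representation of `Sₙ` on functions on the subset lattice of `{0, …, n - 1}`. -/
noncomputable abbrev subsetFunRep : Rep.{0} K (Equiv.Perm (Fin n)) := Rep.of (subsetFunRho K n)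

variable {K n}

theorem subsetFunRho_apply (g : Equiv.Perm (Fin n)) (f : Finset (Fin n) → K)
    (A : Finset (Fin n)) : subsetFunRho K n g f A = f (g⁻¹ • A) := rfl

theorem smul_finset_erase {α : Type*} [DecidableEq α] (g : Equiv.Perm α) (A : Finset α) (b : α) :
    g • A.erase b = (g • A).erase (g • b) := by
  rw [← Finset.sdiff_singleton_eq_erase, ← Finset.sdiff_singleton_eq_erase,
    Finset.smul_finset_sdiff, Finset.smul_finset_singleton]

theorem smul_finset_compl {α : Type*} [Fintype α] [DecidableEq α] (g : Equiv.Perm α)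
    (A : Finset α) : g • Aᶜ = (g • A)ᶜ := by
  rw [Finset.compl_eq_univ_sdiff, Finset.compl_eq_univ_sdiff, Finset.smul_finset_sdiff,
    Finset.smul_finset_univ]

theorem raiseOp_subsetFunRho (g : Equiv.Perm (Fin n)) (f : Finset (Fin n) → K) :
    raiseOp (Fin n) K (subsetFunRho K n g f) = subsetFunRho K n g (raiseOp (Fin n) K f) := by
  ext A
  simp only [subsetFunRho_apply, raiseOp_apply, smul_finset_erase]
  rw [← Finset.image_smul (a := g⁻¹), Finset.sum_image (MulAction.injective g⁻¹).injOn]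

theorem lowerOp_subsetFunRho (g : Equiv.Perm (Fin n)) (f : Finset (Fin n) → K) :
    lowerOp (Fin n) K (subsetFunRho K n g f) = subsetFunRho K n g (lowerOp (Fin n) K f) := by
  ext A
  simp only [subsetFunRho_apply, lowerOp_apply, Finset.smul_finset_insert]
  rw [← smul_finset_compl, ← Finset.image_smul (a := g⁻¹) (s := Aᶜ),
    Finset.sum_image (MulAction.injective g⁻¹).injOn]

theorem cardSubmodule_le_comap (k : ℕ) (g : Equiv.Perm (Fin n)) :
    cardSubmodule (Fin n) K k ≤ (cardSubmodule (Fin n) K k).comap (subsetFunRho K n g) :=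
  fun f hf A hA => hf _ (by rwa [Finset.card_smul_finset])

variable (K n) in
/-- The `k`-th homogeneous component of the functions on the subset lattice. -/
noncomputable abbrev cardRep (k : ℕ) : Rep.{0} K (Equiv.Perm (Fin n)) :=
  (subsetFunRep K n).subrepresentation (cardSubmodule (Fin n) K k) (cardSubmodule_le_comap k)

variable (K n) in
/-- The functions on `k`-element subsets annihilated by the lowering operator. -/
def harmonicSubmodule (k : ℕ) : Submodule K (Finset (Fin n) → K) :=
  cardSubmodule (Fin n) K k ⊓ LinearMap.ker (lowerOp (Fin n) K)

theorem harmonicSubmodule_le_comap (k : ℕ) (g : Equiv.Perm (Fin n)) :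
    harmonicSubmodule K n k ≤ (harmonicSubmodule K n k).comap (subsetFunRho K n g) :=
  fun f hf => ⟨cardSubmodule_le_comap k g hf.1, by
    rw [SetLike.mem_coe, LinearMap.mem_ker, lowerOp_subsetFunRho, hf.2, map_zero]⟩

variable (K n) in
/-- The representation of `Sₙ` on the harmonic functions on `k`-element subsets. -/
noncomputable abbrev harmonicRep (k : ℕ) : Rep.{0} K (Equiv.Perm (Fin n)) :=
  (subsetFunRep K n).subrepresentation (harmonicSubmodule K n k) (harmonicSubmodule_le_comap k)

theorem repClass_subsetRep_eq_cardRep (k : ℕ) :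
    repClass (subsetRep K n k) = repClass (cardRep K n k) := by
  refine repClass_eq_of_linearEquiv (Y := cardRep K n k)
    { toFun := fun f => ⟨fun A => if h : A.card = k then f.coeff ⟨A, h⟩ else 0,
        fun A hA => dif_neg hA⟩
      invFun := fun f => (MonoidAlgebra.coeffLinearEquiv K).symm
        (Finsupp.equivFunOnFinite.symm fun A => f.1 A.1)
      map_add' := fun f g => ?_
      map_smul' := fun c f => ?_
      left_inv := fun f => ?_
      right_inv := fun f => ?_ } fun g f => ?_
  · ext A
    by_cases h : A.card = k <;> simp [h]
  · ext A
    by_cases h : A.card = k <;> simp [h]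
  · ext ⟨A, hA⟩
    rw [mem_subsetsOfCard] at hA
    simp [hA]
  · ext A
    by_cases h : A.card = k
    · simp [h]
    · simp [h, f.2 A h]
  · ext A
    by_cases h : A.card = k
    · simp [h, Representation.coeff_ofMulAction, subsetFunRho_apply]
      rfl
    · simp [h, subsetFunRho_apply]

theorem repClass_subsetRep_compl {k : ℕ} (hk : k ≤ n) :
    repClass (subsetRep K n (n - k)) = repClass (subsetRep K n k) := by
  refine repClass_ofMulAction_congr
    { toFun := fun A => ⟨A.1ᶜ, ?_⟩
      invFun := fun A => ⟨A.1ᶜ, ?_⟩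
      left_inv := fun A => Subtype.ext (compl_compl _)
      right_inv := fun A => Subtype.ext (compl_compl _) } fun g A => Subtype.ext ?_
  · have := A.2
    rw [mem_subsetsOfCard] at this ⊢
    rw [Finset.card_compl, Fintype.card_fin]
    omega
  · have := A.2
    rw [mem_subsetsOfCard] at this ⊢
    rw [Finset.card_compl, Fintype.card_fin]
    omega
  · exact (smul_finset_compl g A.1).symm

theorem repClass_cardRep_zero : repClass (cardRep K n 0) = repClass (harmonicRep K n 0) := by
  refine repClass_eq_of_linearEquiv (LinearEquiv.ofEq _ _ ?_) fun g f => rfl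
  refine le_antisymm (fun f hf => ⟨hf, ?_⟩) inf_le_left
  exact lowerOp_eq_zero_of_mem_zero hf

variable [CharZero K]

/-- Lowering after raising is bijective below the middle of the subset lattice. -/
theorem exists_lowerOp_raiseOp_eq {k : ℕ} (hk : 2 * k < n) {f : Finset (Fin n) → K}
    (hf : f ∈ cardSubmodule (Fin n) K k) :
    ∃ g ∈ cardSubmodule (Fin n) K k, lowerOp (Fin n) K (raiseOp (Fin n) K g) = f := by
  let T : cardSubmodule (Fin n) K k →ₗ[K] cardSubmodule (Fin n) K k :=
    (lowerOp (Fin n) K ∘ₗ raiseOp (Fin n) K).restrict fun g hg => lowerOp_mem (raiseOp_mem hg)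
  have hT : Function.Injective T := by
    rw [injective_iff_map_eq_zero]
    intro g hg
    refine Subtype.ext (eq_zero_of_lowerOp_raiseOp_add 0 k (by rwa [Fintype.card_fin]) g.2 ?_)
    rw [zero_smul, add_zero]
    exact congrArg Subtype.val hg
  obtain ⟨g, hg⟩ := LinearMap.injective_iff_surjective.1 hT ⟨f, hf⟩
  exact ⟨g.1, g.2, congrArg Subtype.val hg⟩

/-- Every function on `k + 1`-subsets is a raised function plus a harmonic one. -/
theorem exists_raiseOp_add_eq {k : ℕ} (hk : 2 * k < n) {f : Finset (Fin n) → K}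
    (hf : f ∈ cardSubmodule (Fin n) K (k + 1)) :
    ∃ g ∈ cardSubmodule (Fin n) K k, ∃ h ∈ harmonicSubmodule K n (k + 1),
      raiseOp (Fin n) K g + h = f := by
  obtain ⟨g, hg, hgf⟩ := exists_lowerOp_raiseOp_eq hk (lowerOp_mem hf)
  refine ⟨g, hg, f - raiseOp (Fin n) K g, ⟨sub_mem hf (raiseOp_mem hg), ?_⟩, add_sub_cancel _ _⟩
  rw [SetLike.mem_coe, LinearMap.mem_ker, map_sub, hgf, sub_self]

theorem repClass_cardRep_succ {k : ℕ} (hk : 2 * k < n) :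
    repClass (cardRep K n (k + 1)) =
      repClass (cardRep K n k) + repClass (harmonicRep K n (k + 1)) := by
  let e : cardSubmodule (Fin n) K k × harmonicSubmodule K n (k + 1) →ₗ[K]
      cardSubmodule (Fin n) K (k + 1) :=
    ((raiseOp (Fin n) K).restrict fun g hg => raiseOp_mem hg).coprod
      (Submodule.inclusion inf_le_left)
  have he : ∀ x, (e x).1 = raiseOp (Fin n) K x.1.1 + x.2.1 := fun _ => rfl
  have hb : Function.Bijective e := by
    constructor
    · rw [injective_iff_map_eq_zero]
      rintro ⟨g, h⟩ hgh
      have h1 : raiseOp (Fin n) K g.1 + h.1 = 0 := congrArg Subtype.val hgh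
      have h2 := congrArg (lowerOp (Fin n) K) h1
      rw [map_add, h.2.2, map_zero] at h2
      have h3 : g = 0 := Subtype.ext (eq_zero_of_lowerOp_raiseOp_add 0 k
        (by rwa [Fintype.card_fin]) g.2 (by rwa [zero_smul]))
      rw [h3, Submodule.coe_zero, map_zero, zero_add] at h1
      exact Prod.ext h3 (Subtype.ext h1)
    · intro f
      obtain ⟨g, hg, h, hh, hgh⟩ := exists_raiseOp_add_eq hk f.2
      exact ⟨(⟨g, hg⟩, ⟨h, hh⟩), Subtype.ext hgh⟩
  let E := LinearEquiv.ofBijective e hb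
  refine repClass_eq_add (X := cardRep K n k) (Y := harmonicRep K n (k + 1)) E.symm fun g z => ?_
  rw [LinearEquiv.symm_apply_eq]
  obtain ⟨x, rfl⟩ := E.surjective z
  rw [LinearEquiv.symm_apply_apply]
  refine Subtype.ext ?_
  change subsetFunRho K n g (raiseOp (Fin n) K x.1.1 + x.2.1) =
    raiseOp (Fin n) K (subsetFunRho K n g x.1.1) + subsetFunRho K n g x.2.1
  rw [map_add, raiseOp_subsetFunRho]

/-- The square of the permutation representation on all subsets, in terms of the harmonic
representations. -/
theorem repClass_subsetPairs_zero :
    repClass (Rep.ofMulAction K (Equiv.Perm (Fin n)) (subsetPairs n 0)) =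
      ∑ j ∈ Finset.range (n / 2 + 1), repClass (harmonicRep K n j ⊗ harmonicRep K n j) +
        repClass (Rep.ofMulAction K (Equiv.Perm (Fin n)) (subsetPairs n 1)) := by
  rw [repClass_subsetPairs, repClass_subsetPairs]
  refine sum_repClass_sq (subsetRep K n) (harmonicRep K n) n ?_ (fun k hk => ?_) fun k hk =>
    repClass_subsetRep_compl hk
  · rw [repClass_subsetRep_eq_cardRep, repClass_cardRep_zero]
  · rw [repClass_subsetRep_eq_cardRep, repClass_subsetRep_eq_cardRep,
      repClass_cardRep_succ (by omega)]

end Representations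

end SubsetLattice

section TwoRowFillings

open scoped Pointwise

/-- `row` and `col` are the row and column functions of a filling of a Young diagram with at most
two rows by `{0, …, n - 1}`, whose second row is `A`. -/
structure IsTwoRowFilling {n : ℕ} (row col : Fin n → ℕ) (A : Finset (Fin n)) : Prop where
  two_mul_card_le : 2 * A.card ≤ n
  row_eq_iff : ∀ s t, row s = row t ↔ (s ∈ A ↔ t ∈ A)
  eq_of_col_eq : ∀ s t, col s = col t → (s ∈ A ↔ t ∈ A) → s = t
  exists_col_eq : ∀ s ∈ A, ∃ t ∉ A, col t = col s

namespace IsTwoRowFilling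

variable {n : ℕ} {row col : Fin n → ℕ} {A : Finset (Fin n)}

theorem mem_stabSubgroup_row_iff (h : IsTwoRowFilling row col A) (σ : Equiv.Perm (Fin n)) :
    σ ∈ stabSubgroup n row ↔ σ • A = A := by
  rw [perm_smul_finset_eq_self_iff]
  exact forall_congr' fun t => h.row_eq_iff _ _

theorem swap_mem_stabSubgroup_col {s t : Fin n} (hst : col s = col t) :
    Equiv.swap s t ∈ stabSubgroup n col := by
  intro x
  rw [Equiv.swap_apply_def]
  split_ifs with h1 h2
  · rw [h1, hst]
  · rw [h2, hst]
  · rfl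

theorem sign_of_mem_stabSubgroup_col (h : IsTwoRowFilling row col A) {q : Equiv.Perm (Fin n)}
    (hq : q ∈ stabSubgroup n col) :
    Equiv.Perm.sign q = (-1) ^ (A \ q • A).card := by
  have hq' : ∀ t, col (q t) = col t := hq
  have hl : ∀ t, q⁻¹ (q t) = t := q.symm_apply_apply
  have hr : ∀ t, q (q⁻¹ t) = t := q.apply_symm_apply
  induction hs : (A \ q • A).card generalizing q with
  | zero =>
    have h1 : q • A = A := (Finset.eq_of_subset_of_card_le
      (Finset.sdiff_eq_empty_iff_subset.1 (Finset.card_eq_zero.1 hs)) (by simp)).symm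
    have h2 : q = 1 := Equiv.ext fun t =>
      h.eq_of_col_eq _ _ (hq' t) ((perm_smul_finset_eq_self_iff q A).1 h1 t)
    rw [h2, map_one, pow_zero]
  | succ s ih =>
    obtain ⟨c, hc⟩ := Finset.card_pos.1 (by omega : 0 < (A \ q • A).card)
    rw [Finset.mem_sdiff, ← Finset.inv_smul_mem_iff, Equiv.Perm.smul_def] at hc
    obtain ⟨b, rfl⟩ := q.surjective c
    rw [hl] at hc
    obtain ⟨hc, hb⟩ := hc
    have hcA : q (q b) ∉ A := fun h1 => hb (by
      rwa [← q.injective (h.eq_of_col_eq _ _ (hq' (q b)) (by simp [h1, hc]))])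
    have hcb : q (q b) = b := h.eq_of_col_eq _ _ ((hq' _).trans (hq' _)) (by simp [hcA, hb])
    have hne : b ≠ q b := fun h1 => hb (h1 ▸ hc)
    have hmem : q * Equiv.swap b (q b) ∈ stabSubgroup n col :=
      mul_mem hq (swap_mem_stabSubgroup_col (hq' b).symm)
    have hsd : A \ (q * Equiv.swap b (q b)) • A = (A \ q • A).erase (q b) := by
      ext x
      rw [Finset.mem_erase, Finset.mem_sdiff, Finset.mem_sdiff, ← Finset.inv_smul_mem_iff,
        ← Finset.inv_smul_mem_iff, Equiv.Perm.smul_def, Equiv.Perm.smul_def, mul_inv_rev,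
        Equiv.swap_inv, Equiv.Perm.mul_apply]
      by_cases hx : x = q b
      · simp [hx, hc]
      by_cases hxA : x ∈ A
      · have h1 : q⁻¹ x ≠ b := fun h1 => hx (by rw [← h1, hr])
        have h2 : q⁻¹ x ≠ q b := fun h1 => hb (by
          rw [← hcb, ← h1, hr]; exact hxA)
        rw [Equiv.swap_apply_of_ne_of_ne h1 h2]
        simp [hx]
      · simp [hxA]
    have hcard := ih hmem hmem (fun t => Equiv.symm_apply_apply _ t) (fun t => Equiv.apply_symm_apply _ t) (by
      rw [hsd, Finset.card_erase_of_mem (by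
        rw [Finset.mem_sdiff, ← Finset.inv_smul_mem_iff, Equiv.Perm.smul_def,
          hl]
        exact ⟨hc, hb⟩), hs, Nat.add_sub_cancel])
    rw [map_mul, Equiv.Perm.sign_swap hne] at hcard
    rw [pow_succ, ← hcard]
    simp

end IsTwoRowFilling

variable {K : Type} [Field K]

/-- The values of a harmonic function invariant under the stabilizer of `A`. -/
theorem choose_mul_apply_of_lowerOp_eq_zero {n : ℕ} {A : Finset (Fin n)} [CharZero K]
    {f : Finset (Fin n) → K} (hf : lowerOp (Fin n) K f = 0)
    (hinv : ∀ σ : Equiv.Perm (Fin n), σ • A = A → ∀ B, f (σ • B) = f B)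
    {B : Finset (Fin n)} (hB : B.card = A.card) :
    ((n - A.card).choose (A \ B).card : K) * f B = (-1) ^ (A \ B).card * f A := by
  induction hs : (A \ B).card generalizing B with
  | zero =>
    rw [Finset.card_eq_zero, Finset.sdiff_eq_empty_iff_subset] at hs
    rw [Finset.eq_of_subset_of_card_le hs hB.le]
    simp
  | succ s ih =>
    have h1 := Finset.card_sdiff_add_card_inter A B
    have h2 := Finset.card_sdiff_add_card_inter B A
    have h3 := Finset.card_union_add_card_inter A B
    have h4 := Finset.card_add_card_compl (A ∪ B)
    rw [Fintype.card_fin] at h4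
    rw [Finset.inter_comm] at h2
    obtain ⟨y, hy⟩ := Finset.card_pos.1 (by omega : 0 < (B \ A).card)
    obtain ⟨hyB, hyA⟩ := Finset.mem_sdiff.1 hy
    have hD : (B.erase y)ᶜ = (A \ B) ∪ insert y (A ∪ B)ᶜ := by
      ext x
      by_cases hx : x = y
      · simp [hx]
      · simp only [Finset.mem_compl, Finset.mem_erase, Finset.mem_union, Finset.mem_sdiff,
          Finset.mem_insert]
        tauto
    have hdisj : Disjoint (A \ B) (insert y (A ∪ B)ᶜ) := by
      rw [Finset.disjoint_left]
      intro x hx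
      simp only [Finset.mem_compl, Finset.mem_union, Finset.mem_sdiff, Finset.mem_insert] at hx ⊢
      rintro (rfl | h)
      · exact hyA hx.1
      · exact h (Or.inl hx.1)
    have hsum := congrFun hf (B.erase y)
    rw [lowerOp_apply, hD, Finset.sum_union hdisj] at hsum
    have hcard : ∀ x, x ∉ B.erase y → (insert x (B.erase y)).card = B.card := fun x hx => by
      rw [Finset.card_insert_of_notMem hx, Finset.card_erase_add_one hyB]
    have hP : ∀ x ∈ A \ B, ((n - A.card).choose s : K) * f (insert x (B.erase y)) =
        (-1) ^ s * f A := by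
      intro x hx
      have hx' := Finset.mem_sdiff.1 hx
      refine ih ?_ ?_
      · rw [hcard x fun h => hx'.2 (Finset.mem_of_mem_erase h), hB]
      · rw [show A \ insert x (B.erase y) = (A \ B).erase x by
          ext z
          by_cases hz : z = y
          · simp [hz, hyA]
          · simp only [Finset.mem_sdiff, Finset.mem_insert, Finset.mem_erase]
            tauto, Finset.card_erase_of_mem hx, hs, Nat.add_sub_cancel]
    have hQ : ∀ x ∈ insert y (A ∪ B)ᶜ, f (insert x (B.erase y)) = f B := by
      intro x hx
      have hxA : x ∉ A := by
        rcases Finset.mem_insert.1 hx with rfl | h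
        · exact hyA
        · exact fun h' => Finset.mem_compl.1 h (Finset.mem_union_left _ h')
      have hxB : x ∉ B.erase y := by
        rcases Finset.mem_insert.1 hx with rfl | h
        · simp
        · exact fun h' => Finset.mem_compl.1 h
            (Finset.mem_union_right _ (Finset.mem_of_mem_erase h'))
      obtain ⟨σ, hσ, hσB⟩ := exists_perm_smul_pair (A := A) (A' := A) (B := B)
        (B' := insert x (B.erase y)) rfl (hcard x hxB).symm (by
          congr 1
          ext z
          simp only [Finset.mem_inter, Finset.mem_insert, Finset.mem_erase]
          constructor
          · rintro ⟨h, h'⟩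
            exact ⟨h, Or.inr ⟨fun e => hyA (e ▸ h), h'⟩⟩
          · rintro ⟨h, h' | h'⟩
            · exact absurd (h' ▸ h) hxA
            · exact ⟨h, h'.2⟩)
      rw [← hσB, hinv σ hσ]
    rw [Finset.sum_congr rfl hQ, Finset.sum_const, Finset.card_insert_of_notMem (by
      simp [hyB])] at hsum
    have hc : (A ∪ B)ᶜ.card + 1 = n - A.card - s := by omega
    have hmul := congrArg (((n - A.card).choose s : K) * ·) hsum
    simp only [mul_add, Finset.mul_sum, Finset.sum_congr rfl hP, Finset.sum_const, hs, hc,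
      Pi.zero_apply, mul_zero, nsmul_eq_mul] at hmul
    have hch := congrArg (Nat.cast (R := K)) (Nat.choose_succ_right_eq (n - A.card) s)
    push_cast at hch hmul
    have hs0 : (s : K) + 1 ≠ 0 := by exact_mod_cast Nat.succ_ne_zero s
    refine mul_left_cancel₀ hs0 ?_
    linear_combination f B * hch + hmul

/-- The alternating sum of `f` over the translates of `A` by the column group. -/
def colAltSum {n : ℕ} (col : Fin n → ℕ) (A : Finset (Fin n)) (f : Finset (Fin n) → K) : K :=
  ∑ q : stabSubgroup n col,
    ((Equiv.Perm.sign (q : Equiv.Perm (Fin n)) : ℤ) : K) * f ((q : Equiv.Perm (Fin n)) • A)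

namespace IsTwoRowFilling

variable [CharZero K] {n : ℕ} {row col : Fin n → ℕ} {A : Finset (Fin n)}

theorem colAltSum_raiseOp (h : IsTwoRowFilling row col A) (f : Finset (Fin n) → K) :
    colAltSum col A (raiseOp (Fin n) K f) = 0 := by
  have key : ∀ b ∈ A, colAltSum col (A.erase b) f = 0 := by
    intro b hb
    obtain ⟨b', hb', hcol⟩ := h.exists_col_eq b hb
    have hne : b ≠ b' := fun e => hb' (e ▸ hb)
    have hfix : Equiv.swap b b' • A.erase b = A.erase b := by
      rw [perm_smul_finset_eq_self_iff]
      intro x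
      rw [Equiv.swap_apply_def]
      split_ifs with h1 h2 <;> simp [*]
    rw [← self_eq_neg]
    refine (Fintype.sum_equiv
      (Equiv.mulRight ⟨_, swap_mem_stabSubgroup_col (col := col) hcol.symm⟩) _ _ fun q => ?_).trans
      (Finset.sum_neg_distrib _)
    rw [Equiv.coe_mulRight, Subgroup.coe_mul, map_mul, Equiv.Perm.sign_swap hne, mul_smul, hfix]
    simp
  simp only [colAltSum, raiseOp_apply] at key ⊢
  rw [← Finset.sum_eq_zero key, Finset.sum_comm]
  refine Finset.sum_congr rfl fun q _ => ?_
  rw [← Finset.image_smul (a := (q : Equiv.Perm (Fin n))) (s := A),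
    Finset.sum_image (MulAction.injective _).injOn, Finset.mul_sum, Finset.image_smul]
  simp only [smul_finset_erase]

theorem eq_zero_of_colAltSum_eq_zero (h : IsTwoRowFilling row col A)
    {f : Finset (Fin n) → K} (hf : lowerOp (Fin n) K f = 0)
    (hinv : ∀ σ : Equiv.Perm (Fin n), σ • A = A → ∀ B, f (σ • B) = f B)
    (h0 : colAltSum col A f = 0) : f A = 0 := by
  let c : stabSubgroup n col → ℕ := fun q =>
    (n - A.card).choose (A \ (q : Equiv.Perm (Fin n)) • A).card
  have hc : ∀ q, 0 < c q := fun q => by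
    have := Finset.card_le_card (Finset.sdiff_subset (s := A)
      (t := (q : Equiv.Perm (Fin n)) • A))
    have := h.two_mul_card_le
    exact Nat.choose_pos (by omega)
  have hterm : ∀ q : stabSubgroup n col,
      ((Equiv.Perm.sign (q : Equiv.Perm (Fin n)) : ℤ) : K) * f ((q : Equiv.Perm (Fin n)) • A) =
        (((c q : ℚ)⁻¹ : ℚ) : K) * f A := by
    intro q
    have hq : (c q : K) ≠ 0 := Nat.cast_ne_zero.2 (hc q).ne'
    have h1 := choose_mul_apply_of_lowerOp_eq_zero hf hinv
      (B := (q : Equiv.Perm (Fin n)) • A) (by simp)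
    have h2 := h.sign_of_mem_stabSubgroup_col q.2
    rw [h2]
    push_cast
    refine mul_left_cancel₀ hq ?_
    rw [mul_inv_cancel_left₀ hq, mul_left_comm, h1, ← mul_assoc, ← mul_pow]
    simp
  rw [colAltSum, Finset.sum_congr rfl fun q _ => hterm q, ← Finset.sum_mul, ← Rat.cast_sum] at h0
  refine (mul_eq_zero.1 h0).resolve_left (Rat.cast_ne_zero.2 (ne_of_gt ?_))
  exact Finset.sum_pos (fun q _ => inv_pos.2 (Nat.cast_pos.2 (hc q))) ⟨1, Finset.mem_univ _⟩

/-- A harmonic function all of whose translates have vanishing alternating sum is zero. -/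
theorem eq_zero_of_forall_colAltSum_eq_zero (h : IsTwoRowFilling row col A)
    {f : Finset (Fin n) → K} (hf : f ∈ harmonicSubmodule K n A.card)
    (h0 : ∀ g, colAltSum col A (subsetFunRho K n g f) = 0) : f = 0 := by
  have key : ∀ g : Equiv.Perm (Fin n), f (g • A) = 0 := by
    intro g
    let F : Finset (Fin n) → K :=
      ∑ r : stabSubgroup n row, subsetFunRho K n (g * (r : Equiv.Perm (Fin n)))⁻¹ f
    have hF : ∀ B, F B = ∑ r : stabSubgroup n row, f (g • (r : Equiv.Perm (Fin n)) • B) := by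
      intro B
      simp only [F, Finset.sum_apply, subsetFunRho_apply, inv_inv, mul_smul]
    have hFA := h.eq_zero_of_colAltSum_eq_zero (f := F) ?_ ?_ ?_
    · rw [hF, Finset.sum_congr rfl fun r _ => by
        rw [(h.mem_stabSubgroup_row_iff _).1 r.2], Finset.sum_const, nsmul_eq_mul] at hFA
      exact (mul_eq_zero.1 hFA).resolve_left
        (Nat.cast_ne_zero.2 (Finset.card_ne_zero_of_mem (Finset.mem_univ 1)))
    · rw [map_sum]
      exact Finset.sum_eq_zero fun r _ => by rw [lowerOp_subsetFunRho, hf.2, map_zero]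
    · intro σ hσ B
      rw [hF, hF]
      refine Fintype.sum_equiv
        (Equiv.mulRight ⟨σ, (h.mem_stabSubgroup_row_iff _).2 hσ⟩) _ _ fun r => ?_
      rw [Equiv.coe_mulRight, Subgroup.coe_mul, mul_smul]
    · simp only [colAltSum, F, Finset.sum_apply, Finset.mul_sum] at h0 ⊢
      rw [Finset.sum_comm]
      exact Finset.sum_eq_zero fun r _ => h0 _
  ext B
  by_cases hB : B.card = A.card
  · obtain ⟨σ, rfl, -⟩ := exists_perm_smul_pair (A := A) (B := A) (A' := B) (B' := B)
      hB.symm hB.symm (by simp [hB])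
    exact key σ
  · exact hf.1 B hB

end IsTwoRowFilling

section GroupAlgebra

variable {n : ℕ}

variable (K) in
/-- The sum of the elements of the row group. -/
noncomputable def rowSym (row : Fin n → ℕ) : MonoidAlgebra K (Equiv.Perm (Fin n)) :=
  ∑ p : stabSubgroup n row, MonoidAlgebra.single (p : Equiv.Perm (Fin n)) (1 : K)

variable (K) in
/-- The signed sum of the elements of the column group. -/
noncomputable def colAntisym (col : Fin n → ℕ) : MonoidAlgebra K (Equiv.Perm (Fin n)) :=
  ∑ q : stabSubgroup n col, MonoidAlgebra.single (q : Equiv.Perm (Fin n))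
    ((Equiv.Perm.sign (q : Equiv.Perm (Fin n)) : ℤ) : K)

/-- The function `g ↦ f (g • A)` as an element of the group algebra. -/
noncomputable def orbitElement (A : Finset (Fin n)) :
    (Finset (Fin n) → K) →ₗ[K] MonoidAlgebra K (Equiv.Perm (Fin n)) where
  toFun f := ∑ g, MonoidAlgebra.single g (f (g • A))
  map_add' f f' := by simp [MonoidAlgebra.single_add, Finset.sum_add_distrib]
  map_smul' c f := by simp [Finset.smul_sum]

theorem coeff_orbitElement (A : Finset (Fin n)) (f : Finset (Fin n) → K)
    (g : Equiv.Perm (Fin n)) : (orbitElement A f).coeff g = f (g • A) := by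
  simp [orbitElement, Finsupp.single_apply]

theorem orbitElement_subsetFunRho (A : Finset (Fin n)) (f : Finset (Fin n) → K)
    (g : Equiv.Perm (Fin n)) :
    orbitElement A (subsetFunRho K n g f) = MonoidAlgebra.single g 1 * orbitElement A f := by
  ext x
  simp [coeff_orbitElement, subsetFunRho_apply, mul_smul]

theorem coeff_orbitElement_mul_colAntisym (A : Finset (Fin n)) (col : Fin n → ℕ)
    (f : Finset (Fin n) → K) (g : Equiv.Perm (Fin n)) :
    (orbitElement A f * colAntisym K col).coeff g =
      colAltSum col A (subsetFunRho K n g⁻¹ f) := by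
  simp only [colAntisym, Finset.mul_sum, MonoidAlgebra.coeff_sum, Finsupp.finsetSum_apply,
    MonoidAlgebra.coeff_mul_single_apply, coeff_orbitElement, colAltSum, subsetFunRho_apply]
  refine Fintype.sum_equiv (Equiv.inv _) _ _ fun q => ?_
  simp [mul_smul, mul_comm]

end GroupAlgebra

namespace IsTwoRowFilling

variable {n : ℕ} {row col : Fin n → ℕ} {A : Finset (Fin n)}

theorem orbitElement_mul_rowSym (h : IsTwoRowFilling row col A) (f : Finset (Fin n) → K) :
    orbitElement A f * rowSym K row = (Fintype.card (stabSubgroup n row) : K) •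
      orbitElement A f := by
  ext g
  simp only [rowSym, Finset.mul_sum, MonoidAlgebra.coeff_sum, Finsupp.finsetSum_apply,
    MonoidAlgebra.coeff_mul_single_apply, coeff_orbitElement, MonoidAlgebra.coeff_smul,
    Finsupp.smul_apply]
  rw [Finset.sum_congr rfl fun r _ => by
    rw [mul_smul, (h.mem_stabSubgroup_row_iff _).1 (inv_mem r.2), mul_one]]
  simp

theorem orbitElement_single (h : IsTwoRowFilling row col A) :
    orbitElement A (Pi.single A 1) = rowSym K row := by
  ext g
  rw [coeff_orbitElement, Pi.single_apply]
  simp only [rowSym, MonoidAlgebra.coeff_sum, Finsupp.finsetSum_apply,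
    MonoidAlgebra.coeff_single, Finsupp.single_apply]
  split_ifs with hg
  · rw [Finset.sum_eq_single ⟨g, (h.mem_stabSubgroup_row_iff g).2 hg⟩] <;>
      simp +contextual [Subtype.ext_iff]
  · refine (Finset.sum_eq_zero fun r _ => if_neg ?_).symm
    rintro rfl
    exact hg ((h.mem_stabSubgroup_row_iff _).1 r.2)

/-- Every element of the left ideal generated by the Young symmetrizer comes from a function on
the subsets of the size of the second row. -/
theorem exists_orbitElement_mul_eq (h : IsTwoRowFilling row col A)
    (y : MonoidAlgebra K (Equiv.Perm (Fin n))) :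
    ∃ f ∈ cardSubmodule (Fin n) K A.card,
      orbitElement A f * colAntisym K col = y * (rowSym K row * colAntisym K col) := by
  induction y using MonoidAlgebra.induction_linear with
  | zero => exact ⟨0, zero_mem _, by simp⟩
  | add x y hx hy =>
    obtain ⟨f, hf, hfx⟩ := hx
    obtain ⟨f', hf', hfy⟩ := hy
    exact ⟨f + f', add_mem hf hf', by rw [map_add, add_mul, hfx, hfy, add_mul]⟩
  | single g c =>
    refine ⟨c • subsetFunRho K n g (Pi.single A 1), Submodule.smul_mem _ _
      (cardSubmodule_le_comap _ g fun B hB => ?_), ?_⟩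
    · exact Pi.single_eq_of_ne (by rintro rfl; exact hB rfl) _
    · rw [map_smul, orbitElement_subsetFunRho, h.orbitElement_single, ← smul_mul_assoc,
        MonoidAlgebra.smul_single, smul_eq_mul, mul_one, mul_assoc]

variable [CharZero K]

theorem orbitElement_raiseOp_mul_colAntisym (h : IsTwoRowFilling row col A)
    (f : Finset (Fin n) → K) :
    orbitElement A (raiseOp (Fin n) K f) * colAntisym K col = 0 := by
  ext g
  rw [coeff_orbitElement_mul_colAntisym, ← raiseOp_subsetFunRho, h.colAltSum_raiseOp]
  rfl

theorem exists_harmonic_orbitElement_mul_eq (h : IsTwoRowFilling row col A)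
    (y : MonoidAlgebra K (Equiv.Perm (Fin n))) :
    ∃ f ∈ harmonicSubmodule K n A.card,
      orbitElement A f * colAntisym K col = y * (rowSym K row * colAntisym K col) := by
  obtain ⟨f, hf, hfy⟩ := h.exists_orbitElement_mul_eq y
  have hn := h.two_mul_card_le
  generalize A.card = k at hf hn
  cases k with
  | zero => exact ⟨f, ⟨hf, lowerOp_eq_zero_of_mem_zero hf⟩, hfy⟩
  | succ k =>
    obtain ⟨g, -, f', hf', rfl⟩ := exists_raiseOp_add_eq (by omega) hf
    refine ⟨f', hf', ?_⟩
    rw [← hfy, map_add, add_mul, h.orbitElement_raiseOp_mul_colAntisym, zero_add]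

theorem orbitElement_mul_colAntisym_mem (h : IsTwoRowFilling row col A)
    (f : Finset (Fin n) → K) :
    orbitElement A f * colAntisym K col ∈
      Submodule.span (MonoidAlgebra K (Equiv.Perm (Fin n)))
        {rowSym K row * colAntisym K col} := by
  have hc : (Fintype.card (stabSubgroup n row) : K) ≠ 0 := Nat.cast_ne_zero.2 Fintype.card_ne_zero
  refine Submodule.mem_span_singleton.2
    ⟨(Fintype.card (stabSubgroup n row) : K)⁻¹ • orbitElement A f, ?_⟩
  rw [smul_eq_mul, ← mul_assoc, smul_mul_assoc, h.orbitElement_mul_rowSym, inv_smul_smul₀ hc]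

/-- The Specht module of a two-row diagram is the harmonic representation. -/
theorem repClass_specht {l : Nat.Partition n}
    (h : IsTwoRowFilling (shiftedRowFn n 0 n l) (shiftedColFn n 0 n l) A) :
    repClass (specht K n l) = repClass (harmonicRep K n A.card) := by
  let b := colAntisym K (shiftedColFn n 0 n l)
  let φ : harmonicSubmodule K n A.card →ₗ[K] (specht K n l).V :=
    { toFun := fun f => (⟨orbitElement A f.1 * b, h.orbitElement_mul_colAntisym_mem f.1⟩ :
        spechtIdeal K n l)
      map_add' := fun f f' => Subtype.ext (by
        change orbitElement A (f.1 + f'.1) * b = _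
        rw [map_add, add_mul]
        rfl)
      map_smul' := fun c f => Subtype.ext (by
        change orbitElement A (c • f.1) * b =
          algebraMap K (MonoidAlgebra K (Equiv.Perm (Fin n))) c * (orbitElement A f.1 * b)
        rw [map_smul, Algebra.smul_def, mul_assoc]) }
  have hφ : Function.Bijective φ := by
    constructor
    · rw [injective_iff_map_eq_zero]
      intro f hf
      have hf : orbitElement A f.1 * b = 0 := congrArg Subtype.val hf
      refine Subtype.ext (h.eq_zero_of_forall_colAltSum_eq_zero f.2 fun g => ?_)
      rw [← inv_inv g, ← coeff_orbitElement_mul_colAntisym, hf]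
      rfl
    · rintro ⟨x, hx⟩
      obtain ⟨y, rfl⟩ := Submodule.mem_span_singleton.1 hx
      obtain ⟨f, hf, hfy⟩ := h.exists_harmonic_orbitElement_mul_eq y
      exact ⟨⟨f, hf⟩, Subtype.ext hfy⟩
  refine (repClass_eq_of_linearEquiv (X := harmonicRep K n A.card)
    (LinearEquiv.ofBijective φ hφ) fun g f => Subtype.ext ?_).symm
  change orbitElement A (subsetFunRho K n g f.1) * b =
    MonoidAlgebra.single g 1 * (orbitElement A f.1 * b)
  rw [orbitElement_subsetFunRho, mul_assoc]

end IsTwoRowFilling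

end TwoRowFillings

section TwoRowPartitions

theorem coe_partsList {n : ℕ} (l : Nat.Partition n) : (partsList l : Multiset ℕ) = l.parts := by
  rw [partsList, ← Multiset.coe_reverse, List.reverse_reverse, Multiset.sort_eq]

theorem pairwise_partsList {n : ℕ} (l : Nat.Partition n) : (partsList l).Pairwise (· ≥ ·) :=
  List.pairwise_reverse.2 (l.parts.pairwise_sort _)

/-- The second largest part of a partition, or `0` if there is none. -/
def secondPart {n : ℕ} (l : Nat.Partition n) : ℕ := (partsList l).getD 1 0

theorem two_row_spec {n : ℕ} (l : Nat.Partition n) (hl : l.parts.card ≤ 2) :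
    2 * secondPart l ≤ n ∧
      l.parts = Multiset.filter (· ≠ 0) {n - secondPart l, secondPart l} ∧
      ∀ t < n, listBlock (partsList l) t = (if t < n - secondPart l then 0 else 1) ∧
        listCol (partsList l) t = if t < n - secondPart l then t else t - (n - secondPart l) := by
  have h1 := coe_partsList l
  have h2 := pairwise_partsList l
  have h3 := l.parts_sum
  have h4 : ∀ x ∈ l.parts, 0 < x := fun x hx => l.parts_pos hx
  rw [← h1] at hl h3 h4 ⊢
  rw [secondPart]
  generalize partsList l = L at *
  match L with
  | [] =>
    simp at h3
    subst h3
    simp [Multiset.filter_singleton]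
  | [a] =>
    simp at h3 h4
    subst h3
    refine ⟨by simp, by simp [h4.ne', Multiset.filter_singleton], fun t ht => ?_⟩
    simp [listBlock, listCol, List.scanl_cons, List.scanl_nil, ht, ht.not_ge]
  | [a, b] =>
    simp at h2 h3 h4
    subst h3
    refine ⟨by simp; omega, ?_, fun t ht => ?_⟩
    · simp [h4.1.ne', h4.2.ne', Multiset.filter_singleton]
      rfl
    · by_cases hta : t < a
      · simp [listBlock, listCol, List.scanl_cons, List.scanl_nil, ht.not_ge, hta, hta.not_ge]
      · simp [listBlock, listCol, List.scanl_cons, List.scanl_nil, ht.not_ge, hta, not_lt.1 hta]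
  | a :: b :: c :: L => simp at hl

/-- The canonical tableau of a partition with at most two parts is a two-row filling. -/
theorem isTwoRowFilling_shifted {n : ℕ} (l : Nat.Partition n) (hl : l.parts.card ≤ 2) :
    IsTwoRowFilling (shiftedRowFn n 0 n l) (shiftedColFn n 0 n l)
      (Finset.univ.filter fun t => n - secondPart l ≤ t.val) ∧
    (Finset.univ.filter fun t : Fin n => n - secondPart l ≤ t.val).card = secondPart l := by
  obtain ⟨h1, -, h2⟩ := two_row_spec l hl
  generalize secondPart l = j at *
  have hrow : ∀ t : Fin n, shiftedRowFn n 0 n l t = n + if t.val < n - j then 0 else 1 :=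
    fun t => by simp [shiftedRowFn, (h2 t.val t.2).1]
  have hcol : ∀ t : Fin n, shiftedColFn n 0 n l t =
      n + if t.val < n - j then t.val else t.val - (n - j) :=
    fun t => by simp [shiftedColFn, (h2 t.val t.2).2]
  have hcard : (Finset.univ.filter fun t : Fin n => n - j ≤ t.val).card = j := by
    refine (card_filter_val (fun t => n - j ≤ t) (s := Finset.Ico (n - j) n)
      (fun t => by simp; omega)).trans ?_
    simp; omega
  refine ⟨⟨by rwa [hcard], fun s t => ?_, fun s t => ?_, fun s hs => ?_⟩, hcard⟩
  · simp only [hrow, Finset.mem_filter, Finset.mem_univ, true_and]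
    grind
  · simp only [hcol, Finset.mem_filter, Finset.mem_univ, true_and, Fin.ext_iff]
    grind
  · simp only [Finset.mem_filter, Finset.mem_univ, true_and] at hs ⊢
    refine ⟨⟨s.val - (n - j), by omega⟩, by dsimp only; omega, ?_⟩
    rw [hcol, hcol]
    grind

variable (K : Type) [Field K] [CharZero K]

theorem sum_repClass_specht_sq (n : ℕ) :
    ∑ l : {l : Nat.Partition n // l.parts.card ≤ 2},
        repClass (specht K n l.1 ⊗ specht K n l.1) =
      ∑ j ∈ Finset.range (n / 2 + 1), repClass (harmonicRep K n j ⊗ harmonicRep K n j) := by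
  refine Finset.sum_nbij (fun l => secondPart l.1) (fun l _ => ?_) (fun l _ l' _ h => ?_)
    (fun j hj => ?_) fun l _ => ?_
  · have := (two_row_spec l.1 l.2).1
    simp only [Finset.mem_range]
    omega
  · refine Subtype.ext (Nat.Partition.ext ?_)
    dsimp only at h
    rw [(two_row_spec l.1 l.2).2.1, (two_row_spec l'.1 l'.2).2.1, h]
  · have hj : 2 * j ≤ n := by simp at hj; omega
    let l : Nat.Partition n := .ofSums n {n - j, j} (by simp; omega)
    have hl : l.parts = Multiset.filter (· ≠ 0) {n - j, j} := rfl
    have hc : l.parts.card ≤ 2 := by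
      rw [hl]
      exact (Multiset.card_le_card (Multiset.filter_le _ _)).trans (by simp)
    refine ⟨⟨l, hc⟩, Finset.mem_coe.2 (Finset.mem_univ _), ?_⟩
    obtain ⟨h1, h2, -⟩ := two_row_spec l hc
    rw [hl] at h2
    dsimp only
    generalize secondPart l = i at *
    have e1 := congrArg (i ∈ ·) h2
    have e2 := congrArg (j ∈ ·) h2
    simp at e1 e2
    omega
  · obtain ⟨h1, h2⟩ := isTwoRowFilling_shifted l.1 l.2
    have h3 := h1.repClass_specht (K := K)
    rw [h2] at h3
    exact repClass_tensor_congr h3 h3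

end TwoRowPartitions

/-- There is an isomorphism of `Sₙ`-representations
`(⊕_{λ⊢n, r(λ)≤2} S_λ ⊗ S_λ) ⊕ (⊕_{2i+1+j+k=n} M(i,i+1,j,k)) ≅ ⊕_{2i+j+k=n} M(i,i,j,k)`. -/
theorem stmt9 (K : Type) [Field K] [CharZero K] (n : ℕ) :
    Nonempty (
      ((⨁ fun l : {l : Nat.Partition n // l.parts.card ≤ 2} =>
          specht K n l.1 ⊗ specht K n l.1) ⊞
        (⨁ fun t : {t : Fin (n + 1) × Fin (n + 1) × Fin (n + 1) //
            2 * t.1.val + 1 + t.2.1.val + t.2.2.val = n} =>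
          youngPermRep K n [t.1.1.val, t.1.1.val + 1, t.1.2.1.val, t.1.2.2.val])) ≅
      (⨁ fun t : {t : Fin (n + 1) × Fin (n + 1) × Fin (n + 1) //
            2 * t.1.val + t.2.1.val + t.2.2.val = n} =>
          youngPermRep K n [t.1.1.val, t.1.1.val, t.1.2.1.val, t.1.2.2.val])) := by
  refine repClass_eq_iff.1 ?_
  rw [repClass_biprod, repClass_biproduct, repClass_biproduct, repClass_biproduct,
    sum_repClass_specht_sq, ← repClass_subsetPairs_eq_sum_youngPermRep K n 1,
    ← repClass_subsetPairs_zero]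
  exact repClass_subsetPairs_eq_sum_youngPermRep K n 0
end

section
/- For integers i, j and n ≥ 0, let f(i,j,n) be the number of 4×4 matrices with nonnegative integer entries whose entries sum to n, such that (sum of the first row) − (sum of the second row) = i and (sum of the first column) − (sum of the second column) = j. Let K be a field of characteristic zero, let V, W be K-vector spaces with dim V = dim W = 2, and let Γ = GL(V)×GL(W) act on U = End(V⊗W) by (g,h)·φ = (g⊗h)∘φ∘(g⊗h)⁻¹. Then for every n ≥ 0, dim (K[U]^Γ)ₙ = f(0,0,n) − f(0,1,n) − f(1,0,n) + f(1,1,n). -/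
open PowerSeries

/-- The space of `Γ`-invariant homogeneous polynomial functions of degree `n` on `U`
(for the action `act` of `Γ` on `U`): functions `U → K` which are restrictions to the
diagonal of an `n`-multilinear form (over a field of characteristic zero this is exactly
the degree-`n` homogeneous polynomial functions) and which are invariant under `act`.
This is the `n`-th homogeneous component `(K[U]^Γ)ₙ` of the invariant ring. -/
def invariantPolynomials (K : Type) [Field K] {U Γ : Type} [AddCommGroup U] [Module K U]
    (act : Γ → U → U) (n : ℕ) : Submodule K (U → K) where
  carrier := {F | (∃ m : MultilinearMap K (fun _ : Fin n => U) K, ∀ u, F u = m fun _ => u) ∧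
    ∀ γ u, F (act γ u) = F u}
  add_mem' := by
    rintro F G ⟨⟨mF, hF⟩, hFi⟩ ⟨⟨mG, hG⟩, hGi⟩
    refine ⟨⟨mF + mG, fun u => ?_⟩, fun γ u => ?_⟩
    · simp [hF, hG]
    · simp [Pi.add_apply, hFi γ u, hGi γ u]
  zero_mem' := by
    refine ⟨⟨0, fun u => ?_⟩, fun γ u => rfl⟩
    simp
  smul_mem' := by
    rintro c F ⟨⟨mF, hF⟩, hFi⟩
    refine ⟨⟨c • mF, fun u => ?_⟩, fun γ u => ?_⟩
    · simp [hF]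
    · simp [Pi.smul_apply, hFi γ u]

/-- The action of `Γ = GL(V) × GL(W)` on `U = End(V ⊗ W)` given by
`(g,h) · φ = (g⊗h) ∘ φ ∘ (g⊗h)⁻¹`. -/
noncomputable def tensorConjAction (K : Type) [Field K] (V W : Type) [AddCommGroup V]
    [Module K V] [AddCommGroup W] [Module K W] :
    ((V ≃ₗ[K] V) × (W ≃ₗ[K] W)) →
      (TensorProduct K V W →ₗ[K] TensorProduct K V W) →
      (TensorProduct K V W →ₗ[K] TensorProduct K V W) :=
  fun γ φ => (TensorProduct.congr γ.1 γ.2).toLinearMap ∘ₗ φ ∘ₗ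
    (TensorProduct.congr γ.1 γ.2).symm.toLinearMap

/-- `fCount i j n` is the number of `4 × 4` matrices with nonnegative integer entries whose
entries sum to `n`, such that (sum of the first row) − (sum of the second row) = `i` and
(sum of the first column) − (sum of the second column) = `j`. -/
noncomputable def fCount (i j : ℤ) (n : ℕ) : ℕ :=
  Set.ncard {M : Matrix (Fin 4) (Fin 4) ℕ |
    (∑ r : Fin 4, ∑ s : Fin 4, M r s) = n ∧
    ((∑ s : Fin 4, (M 0 s : ℤ)) - ∑ s : Fin 4, (M 1 s : ℤ)) = i ∧
    ((∑ r : Fin 4, (M r 0 : ℤ)) - ∑ r : Fin 4, (M r 1 : ℤ)) = j}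

namespace ConjInvariant

section Sl2

variable {K E : Type*} [Field K] [AddCommGroup E] [Module K E]

/-- In a representation of `sl₂`, a vector of weight `2` in a finite-dimensional subspace stable
under `e` vanishes as soon as it is killed by `e ∘ f`. -/
theorem sl2_eq_zero_of_weight_two [CharZero K] {e f h : Module.End K E}
    (hef : ∀ v, e (f v) - f (e v) = h v) (hhe : ∀ v, h (e v) - e (h v) = (2 : K) • e v)
    {Q : Submodule K E} [Module.Finite K Q] (hQ : ∀ v ∈ Q, e v ∈ Q)
    {v : E} (hvQ : v ∈ Q) (hv : h v = (2 : K) • v) (hfv : e (f v) = 0) : v = 0 := by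
  by_contra hne
  have hmem : ∀ k : ℕ, (e ^ k) v ∈ Q := by
    intro k
    induction k with
    | zero => simpa using hvQ
    | succ k ih => rw [pow_succ']; exact hQ _ ih
  have hwt : ∀ k : ℕ, h ((e ^ k) v) = (2 + 2 * k : K) • (e ^ k) v := by
    intro k
    induction k with
    | zero => simpa using hv
    | succ k ih =>
      have := hhe ((e ^ k) v)
      rw [ih, map_smul, sub_eq_iff_eq_add, ← add_smul] at this
      rw [pow_succ', Module.End.mul_apply, this]
      congr 1
      push_cast
      ring
  have hlow : ∀ k : ℕ, f ((e ^ (k + 1)) v) = (-((k + 1) * (k + 2)) : K) • (e ^ k) v := by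
    intro k
    induction k with
    | zero =>
      have := hef v
      rw [hfv, hv, zero_sub, neg_eq_iff_eq_neg] at this
      simp [this]
    | succ k ih =>
      have := hef ((e ^ (k + 1)) v)
      rw [ih, hwt, map_smul, ← Module.End.mul_apply e, ← pow_succ', sub_eq_iff_eq_add,
        ← sub_eq_iff_eq_add', ← sub_smul] at this
      rw [pow_succ', Module.End.mul_apply, ← this]
      congr 1
      push_cast
      ring
  have hnz : ∀ k : ℕ, (e ^ k) v ≠ 0 := by
    intro k
    induction k with
    | zero => simpa using hne
    | succ k ih =>
      intro h0
      have := hlow k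
      rw [h0, map_zero, eq_comm, smul_eq_zero, or_iff_left ih, neg_eq_zero] at this
      norm_cast at this
  have hli : LinearIndependent K fun k : ℕ => (e ^ k) v := by
    refine Module.End.eigenvectors_linearIndependent' h (fun k : ℕ => (2 + 2 * k : K)) ?_ _
      fun k => ⟨Module.End.mem_eigenspace_iff.2 (hwt k), hnz k⟩
    intro a b hab
    simpa using hab
  have hli' : LinearIndependent K fun k : ℕ => (⟨(e ^ k) v, hmem k⟩ : Q) :=
    LinearIndependent.of_comp Q.subtype hli
  exact not_finite_iff_infinite.2 (inferInstance : Infinite ℕ) hli'.finite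

/-- In a finite-dimensional representation of `sl₂`, a vector of weight `0` killed by `e` is also
killed by `f`. -/
theorem sl2_lowering_eq_zero [CharZero K] {e f h : Module.End K E}
    (hef : ∀ v, e (f v) - f (e v) = h v) (hhf : ∀ v, h (f v) - f (h v) = (-2 : K) • f v)
    {Q : Submodule K E} [Module.Finite K Q] (hQ : ∀ v ∈ Q, f v ∈ Q)
    {v : E} (hvQ : v ∈ Q) (hv : h v = 0) (hev : e v = 0) : f v = 0 := by
  have hefv : e (f v) = 0 := by simpa [hv, hev] using hef v
  refine sl2_eq_zero_of_weight_two (e := f) (f := e) (h := -h) (fun w => ?_) (fun w => ?_) hQ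
    (hQ v hvQ) ?_ (by simp [hefv])
  · simp [← hef w]
  · have := hhf w
    simp only [LinearMap.neg_apply, map_neg]
    rw [sub_eq_iff_eq_add] at this
    rw [this]; module
  · have := hhf v
    rw [hv, map_zero, sub_zero] at this
    simp [this]

/-- If `e ∘ f` is injective on the finite-dimensional space `B`, where `f` maps `B` to `A` and `e`
maps `A` to `B`, then `e` maps `A` onto `B`; hence the dimension of its kernel. -/
theorem finrank_inf_ker_add {e f : Module.End K E} {A B : Submodule K E} [Module.Finite K A]
    [Module.Finite K B] (he : ∀ v ∈ A, e v ∈ B) (hf : ∀ v ∈ B, f v ∈ A)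
    (hinj : ∀ v ∈ B, e (f v) = 0 → v = 0) :
    Module.finrank K (A ⊓ LinearMap.ker e : Submodule K E) + Module.finrank K B =
      Module.finrank K A := by
  let e' : A →ₗ[K] B := e.restrict he
  let f' : B →ₗ[K] A := f.restrict hf
  have h1 : Function.Injective (e' ∘ₗ f') := by
    rw [← LinearMap.ker_eq_bot, LinearMap.ker_eq_bot']
    rintro ⟨v, hv⟩ h0
    exact Subtype.ext (hinj v hv (congrArg Subtype.val h0))
  have h2 : Function.Surjective e' :=
    Function.Surjective.of_comp (g := f') (LinearMap.injective_iff_surjective.1 h1)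
  have h3 := LinearMap.finrank_range_add_finrank_ker e'
  rw [LinearMap.range_eq_top.2 h2, finrank_top] at h3
  have h4 : Module.finrank K (LinearMap.ker e') =
      Module.finrank K (A ⊓ LinearMap.ker e : Submodule K E) := by
    have : (A ⊓ LinearMap.ker e : Submodule K E) = (LinearMap.ker e').map A.subtype := by
      ext v
      simp [e', LinearMap.restrict_apply, Subtype.ext_iff, and_comm]
    rw [this]
    exact (LinearEquiv.finrank_eq (Submodule.equivMapOfInjective _ A.injective_subtype _))
  omega

end Sl2

section Weight

variable {K σ : Type*} [Field K]

/-- The derivation `X i ↦ c i • X i`. -/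
noncomputable def weightDer (c : σ → K) :
    Derivation K (MvPolynomial σ K) (MvPolynomial σ K) :=
  MvPolynomial.mkDerivation K fun i => c i • MvPolynomial.X i

@[simp]
theorem weightDer_X (c : σ → K) (i : σ) :
    weightDer c (MvPolynomial.X i) = c i • MvPolynomial.X i :=
  MvPolynomial.mkDerivation_X _ _ _

theorem weightDer_monomial (c : σ → K) (m : σ →₀ ℕ) (a : K) :
    weightDer c (MvPolynomial.monomial m a) =
      (m.sum fun i k => (k : K) * c i) • MvPolynomial.monomial m a := by
  rw [weightDer, MvPolynomial.mkDerivation_monomial, Finsupp.sum, Finsupp.sum, Finset.sum_smul,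
    Finset.smul_sum]
  refine Finset.sum_congr rfl fun i hi => ?_
  have hi' : m - Finsupp.single i 1 + Finsupp.single i 1 = m :=
    tsub_add_cancel_of_le (Finsupp.single_le_iff.2
      (Nat.one_le_iff_ne_zero.2 (Finsupp.mem_support_iff.1 hi)))
  rw [smul_eq_mul, MvPolynomial.X, MvPolynomial.smul_monomial, MvPolynomial.monomial_mul, hi',
    MvPolynomial.smul_monomial, MvPolynomial.smul_monomial]
  congr 1
  simp only [smul_eq_mul]
  ring

theorem coeff_weightDer (c : σ → K) (m : σ →₀ ℕ) (P : MvPolynomial σ K) :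
    (weightDer c P).coeff m = (m.sum fun i k => (k : K) * c i) * P.coeff m := by
  classical
  induction P using MvPolynomial.induction_on' with
  | monomial u a =>
    rw [weightDer_monomial, MvPolynomial.coeff_smul, MvPolynomial.coeff_monomial]
    split_ifs with h
    · rw [h, smul_eq_mul]
    · simp
  | add p q hp hq => simp [hp, hq, mul_add]

theorem weightDer_eq_smul_iff (c : σ → K) (a : K) (P : MvPolynomial σ K) :
    weightDer c P = a • P ↔ ∀ m ∈ P.support, (m.sum fun i k => (k : K) * c i) = a := by
  simp only [MvPolynomial.ext_iff, coeff_weightDer, MvPolynomial.coeff_smul, smul_eq_mul,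
    MvPolynomial.mem_support_iff]
  refine forall_congr' fun m => ?_
  by_cases h : MvPolynomial.coeff m P = 0 <;> simp [h]

end Weight

section Matrix

open Matrix

theorem map_derivation_mul {R A n : Type*} [CommRing R] [CommRing A] [Algebra R A] [Fintype n]
    (D : Derivation R A A) (M N : Matrix n n A) :
    (M * N).map D = M.map D * N + M * N.map D := by
  ext i j
  simp [Matrix.mul_apply, Finset.sum_add_distrib, mul_comm, add_comm]

variable {K N : Type*} [Field K]

/-- The generic matrix, whose entries are the coordinate functions. -/
noncomputable def genericMatrix (K N : Type*) [Field K] :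
    Matrix N N (MvPolynomial (N × N) K) :=
  Matrix.of fun i j => MvPolynomial.X (i, j)

theorem derivation_ext_genericMatrix
    {D₁ D₂ : Derivation K (MvPolynomial (N × N) K) (MvPolynomial (N × N) K)}
    (h : (genericMatrix K N).map D₁ = (genericMatrix K N).map D₂) : D₁ = D₂ := by
  refine MvPolynomial.derivation_ext fun p => ?_
  simpa [genericMatrix] using congrFun₂ h p.1 p.2

theorem map_lie (D₁ D₂ : Derivation K (MvPolynomial (N × N) K) (MvPolynomial (N × N) K))
    (M : Matrix N N (MvPolynomial (N × N) K)) :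
    M.map (⇑⁅D₁, D₂⁆) = (M.map D₂).map D₁ - (M.map D₁).map D₂ := by
  ext1 i j
  simp [Derivation.commutator_apply]

theorem map_C_map_derivation
    (D : Derivation K (MvPolynomial (N × N) K) (MvPolynomial (N × N) K)) (M : Matrix N N K) :
    (M.map MvPolynomial.C).map D = 0 := by
  ext1 i j
  simp

variable [Fintype N]

/-- The derivation of `K[x_{ij}]` sending the generic matrix `x` to `x M - M x`. -/
noncomputable def commDer (M : Matrix N N K) :
    Derivation K (MvPolynomial (N × N) K) (MvPolynomial (N × N) K) :=
  MvPolynomial.mkDerivation K fun p =>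
    (genericMatrix K N * M.map MvPolynomial.C - M.map MvPolynomial.C * genericMatrix K N :
      Matrix N N (MvPolynomial (N × N) K)) p.1 p.2

theorem genericMatrix_map_commDer (M : Matrix N N K) :
    (genericMatrix K N).map (commDer M) =
      genericMatrix K N * M.map MvPolynomial.C - M.map MvPolynomial.C * genericMatrix K N := by
  ext1 i j
  simp [commDer, genericMatrix, MvPolynomial.mkDerivation_X]

theorem commDer_lie (A B : Matrix N N K) : ⁅commDer A, commDer B⁆ = commDer ⁅A, B⁆ := by
  apply derivation_ext_genericMatrix
  have key : ∀ A B : Matrix N N K, ((genericMatrix K N).map (commDer B)).map (commDer A) =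
      (genericMatrix K N * A.map MvPolynomial.C - A.map MvPolynomial.C * genericMatrix K N) *
        B.map MvPolynomial.C - B.map MvPolynomial.C *
      (genericMatrix K N * A.map MvPolynomial.C - A.map MvPolynomial.C * genericMatrix K N) := by
    intro A B
    rw [genericMatrix_map_commDer, Matrix.map_sub _ (map_sub _), map_derivation_mul,
      map_derivation_mul, map_C_map_derivation, genericMatrix_map_commDer]
    simp
  rw [map_lie, key, key, genericMatrix_map_commDer, Ring.lie_def, Matrix.map_sub _ (map_sub _),
    Matrix.map_mul, Matrix.map_mul]
  noncomm_ring

theorem commDer_commute {A B : Matrix N N K} (h : Commute A B) (P : MvPolynomial (N × N) K) :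
    commDer A (commDer B P) = commDer B (commDer A P) := by
  have := DFunLike.congr_fun (commDer_lie A B) P
  rw [Derivation.commutator_apply, Ring.lie_def, h.eq, sub_self] at this
  have h0 : commDer (0 : Matrix N N K) = 0 := derivation_ext_genericMatrix (by
    rw [genericMatrix_map_commDer]; ext1 i j; simp)
  rwa [h0, Derivation.zero_apply, sub_eq_zero] at this

theorem commDer_smul (c : K) (A : Matrix N N K) : commDer (c • A) = c • commDer A := by
  apply derivation_ext_genericMatrix
  have : (c • A).map MvPolynomial.C = (c • A.map MvPolynomial.C :
      Matrix N N (MvPolynomial (N × N) K)) := by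
    ext1 i j
    simp [MvPolynomial.smul_eq_C_mul]
  have h2 : (genericMatrix K N).map (⇑(c • commDer A)) =
      c • (genericMatrix K N).map (commDer A) := by
    ext1 i j
    simp
  rw [h2, genericMatrix_map_commDer, genericMatrix_map_commDer, this, mul_smul_comm,
    smul_mul_assoc, smul_sub]

theorem weightDer_one_commDer (A : Matrix N N K) (P : MvPolynomial (N × N) K) :
    weightDer 1 (commDer A P) = commDer A (weightDer 1 P) := by
  rw [← sub_eq_zero, ← Derivation.commutator_apply]
  have hE : (genericMatrix K N).map (weightDer (1 : N × N → K)) = genericMatrix K N := by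
    ext1 i j
    simp [genericMatrix]
  have : ⁅weightDer (1 : N × N → K), commDer A⁆ = 0 := by
    apply derivation_ext_genericMatrix
    rw [map_lie, hE, genericMatrix_map_commDer, Matrix.map_sub _ (map_sub _), map_derivation_mul,
      map_derivation_mul, map_C_map_derivation, hE]
    ext1 i j
    simp
  rw [this, Derivation.zero_apply]

theorem commDer_diagonal [DecidableEq N] (d : N → K) :
    commDer (diagonal d) = weightDer fun p : N × N => d p.2 - d p.1 := by
  apply derivation_ext_genericMatrix
  rw [genericMatrix_map_commDer]
  ext1 i j
  simp [genericMatrix, diagonal_map, MvPolynomial.smul_eq_C_mul, mul_sub, mul_comm]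

end Matrix

section Path

open Matrix

variable {K N : Type*} [Field K]

/-- Evaluation of a polynomial in the matrix entries at a matrix. -/
noncomputable def evalMatrix {A : Type*} [CommRing A] [Algebra K A] (M : Matrix N N A) :
    MvPolynomial (N × N) K →ₐ[K] A :=
  MvPolynomial.aeval fun p => M p.1 p.2

theorem genericMatrix_map_evalMatrix {A : Type*} [CommRing A] [Algebra K A] (M : Matrix N N A) :
    (genericMatrix K N).map (evalMatrix M) = M := by
  ext1 i j
  simp [genericMatrix, evalMatrix]

theorem algHom_evalMatrix {A B : Type*} [CommRing A] [Algebra K A] [CommRing B] [Algebra K B]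
    (φ : A →ₐ[K] B) (M : Matrix N N A) (P : MvPolynomial (N × N) K) :
    φ (evalMatrix M P) = evalMatrix (M.map φ) P := by
  exact MvPolynomial.comp_aeval_apply _ φ P

theorem eq_of_forall_evalMatrix [Infinite K] {P Q : MvPolynomial (N × N) K}
    (h : ∀ M : Matrix N N K, evalMatrix M P = evalMatrix M Q) : P = Q := by
  refine MvPolynomial.funext fun x => ?_
  simpa [evalMatrix, MvPolynomial.aeval_eq_eval] using h (Matrix.of fun i j => x (i, j))

variable [Fintype N]

/-- If a path of matrices satisfies `γ' = E γ - γ E`, then the derivative of a polynomial function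
along it is computed by the derivation attached to `E`. -/
theorem derivative_evalMatrix {E : Matrix N N K} {γ : Matrix N N (Polynomial K)}
    (hγ : γ.map Polynomial.derivative = E.map Polynomial.C * γ - γ * E.map Polynomial.C)
    (P : MvPolynomial (N × N) K) :
    Polynomial.derivative (evalMatrix γ P) = -evalMatrix γ (commDer E P) := by
  induction P using MvPolynomial.induction_on with
  | C a => simp [evalMatrix]
  | add p q hp hq => simp only [map_add, hp, hq]; ring
  | mul_X p i hp =>
    have h1 : Polynomial.derivative (γ i.1 i.2) =
        -evalMatrix γ (commDer E (MvPolynomial.X i)) := by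
      have h2 := congrFun₂ (genericMatrix_map_commDer E) i.1 i.2
      have h3 : ((genericMatrix K N * E.map MvPolynomial.C -
          E.map MvPolynomial.C * genericMatrix K N).map (evalMatrix γ)) =
          γ * E.map Polynomial.C - E.map Polynomial.C * γ := by
        have h4 : (E.map MvPolynomial.C).map (evalMatrix γ) = E.map Polynomial.C := by
          ext1 i j
          simp [evalMatrix]
        rw [Matrix.map_sub _ (map_sub _), Matrix.map_mul, Matrix.map_mul,
          genericMatrix_map_evalMatrix, h4]
      have h5 : commDer E (MvPolynomial.X i) = (genericMatrix K N * E.map MvPolynomial.C -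
          E.map MvPolynomial.C * genericMatrix K N :
            Matrix N N (MvPolynomial (N × N) K)) i.1 i.2 := by
        rw [← h2]; simp [genericMatrix]
      have h6 := congrFun₂ h3 i.1 i.2
      rw [Matrix.map_apply] at h6
      rw [h5, h6]
      have h7 := congrFun₂ hγ i.1 i.2
      rw [Matrix.map_apply] at h7
      rw [h7]
      simp
    have h0 : evalMatrix γ (MvPolynomial.X i : MvPolynomial (N × N) K) = γ i.1 i.2 := by
      simp [evalMatrix]
    rw [map_mul, Polynomial.derivative_mul, hp, h0, h1, Derivation.leibniz]
    simp only [map_add, smul_eq_mul, map_mul, h0]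
    ring

variable [DecidableEq N]

/-- The path `t ↦ (1 + t E) U (1 - t E)`. -/
noncomputable def conjPath (E U : Matrix N N K) : Matrix N N (Polynomial K) :=
  (1 + (Polynomial.X : Polynomial K) • E.map Polynomial.C) * U.map Polynomial.C *
    (1 - (Polynomial.X : Polynomial K) • E.map Polynomial.C)

theorem conjPath_map_eval (E U : Matrix N N K) (t : K) :
    (conjPath E U).map (Polynomial.aeval t) = (1 + t • E) * U * (1 - t • E) := by
  have h1 : ∀ M : Matrix N N K, (M.map Polynomial.C).map (Polynomial.aeval t) = M := by
    intro M
    ext1 i j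
    simp
  have h2 : ((Polynomial.X : Polynomial K) • E.map Polynomial.C).map (Polynomial.aeval t) =
      t • E := by
    ext1 i j
    simp [mul_comm t]
  have h3 : (1 : Matrix N N (Polynomial K)).map (Polynomial.aeval t) = (1 : Matrix N N K) :=
    Matrix.map_one _ (map_zero _) (map_one _)
  rw [conjPath, Matrix.map_mul, Matrix.map_mul, Matrix.map_sub _ (map_sub _),
    Matrix.map_add _ (map_add _), h1, h2, h3]

theorem conjPath_map_derivative {E : Matrix N N K} (hE : E * E = 0) (U : Matrix N N K) :
    (conjPath E U).map Polynomial.derivative =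
      E.map Polynomial.C * conjPath E U - conjPath E U * E.map Polynomial.C := by
  have hE' : E.map Polynomial.C * E.map Polynomial.C = 0 := by
    rw [← Matrix.map_mul, hE]
    ext1 i j
    simp
  have h1 : ∀ M : Matrix N N K,
      (M.map Polynomial.C).map (Polynomial.derivative' (R := K)) = 0 := by
    intro M
    ext1 i j
    simp
  have h2 : ((Polynomial.X : Polynomial K) • E.map Polynomial.C).map
      (Polynomial.derivative' (R := K)) = E.map Polynomial.C := by
    ext1 i j
    simp
  have h3 : (1 : Matrix N N (Polynomial K)).map (Polynomial.derivative' (R := K)) = 0 := by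
    ext1 i j
    by_cases h : i = j <;> simp [h]
  change (conjPath E U).map (Polynomial.derivative' (R := K)) = _
  rw [conjPath, map_derivation_mul, map_derivation_mul, Matrix.map_sub _ (map_sub _),
    Matrix.map_add _ (map_add _), h1, h2, h3]
  set F := E.map Polynomial.C
  set V := U.map Polynomial.C
  have e1 : F * (1 + (Polynomial.X : Polynomial K) • F) = F := by
    rw [mul_add, mul_one, mul_smul_comm, hE', smul_zero, add_zero]
  have e2 : (1 - (Polynomial.X : Polynomial K) • F) * F = F := by
    rw [sub_mul, one_mul, smul_mul_assoc, hE', smul_zero, sub_zero]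
  rw [← mul_assoc, ← mul_assoc, e1, mul_assoc _ (1 - _) F, e2]
  simp only [zero_add, mul_neg, mul_zero, add_zero, sub_eq_add_neg]

theorem evalMatrix_unipotent_iff [CharZero K] {E : Matrix N N K} (hE : E * E = 0)
    (P : MvPolynomial (N × N) K) :
    (∀ (t : K) (U : Matrix N N K),
      evalMatrix ((1 + t • E) * U * (1 - t • E)) P = evalMatrix U P) ↔ commDer E P = 0 := by
  have hd := fun U => derivative_evalMatrix (conjPath_map_derivative hE U) P
  have he : ∀ (t : K) (U : Matrix N N K) (Q : MvPolynomial (N × N) K),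
      (evalMatrix (conjPath E U) Q).eval t = evalMatrix ((1 + t • E) * U * (1 - t • E)) Q := by
    intro t U Q
    rw [← conjPath_map_eval, ← algHom_evalMatrix, Polynomial.coe_aeval_eq_eval]
  have he0 : ∀ (U : Matrix N N K) (Q : MvPolynomial (N × N) K),
      (evalMatrix (conjPath E U) Q).eval 0 = evalMatrix U Q := by
    intro U Q
    rw [he]
    simp
  constructor
  · intro h
    refine eq_of_forall_evalMatrix fun U => ?_
    have hc : evalMatrix (conjPath E U) P = Polynomial.C (evalMatrix U P) :=
      Polynomial.funext fun t => by rw [he, h, Polynomial.eval_C]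
    have := hd U
    rw [hc, Polynomial.derivative_C, zero_eq_neg] at this
    rw [← he0, this, map_zero, Polynomial.eval_zero]
  · intro h t U
    have := hd U
    rw [h, map_zero, neg_zero] at this
    rw [← he, ← he0 U, Polynomial.eq_C_of_derivative_eq_zero this, Polynomial.eval_C,
      Polynomial.eval_C]

end Path

section Invariants

open Matrix

variable {K : Type*} [Field K]

/-- The standard basis of `sl₂`: the raising operator. -/
def slE (K : Type*) [Field K] : Matrix (Fin 2) (Fin 2) K := !![0, 1; 0, 0]

/-- The standard basis of `sl₂`: the lowering operator. -/
def slF (K : Type*) [Field K] : Matrix (Fin 2) (Fin 2) K := !![0, 0; 1, 0]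

/-- The standard basis of `sl₂`: the diagonal element. -/
def slH (K : Type*) [Field K] : Matrix (Fin 2) (Fin 2) K := diagonal ![1, -1]

theorem slE_lie_slF : slE K * slF K - slF K * slE K = slH K := by
  ext i j
  fin_cases i <;> fin_cases j <;> simp [slE, slF, slH]

theorem slH_lie_slE : slH K * slE K - slE K * slH K = (2 : K) • slE K := by
  ext i j
  simp only [slH, Matrix.sub_apply, Matrix.smul_apply, diagonal_mul, mul_diagonal]
  fin_cases i <;> fin_cases j <;> simp [slE, one_add_one_eq_two]

theorem slH_lie_slF : slH K * slF K - slF K * slH K = (-2 : K) • slF K := by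
  ext i j
  simp only [slH, Matrix.sub_apply, Matrix.smul_apply, diagonal_mul, mul_diagonal]
  fin_cases i <;> fin_cases j <;> simp [slF]
  norm_num

theorem slE_mul_self : slE K * slE K = 0 := by
  ext i j
  fin_cases i <;> fin_cases j <;> simp [slE]

theorem slF_mul_self : slF K * slF K = 0 := by
  ext i j
  fin_cases i <;> fin_cases j <;> simp [slF]

theorem transvectionStruct_fin_two (t : TransvectionStruct (Fin 2) K) :
    t.toMatrix = 1 + t.c • slE K ∨ t.toMatrix = 1 + t.c • slF K := by
  obtain ⟨i, j, hij, c⟩ := t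
  fin_cases i <;> fin_cases j
  · exact absurd rfl hij
  · left
    ext a b
    fin_cases a <;> fin_cases b <;>
      simp [slE, TransvectionStruct.toMatrix, transvection, Matrix.single]
  · right
    ext a b
    fin_cases a <;> fin_cases b <;>
      simp [slF, TransvectionStruct.toMatrix, transvection, Matrix.single]
  · exact absurd rfl hij

theorem inv_one_add_smul {R n : Type*} [CommRing R] [Fintype n] [DecidableEq n] {E : Matrix n n R}
    (hE : E * E = 0) (t : R) : (1 + t • E)⁻¹ = 1 - t • E := by
  refine Matrix.inv_eq_right_inv ?_
  rw [mul_sub, mul_one, mul_smul_comm, add_mul, one_mul, smul_mul_assoc, hE]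
  simp

theorem isUnit_det_one_add_smul {R n : Type*} [CommRing R] [Fintype n] [DecidableEq n]
    {E : Matrix n n R} (hE : E * E = 0) (t : R) : IsUnit (1 + t • E).det := by
  refine Matrix.isUnit_det_of_right_inverse (B := 1 - t • E) ?_
  rw [mul_sub, mul_one, mul_smul_comm, add_mul, one_mul, smul_mul_assoc, hE]
  simp

/-- Homogeneous polynomials of degree `n`, as an eigenspace of the Euler derivation. -/
noncomputable def homogeneous (K σ : Type*) [Field K] (n : ℕ) : Submodule K (MvPolynomial σ K) :=
  Module.End.eigenspace (weightDer (1 : σ → K)).toLinearMap (n : K)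

theorem mem_homogeneous {σ : Type*} {n : ℕ} {P : MvPolynomial σ K} :
    P ∈ homogeneous K σ n ↔ weightDer 1 P = (n : K) • P :=
  Module.End.mem_eigenspace_iff

theorem mem_homogeneous_iff_degree [CharZero K] {σ : Type*} {n : ℕ} {P : MvPolynomial σ K} :
    P ∈ homogeneous K σ n ↔ ∀ m ∈ P.support, m.degree = n := by
  rw [mem_homogeneous, weightDer_eq_smul_iff]
  refine forall₂_congr fun m _ => ?_
  simp only [Pi.one_apply, mul_one, Finsupp.degree, Finsupp.sum]
  norm_cast

instance [CharZero K] {σ : Type*} [Finite σ] (n : ℕ) : Module.Finite K (homogeneous K σ n) := by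
  refine Submodule.finiteDimensional_of_le (S₂ := MvPolynomial.restrictTotalDegree σ K n) ?_
  intro P hP
  rw [mem_homogeneous_iff_degree] at hP
  rw [MvPolynomial.mem_restrictTotalDegree]
  exact Finset.sup_le fun m hm => (hP m hm).le

variable {N : Type*} [Fintype N]

theorem commDer_mem_homogeneous (A : Matrix N N K) {n : ℕ} {P : MvPolynomial (N × N) K}
    (hP : P ∈ homogeneous K (N × N) n) : commDer A P ∈ homogeneous K (N × N) n := by
  rw [mem_homogeneous] at hP ⊢
  rw [weightDer_one_commDer, hP, Derivation.map_smul]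

variable [DecidableEq N] (κ : Matrix (Fin 2) (Fin 2) K →ₐ[K] Matrix N N K)

theorem commDer_lie_apply (A B : Matrix (Fin 2) (Fin 2) K) (P : MvPolynomial (N × N) K) :
    commDer (κ A) (commDer (κ B) P) - commDer (κ B) (commDer (κ A) P) =
      commDer (κ (A * B - B * A)) P := by
  rw [← Derivation.commutator_apply, commDer_lie, Ring.lie_def, map_sub, map_mul, map_mul]

theorem commDer_slE_slF (P : MvPolynomial (N × N) K) :
    commDer (κ (slE K)) (commDer (κ (slF K)) P) - commDer (κ (slF K)) (commDer (κ (slE K)) P) =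
      commDer (κ (slH K)) P := by
  rw [commDer_lie_apply, slE_lie_slF]

theorem commDer_slH_slE (P : MvPolynomial (N × N) K) :
    commDer (κ (slH K)) (commDer (κ (slE K)) P) - commDer (κ (slE K)) (commDer (κ (slH K)) P) =
      (2 : K) • commDer (κ (slE K)) P := by
  rw [commDer_lie_apply, slH_lie_slE, map_smul, commDer_smul, Derivation.smul_apply]

theorem commDer_slH_slF (P : MvPolynomial (N × N) K) :
    commDer (κ (slH K)) (commDer (κ (slF K)) P) - commDer (κ (slF K)) (commDer (κ (slH K)) P) =
      (-2 : K) • commDer (κ (slF K)) P := by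
  rw [commDer_lie_apply, slH_lie_slF, map_smul, commDer_smul, Derivation.smul_apply]

theorem evalMatrix_diagonal_conj [CharZero K] {π : N → Fin 2} {P : MvPolynomial (N × N) K}
    (hP : commDer (diagonal (![1, -1] ∘ π)) P = 0) {d : Fin 2 → K} (hd : ∀ i, d i ≠ 0)
    (U : Matrix N N K) :
    evalMatrix (diagonal (d ∘ π) * U * diagonal (d⁻¹ ∘ π)) P = evalMatrix U P := by
  rw [commDer_diagonal, ← zero_smul K P, weightDer_eq_smul_iff] at hP
  rw [evalMatrix, evalMatrix, MvPolynomial.aeval_def, MvPolynomial.aeval_def,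
    MvPolynomial.eval₂_eq', MvPolynomial.eval₂_eq']
  refine Finset.sum_congr rfl fun m hm => ?_
  congr 1
  let w : N × N → ℤ := fun p => (π p.2 : ℤ) - (π p.1 : ℤ)
  have hw : ∑ p, w p * m p = 0 := by
    have h1 := hP m hm
    rw [Finsupp.sum_fintype _ _ (by simp)] at h1
    have h2 : ∀ p : N × N, ((![1, -1] : Fin 2 → K) ∘ π) p.2 - ((![1, -1] : Fin 2 → K) ∘ π) p.1 =
        ((-2 * w p : ℤ) : K) := by
      intro p
      simp only [Function.comp_apply, w]
      generalize π p.1 = a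
      generalize π p.2 = b
      fin_cases a <;> fin_cases b <;> norm_num
    simp only [h2] at h1
    have h3 : ∑ p, (m p : ℤ) * (-2 * w p) = 0 := by exact_mod_cast h1
    have h4 : ∑ p, (m p : ℤ) * (-2 * w p) = -2 * ∑ p, w p * m p := by
      rw [Finset.mul_sum]
      exact Finset.sum_congr rfl fun p _ => by ring
    omega
  have hq : d 0 / d 1 ≠ 0 := div_ne_zero (hd 0) (hd 1)
  have hentry : ∀ p : N × N, (diagonal (d ∘ π) * U * diagonal (d⁻¹ ∘ π)) p.1 p.2 =
      (d 0 / d 1) ^ w p * U p.1 p.2 := by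
    intro p
    rw [Matrix.mul_diagonal, Matrix.diagonal_mul]
    simp only [Function.comp_apply, w, Pi.inv_apply]
    have h0 := hd 0
    have h1 := hd 1
    generalize π p.1 = a
    generalize π p.2 = b
    fin_cases a <;> fin_cases b <;> simp <;> field_simp
  have hprod : ∀ (s : Finset (N × N)) (g : N × N → ℤ),
      ∏ p ∈ s, (d 0 / d 1) ^ g p = (d 0 / d 1) ^ ∑ p ∈ s, g p := by
    intro s g
    induction s using Finset.induction_on with
    | empty => simp
    | insert a s ha ih => rw [Finset.prod_insert ha, Finset.sum_insert ha, ih, zpow_add₀ hq]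
  have hone : ∏ p, ((d 0 / d 1) ^ w p) ^ m p = 1 := by
    simp only [← zpow_natCast, ← _root_.zpow_mul]
    rw [hprod, hw, zpow_zero]
  simp only [hentry, mul_pow, Finset.prod_mul_distrib, hone, one_mul]

/-- A homogeneous polynomial function is invariant under conjugation by the image of `GL₂` if and
only if it has weight zero and is killed by the raising operator. -/
theorem evalMatrix_conj_iff [CharZero K] {π : N → Fin 2}
    (hκ : ∀ d : Fin 2 → K, κ (diagonal d) = diagonal (d ∘ π)) {n : ℕ}
    {P : MvPolynomial (N × N) K} (hP : P ∈ homogeneous K (N × N) n) :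
    (∀ G : Matrix (Fin 2) (Fin 2) K, G.det ≠ 0 → ∀ U : Matrix N N K,
      evalMatrix (κ G * U * κ G⁻¹) P = evalMatrix U P) ↔
      commDer (κ (slH K)) P = 0 ∧ commDer (κ (slE K)) P = 0 := by
  have hκnil : ∀ {A : Matrix (Fin 2) (Fin 2) K}, A * A = 0 → κ A * κ A = 0 := fun h => by
    rw [← map_mul, h, map_zero]
  have hconj : ∀ {A : Matrix (Fin 2) (Fin 2) K}, A * A = 0 → ∀ (t : K) (U : Matrix N N K),
      κ (1 + t • A) * U * κ (1 + t • A)⁻¹ = (1 + t • κ A) * U * (1 - t • κ A) := fun h t U => by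
    rw [inv_one_add_smul h]
    simp
  constructor
  · intro h
    have hnil : ∀ {A : Matrix (Fin 2) (Fin 2) K}, A * A = 0 → commDer (κ A) P = 0 := fun hA =>
      (evalMatrix_unipotent_iff (hκnil hA) P).1 fun t U => by
        rw [← hconj hA]
        exact h _ (isUnit_det_one_add_smul hA t).ne_zero U
    have hE := hnil (slE_mul_self (K := K))
    have hF := hnil (slF_mul_self (K := K))
    refine ⟨?_, hE⟩
    rw [← commDer_slE_slF, hE, hF, map_zero, map_zero, sub_zero]
  · rintro ⟨hH, hE⟩
    have hF : commDer (κ (slF K)) P = 0 :=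
      sl2_lowering_eq_zero (e := (commDer (κ (slE K))).toLinearMap)
        (f := (commDer (κ (slF K))).toLinearMap) (h := (commDer (κ (slH K))).toLinearMap)
        (commDer_slE_slF κ) (commDer_slH_slF κ)
        (fun _ => commDer_mem_homogeneous _) hP hH hE
    intro G hG
    refine diagonal_transvection_induction_of_det_ne_zero
      (fun G => ∀ U : Matrix N N K, evalMatrix (κ G * U * κ G⁻¹) P = evalMatrix U P) G hG
      ?_ ?_ ?_
    · intro d hd U
      rw [det_diagonal, Finset.prod_ne_zero_iff] at hd
      have hd' : ∀ i, d i ≠ 0 := fun i => hd i (Finset.mem_univ i)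
      have hinv : (diagonal d)⁻¹ = diagonal d⁻¹ := by
        refine Matrix.inv_eq_right_inv ?_
        rw [diagonal_mul_diagonal, ← diagonal_one]
        congr 1
        ext i
        exact mul_inv_cancel₀ (hd' i)
      rw [hinv, hκ, hκ]
      rw [slH, hκ] at hH
      exact evalMatrix_diagonal_conj hH hd' U
    · intro t U
      rcases transvectionStruct_fin_two t with ht | ht
      · rw [ht, hconj slE_mul_self]
        exact (evalMatrix_unipotent_iff (hκnil slE_mul_self) P).2 hE t.c U
      · rw [ht, hconj slF_mul_self]
        exact (evalMatrix_unipotent_iff (hκnil slF_mul_self) P).2 hF t.c U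
    · intro A B _ _ hA hB U
      rw [Matrix.mul_inv_rev, map_mul, map_mul, ← hB U, ← hA (κ B * U * κ B⁻¹)]
      congr 1
      simp only [Matrix.mul_assoc]

end Invariants

section Bigrading

open Matrix Kronecker

variable {K N : Type*} [Field K] [Fintype N] [DecidableEq N]
  (κ κ' : Matrix (Fin 2) (Fin 2) K →ₐ[K] Matrix N N K)

/-- The homogeneous polynomials of degree `n` and weight `(2 * i, 2 * j)`. -/
noncomputable def weightSpace (n : ℕ) (i j : ℤ) : Submodule K (MvPolynomial (N × N) K) :=
  homogeneous K (N × N) n ⊓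
    Module.End.eigenspace (commDer (κ (slH K))).toLinearMap (2 * i : K) ⊓
    Module.End.eigenspace (commDer (κ' (slH K))).toLinearMap (2 * j : K)

variable {κ κ'} in
theorem mem_weightSpace {n : ℕ} {i j : ℤ} {P : MvPolynomial (N × N) K} :
    P ∈ weightSpace κ κ' n i j ↔ (P ∈ homogeneous K (N × N) n ∧
      commDer (κ (slH K)) P = (2 * i : K) • P) ∧ commDer (κ' (slH K)) P = (2 * j : K) • P := by
  simp only [weightSpace, Submodule.mem_inf, Module.End.mem_eigenspace_iff]
  rfl

theorem weightSpace_comm (n : ℕ) (i j : ℤ) : weightSpace κ κ' n i j = weightSpace κ' κ n j i := by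
  ext P
  simp only [mem_weightSpace, and_right_comm]

instance [CharZero K] (n : ℕ) (i j : ℤ) : Module.Finite K (weightSpace κ κ' n i j) :=
  Submodule.finiteDimensional_of_le (S₂ := homogeneous K (N × N) n)
    fun _ hP => (mem_weightSpace.1 hP).1.1

variable {κ κ'}

theorem raise_mem_weightSpace (hc : ∀ A B, Commute (κ A) (κ' B)) {n : ℕ} {i i' j : ℤ}
    (hi : i + 1 = i') {P : MvPolynomial (N × N) K} (hP : P ∈ weightSpace κ κ' n i j) :
    commDer (κ (slE K)) P ∈ weightSpace κ κ' n i' j := by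
  subst hi
  rw [mem_weightSpace] at hP ⊢
  obtain ⟨⟨h1, h2⟩, h3⟩ := hP
  refine ⟨⟨commDer_mem_homogeneous _ h1, ?_⟩, ?_⟩
  · have := commDer_slH_slE κ P
    rw [h2, Derivation.map_smul, sub_eq_iff_eq_add] at this
    rw [this, ← add_smul]
    congr 1
    push_cast
    ring
  · rw [← commDer_commute (hc _ _), h3, Derivation.map_smul]

theorem lower_mem_weightSpace (hc : ∀ A B, Commute (κ A) (κ' B)) {n : ℕ} {i i' j : ℤ}
    (hi : i + 1 = i') {P : MvPolynomial (N × N) K} (hP : P ∈ weightSpace κ κ' n i' j) :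
    commDer (κ (slF K)) P ∈ weightSpace κ κ' n i j := by
  subst hi
  rw [mem_weightSpace] at hP ⊢
  obtain ⟨⟨h1, h2⟩, h3⟩ := hP
  refine ⟨⟨commDer_mem_homogeneous _ h1, ?_⟩, ?_⟩
  · have := commDer_slH_slF κ P
    rw [h2, Derivation.map_smul, sub_eq_iff_eq_add] at this
    rw [this, ← add_smul]
    congr 1
    push_cast
    ring
  · rw [← commDer_commute (hc _ _), h3, Derivation.map_smul]

theorem eq_zero_of_raise_lower [CharZero K] {n : ℕ} {j : ℤ} {P : MvPolynomial (N × N) K}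
    (hP : P ∈ weightSpace κ κ' n 1 j)
    (h0 : commDer (κ (slE K)) (commDer (κ (slF K)) P) = 0) : P = 0 := by
  rw [mem_weightSpace] at hP
  obtain ⟨⟨h1, h2⟩, h3⟩ := hP
  refine sl2_eq_zero_of_weight_two (e := (commDer (κ (slE K))).toLinearMap)
    (f := (commDer (κ (slF K))).toLinearMap) (h := (commDer (κ (slH K))).toLinearMap)
    (commDer_slE_slF κ) (commDer_slH_slE κ) (fun _ => commDer_mem_homogeneous _) h1 ?_ h0
  simpa using h2

theorem finrank_ker_slE_add [CharZero K] (hc : ∀ A B, Commute (κ A) (κ' B)) (n : ℕ) (j : ℤ) :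
    Module.finrank K (weightSpace κ κ' n 0 j ⊓
      LinearMap.ker (commDer (κ (slE K))).toLinearMap : Submodule K _) +
        Module.finrank K (weightSpace κ κ' n 1 j) = Module.finrank K (weightSpace κ κ' n 0 j) :=
  finrank_inf_ker_add (e := (commDer (κ (slE K))).toLinearMap)
    (f := (commDer (κ (slF K))).toLinearMap)
    (A := weightSpace κ κ' n 0 j) (B := weightSpace κ κ' n 1 j)
    (fun _ hP => raise_mem_weightSpace hc (zero_add 1) hP)
    (fun _ hP => lower_mem_weightSpace hc (zero_add 1) hP)
    (fun _ hP => eq_zero_of_raise_lower hP)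

theorem finrank_ker_slE_slE_add [CharZero K] (hc : ∀ A B, Commute (κ A) (κ' B)) (n : ℕ) :
    Module.finrank K (weightSpace κ κ' n 0 0 ⊓
      LinearMap.ker (commDer (κ (slE K))).toLinearMap ⊓
      LinearMap.ker (commDer (κ' (slE K))).toLinearMap : Submodule K _) +
        Module.finrank K (weightSpace κ κ' n 0 1 ⊓
      LinearMap.ker (commDer (κ (slE K))).toLinearMap : Submodule K _) =
    Module.finrank K (weightSpace κ κ' n 0 0 ⊓
      LinearMap.ker (commDer (κ (slE K))).toLinearMap : Submodule K _) := by
  have hc' : ∀ A B, Commute (κ' A) (κ B) := fun A B => (hc B A).symm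
  have hker : ∀ A {P : MvPolynomial (N × N) K},
      P ∈ LinearMap.ker (commDer (κ (slE K))).toLinearMap →
      commDer (κ' A) P ∈ LinearMap.ker (commDer (κ (slE K))).toLinearMap := by
    intro A P hP
    change commDer (κ (slE K)) P = 0 at hP
    change commDer (κ (slE K)) (commDer (κ' A) P) = 0
    rw [commDer_commute (hc _ _), hP, map_zero]
  refine finrank_inf_ker_add (e := (commDer (κ' (slE K))).toLinearMap)
    (f := (commDer (κ' (slF K))).toLinearMap)
    (A := weightSpace κ κ' n 0 0 ⊓ LinearMap.ker (commDer (κ (slE K))).toLinearMap)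
    (B := weightSpace κ κ' n 0 1 ⊓ LinearMap.ker (commDer (κ (slE K))).toLinearMap) ?_ ?_ ?_
  · intro P hP
    obtain ⟨hP, hP'⟩ := Submodule.mem_inf.1 hP
    refine Submodule.mem_inf.2 ⟨?_, hker _ hP'⟩
    rw [weightSpace_comm] at hP ⊢
    exact raise_mem_weightSpace hc' (zero_add 1) hP
  · intro P hP
    obtain ⟨hP, hP'⟩ := Submodule.mem_inf.1 hP
    refine Submodule.mem_inf.2 ⟨?_, hker _ hP'⟩
    rw [weightSpace_comm] at hP ⊢
    exact lower_mem_weightSpace hc' (zero_add 1) hP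
  · intro P hP h0
    have hP := (Submodule.mem_inf.1 hP).1
    rw [weightSpace_comm] at hP
    exact eq_zero_of_raise_lower hP h0

/-- The highest weight vectors of weight `(0, 0)`. -/
theorem finrank_highest_weight [CharZero K] (hc : ∀ A B, Commute (κ A) (κ' B)) (n : ℕ) :
    (Module.finrank K (weightSpace κ κ' n 0 0 ⊓
      LinearMap.ker (commDer (κ (slE K))).toLinearMap ⊓
      LinearMap.ker (commDer (κ' (slE K))).toLinearMap : Submodule K _) : ℤ) =
    Module.finrank K (weightSpace κ κ' n 0 0) - Module.finrank K (weightSpace κ κ' n 0 1) -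
      Module.finrank K (weightSpace κ κ' n 1 0) + Module.finrank K (weightSpace κ κ' n 1 1) := by
  have h := finrank_ker_slE_slE_add hc n
  have h0 := finrank_ker_slE_add hc n 0
  have h1 := finrank_ker_slE_add hc n 1
  zify at h h0 h1
  linarith only [h, h0, h1]

end Bigrading

section Kronecker

open Matrix Kronecker

variable {K : Type*} [Field K]

/-- The embedding `G ↦ G ⊗ 1`. -/
noncomputable def kronLeft (K : Type*) [Field K] :
    Matrix (Fin 2) (Fin 2) K →ₐ[K] Matrix (Fin 2 × Fin 2) (Fin 2 × Fin 2) K :=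
  AlgHom.ofLinearMap
    { toFun := fun A => A ⊗ₖ (1 : Matrix (Fin 2) (Fin 2) K)
      map_add' := fun A B => add_kronecker A B 1
      map_smul' := fun c A => smul_kronecker c A 1 }
    one_kronecker_one fun A B => by
      simp only [LinearMap.coe_mk, AddHom.coe_mk]
      rw [← mul_kronecker_mul, mul_one]

/-- The embedding `H ↦ 1 ⊗ H`. -/
noncomputable def kronRight (K : Type*) [Field K] :
    Matrix (Fin 2) (Fin 2) K →ₐ[K] Matrix (Fin 2 × Fin 2) (Fin 2 × Fin 2) K :=
  AlgHom.ofLinearMap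
    { toFun := fun A => (1 : Matrix (Fin 2) (Fin 2) K) ⊗ₖ A
      map_add' := fun A B => kronecker_add 1 A B
      map_smul' := fun c A => kronecker_smul c 1 A }
    one_kronecker_one fun A B => by
      simp only [LinearMap.coe_mk, AddHom.coe_mk]
      rw [← mul_kronecker_mul, mul_one]

theorem kronLeft_apply (A : Matrix (Fin 2) (Fin 2) K) : kronLeft K A = A ⊗ₖ 1 := rfl

theorem kronRight_apply (A : Matrix (Fin 2) (Fin 2) K) : kronRight K A = 1 ⊗ₖ A := rfl

theorem kronLeft_mul_kronRight (A B : Matrix (Fin 2) (Fin 2) K) :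
    kronLeft K A * kronRight K B = A ⊗ₖ B := by
  rw [kronLeft_apply, kronRight_apply, ← mul_kronecker_mul, mul_one, one_mul]

theorem commute_kronLeft_kronRight (A B : Matrix (Fin 2) (Fin 2) K) :
    Commute (kronLeft K A) (kronRight K B) := by
  rw [Commute, SemiconjBy, kronLeft_mul_kronRight, kronLeft_apply, kronRight_apply,
    ← mul_kronecker_mul, mul_one, one_mul]

theorem kronLeft_diagonal (d : Fin 2 → K) :
    kronLeft K (diagonal d) = diagonal (d ∘ Prod.fst) := by
  rw [kronLeft_apply, ← diagonal_one, diagonal_kronecker_diagonal]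
  simp [Function.comp_def]

theorem kronRight_diagonal (d : Fin 2 → K) :
    kronRight K (diagonal d) = diagonal (d ∘ Prod.snd) := by
  rw [kronRight_apply, ← diagonal_one, diagonal_kronecker_diagonal]
  simp [Function.comp_def]

/-- A labelling of the matrix units of `M₂` for which the first has weight `1`, the second `-1` and
the others `0`. -/
noncomputable def unitLabel : Fin 4 ≃ Fin 2 × Fin 2 :=
  Equiv.ofBijective ![(1, 0), (0, 1), (0, 0), (1, 1)] (by decide)

/-- Labelling of the coordinates on `M₂ ⊗ M₂` by pairs of matrix units. -/
noncomputable def coordLabel : Fin 4 × Fin 4 ≃ (Fin 2 × Fin 2) × (Fin 2 × Fin 2) :=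
  (Equiv.prodCongr unitLabel unitLabel).trans (Equiv.prodProdProdComm _ _ _ _)

/-- Matrices of exponents as monomials in the coordinates on `M₂ ⊗ M₂`. -/
noncomputable def exponentEquiv :
    ((Fin 2 × Fin 2) × (Fin 2 × Fin 2) →₀ ℕ) ≃ Matrix (Fin 4) (Fin 4) ℕ :=
  (Finsupp.equivFunOnFinite.trans (coordLabel.symm.arrowCongr (Equiv.refl ℕ))).trans
    (Equiv.curry _ _ _)

theorem sum_exponent_mul {R : Type*} [CommSemiring R]
    (m : (Fin 2 × Fin 2) × (Fin 2 × Fin 2) →₀ ℕ) (g : (Fin 2 × Fin 2) × (Fin 2 × Fin 2) → R) :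
    (m.sum fun p k => (k : R) * g p) =
      ∑ r, ∑ s, (exponentEquiv m r s : R) * g (coordLabel (r, s)) := by
  rw [Finsupp.sum_fintype _ _ (by simp), ← coordLabel.sum_comp, Fintype.sum_prod_type]
  rfl

theorem mem_weightSpace_iff_support [CharZero K] {n : ℕ} {i j : ℤ}
    {P : MvPolynomial ((Fin 2 × Fin 2) × (Fin 2 × Fin 2)) K} :
    P ∈ weightSpace (kronLeft K) (kronRight K) n i j ↔
      ∀ m ∈ P.support, exponentEquiv m ∈ {M : Matrix (Fin 4) (Fin 4) ℕ |
        (∑ r : Fin 4, ∑ s : Fin 4, M r s) = n ∧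
        ((∑ s : Fin 4, (M 0 s : ℤ)) - ∑ s : Fin 4, (M 1 s : ℤ)) = i ∧
        ((∑ r : Fin 4, (M r 0 : ℤ)) - ∑ r : Fin 4, (M r 1 : ℤ)) = j} := by
  rw [mem_weightSpace, mem_homogeneous, slH, kronLeft_diagonal, kronRight_diagonal,
    commDer_diagonal, commDer_diagonal, weightDer_eq_smul_iff, weightDer_eq_smul_iff,
    weightDer_eq_smul_iff, ← forall₂_and, ← forall₂_and]
  refine forall₂_congr fun m _ => ?_
  have hcast : ∀ x y : ℤ, x = y ↔ (2 * x : K) = 2 * y := fun x y => by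
    rw [mul_right_inj' two_ne_zero, Int.cast_inj]
  rw [and_assoc, sum_exponent_mul, sum_exponent_mul, sum_exponent_mul, Set.mem_ofPred_eq]
  generalize exponentEquiv m = M
  refine and_congr ?_ (and_congr ?_ ?_)
  · simp only [Pi.one_apply, mul_one]
    norm_cast
  · rw [hcast]
    refine Eq.congr ?_ rfl
    simp [Fin.sum_univ_four, coordLabel, unitLabel]
    ring
  · rw [hcast]
    refine Eq.congr ?_ rfl
    simp [Fin.sum_univ_four, coordLabel, unitLabel]
    ring

theorem finrank_restrictSupport {σ : Type*} (s : Set (σ →₀ ℕ)) :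
    Module.finrank K (MvPolynomial.restrictSupport K s) = s.ncard :=
  Module.finrank_eq_nat_card_basis (MvPolynomial.basisRestrictSupport K s)

theorem finrank_weightSpace [CharZero K] (n : ℕ) (i j : ℤ) :
    Module.finrank K (weightSpace (kronLeft K) (kronRight K) n i j) = fCount i j n := by
  have h : weightSpace (kronLeft K) (kronRight K) n i j = MvPolynomial.restrictSupport K
      (exponentEquiv ⁻¹' {M : Matrix (Fin 4) (Fin 4) ℕ |
        (∑ r : Fin 4, ∑ s : Fin 4, M r s) = n ∧
        ((∑ s : Fin 4, (M 0 s : ℤ)) - ∑ s : Fin 4, (M 1 s : ℤ)) = i ∧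
        ((∑ r : Fin 4, (M r 0 : ℤ)) - ∑ r : Fin 4, (M r 1 : ℤ)) = j}) := by
    ext P
    rw [mem_weightSpace_iff_support, MvPolynomial.mem_restrictSupport_iff]
    rfl
  rw [h, finrank_restrictSupport, fCount,
    Set.ncard_preimage_of_injective_subset_range exponentEquiv.injective
      (by rw [exponentEquiv.range_eq_univ]; exact Set.subset_univ _)]

end Kronecker

section PolynomialFunctions

variable {K U σ : Type*} [Field K] [AddCommGroup U] [Module K U] [Fintype σ]

theorem exists_multilinearMap_monomial (c : U →ₗ[K] (σ → K)) {n : ℕ} {d : σ →₀ ℕ}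
    (hd : d.degree = n) :
    ∃ m : MultilinearMap K (fun _ : Fin n => U) K, ∀ u, m (fun _ => u) = ∏ p, c u p ^ d p := by
  have e : (Σ p, Fin (d p)) ≃ Fin n := Fintype.equivFinOfCardEq <| by
    simpa [Finsupp.degree_eq_sum] using hd
  refine ⟨((MultilinearMap.mkPiAlgebra K (Σ p, Fin (d p)) K).compLinearMap
    fun q => LinearMap.proj q.1 ∘ₗ c).domDomCongr e, fun u => ?_⟩
  simp [Fintype.prod_sigma]

/-- The homogeneous polynomial functions of degree `n`, in coordinates `c`. -/
theorem exists_multilinearMap_iff [CharZero K] (c : U ≃ₗ[K] (σ → K)) {n : ℕ} {F : U → K} :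
    (∃ m : MultilinearMap K (fun _ : Fin n => U) K, ∀ u, F u = m fun _ => u) ↔
      ∃ P ∈ homogeneous K σ n, ∀ u, F u = MvPolynomial.aeval (c u) P := by
  classical
  constructor
  · rintro ⟨m, hm⟩
    let b := Module.Basis.ofEquivFun c
    refine ⟨∑ φ : Fin n → σ, MvPolynomial.C (m fun i => b (φ i)) * ∏ i, MvPolynomial.X (φ i),
      mem_homogeneous_iff_degree.2 fun d hd => ?_, fun u => ?_⟩
    · by_contra hdn
      refine (MvPolynomial.mem_support_iff.1 hd) (MvPolynomial.IsHomogeneous.coeff_eq_zero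
        (.sum _ _ n fun φ _ => .C_mul ?_ _) hdn)
      simpa using MvPolynomial.IsHomogeneous.prod Finset.univ
        (fun i => MvPolynomial.X (φ i) : Fin n → MvPolynomial σ K) 1
        fun i _ => MvPolynomial.isHomogeneous_X K (φ i)
    · have hu : u = ∑ p, c u p • b p := (b.sum_equivFun u).symm
      rw [hm, hu, MultilinearMap.map_sum, ← hu, map_sum]
      refine Finset.sum_congr rfl fun φ _ => ?_
      rw [MultilinearMap.map_smul_univ]
      simp [mul_comm]
  · rintro ⟨P, hP, hF⟩
    rw [mem_homogeneous_iff_degree] at hP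
    choose m hm using fun d : P.support =>
      exists_multilinearMap_monomial c.toLinearMap (hP d.1 d.2)
    refine ⟨∑ d, P.coeff d.1 • m d, fun u => ?_⟩
    rw [hF, MvPolynomial.aeval_eq_eval, MvPolynomial.eval_eq', ← Finset.sum_coe_sort]
    simp [hm]

end PolynomialFunctions

section Main

open Matrix Kronecker

/-- The joint highest weight vectors of weight `(0, 0)` among the polynomials of degree `n`. -/
noncomputable def highestWeightSpace (K : Type*) [Field K] (n : ℕ) :
    Submodule K (MvPolynomial ((Fin 2 × Fin 2) × (Fin 2 × Fin 2)) K) :=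
  weightSpace (kronLeft K) (kronRight K) n 0 0 ⊓
    LinearMap.ker (commDer (kronLeft K (slE K))).toLinearMap ⊓
    LinearMap.ker (commDer (kronRight K (slE K))).toLinearMap

theorem mem_highestWeightSpace {K : Type*} [Field K] [CharZero K] {n : ℕ}
    {P : MvPolynomial ((Fin 2 × Fin 2) × (Fin 2 × Fin 2)) K} :
    P ∈ highestWeightSpace K n ↔ P ∈ homogeneous K _ n ∧
      ∀ G H : Matrix (Fin 2) (Fin 2) K, G.det ≠ 0 → H.det ≠ 0 → ∀ U,
        evalMatrix ((G ⊗ₖ H) * U * (G⁻¹ ⊗ₖ H⁻¹)) P = evalMatrix U P := by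
  have h1 : P ∈ highestWeightSpace K n ↔ P ∈ homogeneous K _ n ∧
      (commDer (kronLeft K (slH K)) P = 0 ∧ commDer (kronLeft K (slE K)) P = 0) ∧
      (commDer (kronRight K (slH K)) P = 0 ∧ commDer (kronRight K (slE K)) P = 0) := by
    rw [highestWeightSpace, Submodule.mem_inf, Submodule.mem_inf, LinearMap.mem_ker,
      LinearMap.mem_ker, Derivation.coeFn_coe, Derivation.coeFn_coe, mem_weightSpace, Int.cast_zero, mul_zero,
      zero_smul]
    exact ⟨fun ⟨⟨⟨⟨h, h1⟩, h2⟩, h3⟩, h4⟩ => ⟨h, ⟨h1, h3⟩, h2, h4⟩,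
      fun ⟨h, ⟨h1, h3⟩, h2, h4⟩ => ⟨⟨⟨⟨h, h1⟩, h2⟩, h3⟩, h4⟩⟩
  rw [h1]
  refine and_congr_right fun hP => ?_
  rw [← evalMatrix_conj_iff _ kronLeft_diagonal hP, ← evalMatrix_conj_iff _ kronRight_diagonal hP]
  simp only [← kronLeft_mul_kronRight]
  constructor
  · rintro ⟨hl, hr⟩ G H hG hH U
    rw [(commute_kronLeft_kronRight G⁻¹ H⁻¹).eq, ← hr H hH U,
      ← hl G hG (kronRight K H * U * kronRight K H⁻¹)]
    simp only [mul_assoc]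
  · intro h
    refine ⟨fun G hG U => ?_, fun H hH U => ?_⟩
    · simpa using h G 1 hG (by simp) U
    · simpa using h 1 H (by simp) hH U

variable {K : Type} [Field K]

/-- The polynomial function on an endomorphism space attached to a polynomial in the matrix
entries. -/
noncomputable def polynomialFunction {N E : Type} [Fintype N] [DecidableEq N] [AddCommGroup E]
    [Module K E] (b : Module.Basis N K E) : MvPolynomial (N × N) K →ₗ[K] (E →ₗ[K] E) → K :=
  LinearMap.pi fun u => (evalMatrix (LinearMap.toMatrix b b u)).toLinearMap

variable {N E : Type} [Fintype N] [DecidableEq N] [AddCommGroup E] [Module K E]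
  (b : Module.Basis N K E)

theorem polynomialFunction_apply (P : MvPolynomial (N × N) K) (u : E →ₗ[K] E) :
    polynomialFunction b P u = evalMatrix (LinearMap.toMatrix b b u) P := rfl

theorem polynomialFunction_injective [Infinite K] :
    Function.Injective (polynomialFunction b) := fun P Q h =>
  eq_of_forall_evalMatrix fun M => by
    simpa [polynomialFunction_apply] using congrFun h (Matrix.toLin b b M)

theorem exists_multilinearMap_iff_polynomialFunction [CharZero K] {n : ℕ}
    {F : (E →ₗ[K] E) → K} :
    (∃ m : MultilinearMap K (fun _ : Fin n => E →ₗ[K] E) K, ∀ u, F u = m fun _ => u) ↔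
      ∃ P ∈ homogeneous K (N × N) n, polynomialFunction b P = F := by
  rw [exists_multilinearMap_iff
    ((LinearMap.toMatrix b b).trans (LinearEquiv.curry K K N N).symm)]
  refine exists_congr fun P => and_congr_right fun _ => ?_
  rw [funext_iff]
  exact forall_congr' fun u => eq_comm

variable {V W : Type} [AddCommGroup V] [Module K V] [AddCommGroup W] [Module K W]
  (bV : Module.Basis (Fin 2) K V) (bW : Module.Basis (Fin 2) K W)

theorem toMatrix_symm (g : V ≃ₗ[K] V) :
    LinearMap.toMatrix bV bV g.symm.toLinearMap =
      (LinearMap.toMatrix bV bV g.toLinearMap)⁻¹ := by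
  refine (Matrix.inv_eq_left_inv ?_).symm
  rw [← LinearMap.toMatrix_comp]
  simp

theorem toMatrix_tensorConjAction (g : V ≃ₗ[K] V) (h : W ≃ₗ[K] W)
    (u : TensorProduct K V W →ₗ[K] TensorProduct K V W) :
    LinearMap.toMatrix (bV.tensorProduct bW) (bV.tensorProduct bW)
      (tensorConjAction K V W (g, h) u) =
    (LinearMap.toMatrix bV bV g.toLinearMap ⊗ₖ LinearMap.toMatrix bW bW h.toLinearMap) *
      LinearMap.toMatrix (bV.tensorProduct bW) (bV.tensorProduct bW) u *
      ((LinearMap.toMatrix bV bV g.toLinearMap)⁻¹ ⊗ₖ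
        (LinearMap.toMatrix bW bW h.toLinearMap)⁻¹) := by
  rw [← toMatrix_symm, ← toMatrix_symm, ← TensorProduct.toMatrix_map, ← TensorProduct.toMatrix_map,
    ← LinearMap.toMatrix_comp, ← LinearMap.toMatrix_comp]
  rfl

theorem invariantPolynomials_eq_map [CharZero K] (n : ℕ) :
    invariantPolynomials K (tensorConjAction K V W) n =
      (highestWeightSpace K n).map (polynomialFunction (bV.tensorProduct bW)) := by
  have key (P : MvPolynomial ((Fin 2 × Fin 2) × (Fin 2 × Fin 2)) K) :
      (∀ G H : Matrix (Fin 2) (Fin 2) K, G.det ≠ 0 → H.det ≠ 0 → ∀ U,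
        evalMatrix ((G ⊗ₖ H) * U * (G⁻¹ ⊗ₖ H⁻¹)) P = evalMatrix U P) ↔
      ∀ γ u, polynomialFunction (bV.tensorProduct bW) P (tensorConjAction K V W γ u) =
        polynomialFunction (bV.tensorProduct bW) P u := by
    constructor
    · rintro h ⟨g, g'⟩ u
      rw [polynomialFunction_apply, toMatrix_tensorConjAction]
      exact h _ _ (g.isUnit_det bV bV).ne_zero (g'.isUnit_det bW bW).ne_zero _
    · intro h G H hG hH U
      have := h (G.toLinearEquiv bV hG.isUnit, H.toLinearEquiv bW hH.isUnit)
        (Matrix.toLin (bV.tensorProduct bW) (bV.tensorProduct bW) U)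
      rw [polynomialFunction_apply, polynomialFunction_apply, toMatrix_tensorConjAction] at this
      have hGL : (G.toLinearEquiv bV hG.isUnit).toLinearMap = Matrix.toLin bV bV G := rfl
      have hHL : (H.toLinearEquiv bW hH.isUnit).toLinearMap = Matrix.toLin bW bW H := rfl
      simpa only [hGL, hHL, LinearMap.toMatrix_toLin] using this
  ext F
  change (∃ m : MultilinearMap K (fun _ : Fin n => _) K, ∀ u, F u = m fun _ => u) ∧
    (∀ γ u, F (tensorConjAction K V W γ u) = F u) ↔ _
  rw [exists_multilinearMap_iff_polynomialFunction (bV.tensorProduct bW), Submodule.mem_map]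
  simp only [mem_highestWeightSpace, key]
  constructor
  · rintro ⟨⟨P, hP, rfl⟩, h⟩
    exact ⟨P, ⟨hP, h⟩, rfl⟩
  · rintro ⟨P, ⟨hP, h⟩, rfl⟩
    exact ⟨⟨P, hP, rfl⟩, h⟩

end Main

end ConjInvariant

/-- For `dim V = dim W = 2`, the dimension of the `n`-th homogeneous component of
`K[End(V ⊗ W)]^{GL(V) × GL(W)}` is `f(0,0,n) − f(0,1,n) − f(1,0,n) + f(1,1,n)`. -/
theorem stmt10 (K : Type) [Field K] [CharZero K] (V W : Type) [AddCommGroup V] [Module K V]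
    [AddCommGroup W] [Module K W]
    (hV : Module.finrank K V = 2) (hW : Module.finrank K W = 2) (n : ℕ) :
    (Module.finrank K (invariantPolynomials K (tensorConjAction K V W) n) : ℤ) =
      (fCount 0 0 n : ℤ) - fCount 0 1 n - fCount 1 0 n + fCount 1 1 n := by
  have : Module.Finite K V := Module.finite_of_finrank_pos (by omega)
  have : Module.Finite K W := Module.finite_of_finrank_pos (by omega)
  let bV := Module.finBasisOfFinrankEq K V hV
  let bW := Module.finBasisOfFinrankEq K W hW
  rw [ConjInvariant.invariantPolynomials_eq_map bV bW, ← LinearEquiv.finrank_eq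
      (Submodule.equivMapOfInjective _
        (ConjInvariant.polynomialFunction_injective (bV.tensorProduct bW)) _),
    ConjInvariant.highestWeightSpace,
    ConjInvariant.finrank_highest_weight ConjInvariant.commute_kronLeft_kronRight]
  simp only [ConjInvariant.finrank_weightSpace]
end

section
/- For integers i, j and n ≥ 0, let f(i,j,n) be the number of 4×4 matrices with nonnegative integer entries whose entries sum to n, such that (sum of the first row) − (sum of the second row) = i and (sum of the first column) − (sum of the second column) = j. Then in ℤ[[x]], Σ_{n≥0} (f(0,0,n) − f(0,1,n) − f(1,0,n) + f(1,1,n)) xⁿ = (1 − x² − x³ + 2x⁴ + 2x⁵ + 2x⁶ − x⁷ − x⁸ + x¹⁰) / ((1−x)(1−x²)⁴(1−x³)³(1−x⁴)²). -/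
open PowerSeries

open AddMonoidAlgebra in
/-- The power series `∑ x ^ (k * m) T ^ (m • w) = (1 - x ^ k T ^ w)⁻¹` over the Laurent
polynomial ring `ℤ[ℤ × ℤ]`. -/
noncomputable def geomSeries (k : ℕ) (w : ℤ × ℤ) : PowerSeries (AddMonoidAlgebra ℤ (ℤ × ℤ)) :=
  PowerSeries.mk fun n => if k ∣ n then single ((n / k) • w) 1 else 0

/-- The Laurent monomial `T ^ w` as a constant power series. -/
noncomputable def laurentMonomial (w : ℤ × ℤ) : PowerSeries (AddMonoidAlgebra ℤ (ℤ × ℤ)) :=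
  PowerSeries.C (AddMonoidAlgebra.single w 1)

lemma laurentMonomial_zero : laurentMonomial 0 = 1 := by
  simp [laurentMonomial, ← AddMonoidAlgebra.one_def]

lemma laurentMonomial_add (w w' : ℤ × ℤ) :
    laurentMonomial (w + w') = laurentMonomial w * laurentMonomial w' := by
  simp [laurentMonomial, ← map_mul, AddMonoidAlgebra.single_mul_single]

lemma geomSeries_mul {k : ℕ} (hk : 0 < k) (w : ℤ × ℤ) :
    geomSeries k w * (1 - X ^ k * laurentMonomial w) = 1 := by
  ext1 n
  rw [mul_sub, mul_one, ← mul_assoc, map_sub, laurentMonomial, PowerSeries.coeff_mul_C,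
    PowerSeries.coeff_mul_X_pow', PowerSeries.coeff_one]
  simp only [geomSeries, PowerSeries.coeff_mk]
  by_cases hkn : k ≤ n
  · obtain ⟨m, rfl⟩ := Nat.exists_eq_add_of_le hkn
    have h0 : k + m ≠ 0 := by omega
    have hd : k ∣ k + m ↔ k ∣ m := by simp
    simp only [hkn, if_true, Nat.add_sub_cancel_left, hd, h0, if_false]
    split_ifs
    · rw [AddMonoidAlgebra.single_mul_single, Nat.add_div_left m hk, succ_nsmul]
      simp
    · simp
  · rw [if_neg hkn]
    by_cases hn : n = 0
    · subst hn
      simp [AddMonoidAlgebra.one_def]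
    · have : ¬ k ∣ n := fun h => hkn (Nat.le_of_dvd (by omega) h)
      simp [hn, this]

/-- The power series whose Laurent monomials all have nonnegative weight with respect to `φ`. -/
def nonnegSubring (φ : ℤ × ℤ →+ ℤ) : Subring (PowerSeries (AddMonoidAlgebra ℤ (ℤ × ℤ))) where
  carrier := {f | ∀ n, ∀ w ∈ (PowerSeries.coeff n f).coeff.support, 0 ≤ φ w}
  mul_mem' := by
    classical
    intro f g hf hg n w hw
    rw [PowerSeries.coeff_mul, AddMonoidAlgebra.coeff_sum] at hw
    obtain ⟨p, -, hp⟩ := Finset.mem_biUnion.1 (Finsupp.support_finsetSum hw)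
    obtain ⟨a, ha, b, hb, rfl⟩ :=
      Finset.mem_add.1 (AddMonoidAlgebra.support_coeff_mul_subset _ _ hp)
    rw [map_add]
    exact add_nonneg (hf _ _ ha) (hg _ _ hb)
  one_mem' := by
    intro n w hw
    rw [PowerSeries.coeff_one] at hw
    split_ifs at hw
    · have : w = 0 := by simpa [AddMonoidAlgebra.one_def] using hw
      simp [this]
    · simp at hw
  add_mem' := by
    classical
    intro f g hf hg n w hw
    rw [map_add, AddMonoidAlgebra.coeff_add] at hw
    rcases Finset.mem_union.1 (Finsupp.support_add hw) with h | h
    exacts [hf _ _ h, hg _ _ h]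
  zero_mem' := by
    intro n w hw
    simp at hw
  neg_mem' := by
    intro f hf n w hw
    rw [map_neg, AddMonoidAlgebra.coeff_neg, Finsupp.support_neg] at hw
    exact hf _ _ hw

lemma geomSeries_mem {φ : ℤ × ℤ →+ ℤ} (k : ℕ) {w : ℤ × ℤ} (hw : 0 ≤ φ w) :
    geomSeries k w ∈ nonnegSubring φ := by
  intro n a ha
  rw [geomSeries, PowerSeries.coeff_mk] at ha
  split_ifs at ha
  · rw [AddMonoidAlgebra.coeff_single] at ha
    obtain rfl := Finset.mem_singleton.1 (Finsupp.support_single_subset ha)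
    rw [map_nsmul]
    exact nsmul_nonneg hw _
  · simp at ha

lemma laurentMonomial_mem {φ : ℤ × ℤ →+ ℤ} {w : ℤ × ℤ} (hw : 0 ≤ φ w) :
    laurentMonomial w ∈ nonnegSubring φ := by
  intro n a ha
  rw [laurentMonomial, PowerSeries.coeff_C] at ha
  split_ifs at ha
  · rw [AddMonoidAlgebra.coeff_single] at ha
    obtain rfl := Finset.mem_singleton.1 (Finsupp.support_single_subset ha)
    exact hw
  · simp at ha

lemma map_mem_nonnegSubring (φ : ℤ × ℤ →+ ℤ) (f : PowerSeries ℤ) :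
    PowerSeries.map (algebraMap ℤ _) f ∈ nonnegSubring φ := by
  intro n a ha
  rw [PowerSeries.coeff_map, AddMonoidAlgebra.coe_algebraMap, Function.comp_apply,
    AddMonoidAlgebra.coeff_single] at ha
  obtain rfl := Finset.mem_singleton.1 (Finsupp.support_single_subset ha)
  exact (map_zero φ).ge

/-- The constant term, in the Laurent variables, of a power series over `ℤ[ℤ × ℤ]`. -/
noncomputable def constTerm : PowerSeries (AddMonoidAlgebra ℤ (ℤ × ℤ)) →+ PowerSeries ℤ where
  toFun f := PowerSeries.mk fun n => (PowerSeries.coeff n f).coeff 0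
  map_zero' := by ext; simp
  map_add' f g := by ext; simp

lemma coeff_constTerm (f : PowerSeries (AddMonoidAlgebra ℤ (ℤ × ℤ))) (n : ℕ) :
    PowerSeries.coeff n (constTerm f) = (PowerSeries.coeff n f).coeff 0 := by
  simp [constTerm]

lemma coeff_constTerm_laurentMonomial_mul (w : ℤ × ℤ)
    (f : PowerSeries (AddMonoidAlgebra ℤ (ℤ × ℤ))) (n : ℕ) :
    PowerSeries.coeff n (constTerm (laurentMonomial w * f)) =
      (PowerSeries.coeff n f).coeff (-w) := by
  rw [coeff_constTerm, laurentMonomial, PowerSeries.coeff_C_mul,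
    AddMonoidAlgebra.coeff_single_mul_apply]
  simp

lemma constTerm_map_mul (c : PowerSeries ℤ) (f : PowerSeries (AddMonoidAlgebra ℤ (ℤ × ℤ))) :
    constTerm (PowerSeries.map (algebraMap ℤ _) c * f) = c * constTerm f := by
  ext n
  simp only [coeff_constTerm, PowerSeries.coeff_mul, AddMonoidAlgebra.coeff_sum,
    Finsupp.finsetSum_apply, PowerSeries.coeff_map]
  refine Finset.sum_congr rfl fun p _ => ?_
  rw [← Algebra.smul_def, AddMonoidAlgebra.coeff_smul_apply, smul_eq_mul]

lemma constTerm_one : constTerm 1 = 1 := by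
  ext n
  rw [coeff_constTerm, PowerSeries.coeff_one, PowerSeries.coeff_one]
  split_ifs <;> simp [AddMonoidAlgebra.one_def]

lemma constTerm_map (c : PowerSeries ℤ) :
    constTerm (PowerSeries.map (algebraMap ℤ _) c) = c := by
  simpa [constTerm_one] using constTerm_map_mul c 1

lemma constTerm_laurentMonomial_mul {φ : ℤ × ℤ →+ ℤ} {w : ℤ × ℤ} (hw : 0 < φ w)
    {f : PowerSeries (AddMonoidAlgebra ℤ (ℤ × ℤ))} (hf : f ∈ nonnegSubring φ) :
    constTerm (laurentMonomial w * f) = 0 := by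
  ext n
  rw [coeff_constTerm_laurentMonomial_mul, map_zero]
  by_contra h
  have := hf n (-w) (Finsupp.mem_support_iff.2 h)
  rw [map_neg] at this
  omega

/-- The difference of the multiplicities of index `0` and of index `1` carried by index `r`. -/
def indexWeight : Fin 4 → ℤ := ![1, -1, 0, 0]

lemma coeff_prod_geomSeries (i j : ℤ) (n : ℕ) :
    (PowerSeries.coeff n (∏ p : Fin 4 × Fin 4,
      geomSeries 1 (indexWeight p.1, indexWeight p.2))).coeff (i, j) = fCount i j n := by
  classical
  have key (l : Fin 4 × Fin 4 →₀ ℕ) : ∏ p : Fin 4 × Fin 4, PowerSeries.coeff (l p)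
      (geomSeries 1 (indexWeight p.1, indexWeight p.2)) =
      AddMonoidAlgebra.single
        (∑ p : Fin 4 × Fin 4, l p • (indexWeight p.1, indexWeight p.2)) 1 := by
    simp [geomSeries, AddMonoidAlgebra.prod_single]
  simp only [PowerSeries.coeff_prod, key, AddMonoidAlgebra.coeff_sum, Finsupp.finsetSum_apply,
    AddMonoidAlgebra.coeff_single, Finsupp.single_apply, Finset.sum_boole]
  rw [fCount, ← Set.ncard_coe_finset]
  refine congrArg Nat.cast (Set.ncard_congr (fun (l : Fin 4 × Fin 4 →₀ ℕ) _ =>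
    Matrix.of fun r s => l (r, s)) ?_ ?_ ?_)
  · intro l hl
    simp only [Finset.coe_filter, Finset.mem_finsuppAntidiag, Set.mem_ofPred_eq, Prod.ext_iff,
      Prod.fst_sum, Prod.snd_sum, Fintype.sum_prod_type, indexWeight] at hl ⊢
    simp [Fin.sum_univ_four] at hl ⊢
    omega
  · intro l m _ _ h
    ext ⟨r, s⟩
    exact congrFun (congrFun h r) s
  · intro M hM
    refine ⟨Finsupp.equivFunOnFinite.symm fun p => M p.1 p.2, ?_, by ext; simp⟩
    simp only [Finset.coe_filter, Finset.mem_finsuppAntidiag, Set.mem_ofPred_eq, Prod.ext_iff,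
      Prod.fst_sum, Prod.snd_sum, Fintype.sum_prod_type, indexWeight] at hM ⊢
    simp [Fin.sum_univ_four] at hM ⊢
    omega

/-- Partial fractions in `u`: if `D` and `D'` are invertible with inverses `g` and `g'`, an identity
of polynomials in `u` obtained by clearing `u' = u⁻¹` splits `N / (D * D')` into a constant, a part
with positive powers of `u` only, and a part with negative powers of `u` only. -/
lemma laurent_split {R B : Type*} [CommRing R] [CommRing B] {ι : B →+* R}
    {S T : Subring R} {u u' g g' D D' Dr N Nr c : R}
    (huu : u * u' = 1) (hS : ∀ b : B, ι b ∈ S) (hT : ∀ b : B, ι b ∈ T)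
    (hu : u ∈ S) (hu' : u' ∈ T) (hg : g ∈ S) (hg' : g' ∈ T)
    (hgD : g * D = 1) (hgD' : g' * D' = 1) (hD' : u ^ 5 * D' = Dr) (hN : u ^ 5 * N = Nr)
    (p₀ p₁ p₂ p₃ p₄ q₀ q₁ q₂ q₃ q₄ : B)
    (h : Nr = c * D * Dr + u * (ι p₀ + ι p₁ * u + ι p₂ * u ^ 2 + ι p₃ * u ^ 3 + ι p₄ * u ^ 4) * Dr +
      (ι q₀ * u ^ 4 + ι q₁ * u ^ 3 + ι q₂ * u ^ 2 + ι q₃ * u + ι q₄) * D) :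
    ∃ P ∈ S, ∃ Q ∈ T, N * (g * g') = c + u * P + u' * Q := by
  refine ⟨(ι p₀ + ι p₁ * u + ι p₂ * u ^ 2 + ι p₃ * u ^ 3 + ι p₄ * u ^ 4) * g, ?_,
    (ι q₀ + ι q₁ * u' + ι q₂ * u' ^ 2 + ι q₃ * u' ^ 3 + ι q₄ * u' ^ 4) * g', ?_, ?_⟩
  · repeat' first
      | assumption | exact hS _ | apply Subring.add_mem | apply Subring.mul_mem
      | apply Subring.pow_mem
  · repeat' first
      | assumption | exact hT _ | apply Subring.add_mem | apply Subring.mul_mem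
      | apply Subring.pow_mem
  · have hq : u ^ 5 * (u' * (ι q₀ + ι q₁ * u' + ι q₂ * u' ^ 2 + ι q₃ * u' ^ 3 + ι q₄ * u' ^ 4)) =
        ι q₀ * u ^ 4 + ι q₁ * u ^ 3 + ι q₂ * u ^ 2 + ι q₃ * u + ι q₄ := by
      have h2 : u ^ 2 * u' ^ 2 = 1 := by rw [← mul_pow, huu, one_pow]
      have h3 : u ^ 3 * u' ^ 3 = 1 := by rw [← mul_pow, huu, one_pow]
      have h4 : u ^ 4 * u' ^ 4 = 1 := by rw [← mul_pow, huu, one_pow]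
      have h5 : u ^ 5 * u' ^ 5 = 1 := by rw [← mul_pow, huu, one_pow]
      linear_combination ι q₀ * u ^ 4 * huu + ι q₁ * u ^ 3 * h2 + ι q₂ * u ^ 2 * h3 +
        ι q₃ * u * h4 + ι q₄ * h5
    have hunit : IsUnit (u ^ 5) := (IsUnit.of_mul_eq_one _ huu).pow 5
    apply hunit.mul_left_cancel
    rw [← hD', ← hN, ← hq] at h
    linear_combination g * g' * h + u ^ 5 * (c + u * (ι p₀ + ι p₁ * u + ι p₂ * u ^ 2 +
      ι p₃ * u ^ 3 + ι p₄ * u ^ 4) * g) * hgD' + u ^ 5 * (c * g' * D' + u' * (ι q₀ +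
      ι q₁ * u' + ι q₂ * u' ^ 2 + ι q₃ * u' ^ 3 + ι q₄ * u' ^ 4) * g') * hgD

set_option maxHeartbeats 400000 in
/-- The first elimination: the partial fraction decomposition in the row variable `u`, where
`t = v + v⁻¹`. -/
lemma row_split {R B : Type*} [CommRing R] [CommRing B] {ι : B →+* R}
    {S T : Subring R} {x s : B} {y t u u' g g' : R}
    (huu : u * u' = 1) (hS : ∀ b : B, ι b ∈ S) (hT : ∀ b : B, ι b ∈ T)
    (hx : ι x = y) (hs : ι s = t) (hu : u ∈ S)
    (hu' : u' ∈ T) (hg : g ∈ S) (hg' : g' ∈ T)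
    (hgD : g * ((1 - y * u) ^ 2 * (1 - t * (y * u) + (y * u) ^ 2)) = 1)
    (hgD' : g' * ((1 - y * u') ^ 2 * (1 - t * (y * u') + (y * u') ^ 2)) = 1) :
    ∃ P ∈ S, ∃ Q ∈ T, ((1 - y ^ 2) ^ 4 * (1 - t * y ^ 2 + y ^ 4) ^ 2 *
        (1 - (t ^ 2 - 2) * y ^ 2 + y ^ 4) * (1 - u')) * (g * g') =
      (1 - y) ^ 2 * (1 - t * y + y ^ 2) * (1 + (y ^ 3 - y ^ 5) * (t + 2) - y ^ 8) +
        u * P + u' * Q := by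
  have hux : u * (1 - y * u') = u - y := by linear_combination -y * huu
  have hus : u ^ 2 * (1 - t * (y * u') + (y * u') ^ 2) = u ^ 2 - t * y * u + y ^ 2 := by
    linear_combination (-t * y * u + y ^ 2 * (u * u' + 1)) * huu
  let p₀ : B := 2 * x - 2 * x ^ 2 - 2 * x ^ 5 + 2 * x ^ 7 + 2 * x ^ 10 - 2 * x ^ 11 + s * (x -
    2 * x ^ 2 + 4 * x ^ 4 - 5 * x ^ 5 + 5 * x ^ 7 - 4 * x ^ 8 + 2 * x ^ 10 - x ^ 11) + s ^ 2 *
    (-x ^ 2 + 3 * x ^ 4 - 2 * x ^ 5 + 2 * x ^ 7 - 3 * x ^ 8 + x ^ 10)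
  let p₁ : B := -2 * x ^ 2 + 2 * x ^ 3 - 2 * x ^ 5 + 4 * x ^ 6 + 2 * x ^ 7 - 4 * x ^ 8 +
    2 * x ^ 9 - 2 * x ^ 10 - 4 * x ^ 11 + 4 * x ^ 12 + s * (-2 * x ^ 2 + 5 * x ^ 3 - 4 * x ^ 4 -
    5 * x ^ 5 + 12 * x ^ 6 - 3 * x ^ 7 - 8 * x ^ 8 + 9 * x ^ 9 - 2 * x ^ 10 - 6 * x ^ 11 +
    4 * x ^ 12) + s ^ 2 * (2 * x ^ 3 - 3 * x ^ 4 - 2 * x ^ 5 + 9 * x ^ 6 - 8 * x ^ 7 - 6 * x ^ 8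
    + 12 * x ^ 9 - x ^ 10 - 4 * x ^ 11 + x ^ 12) + s ^ 3 * (2 * x ^ 6 - 3 * x ^ 7 - 2 * x ^ 8 +
    4 * x ^ 9 - x ^ 11)
  let p₂ : B := 2 * x ^ 3 - 3 * x ^ 4 + 2 * x ^ 5 + 2 * x ^ 6 - 6 * x ^ 7 + x ^ 8 + 2 * x ^ 9 -
    4 * x ^ 10 + 4 * x ^ 11 + 3 * x ^ 12 - 4 * x ^ 13 + 2 * x ^ 14 - x ^ 16 + s * (x ^ 3 -
    4 * x ^ 4 + 5 * x ^ 5 + 2 * x ^ 6 - 11 * x ^ 7 + 8 * x ^ 8 + 5 * x ^ 9 - 12 * x ^ 10 +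
    6 * x ^ 11 + 4 * x ^ 12 - 6 * x ^ 13 + 2 * x ^ 14) + s ^ 2 * (-x ^ 4 + 2 * x ^ 5 - 6 * x ^ 7
    + 8 * x ^ 8 + 2 * x ^ 9 - 9 * x ^ 10 + 4 * x ^ 11 + x ^ 12 - 2 * x ^ 13 + x ^ 14) + s ^ 3 *
    (-x ^ 7 + 2 * x ^ 8 - 2 * x ^ 10 + x ^ 11)
  let p₃ : B := -x ^ 4 + 2 * x ^ 5 - 2 * x ^ 6 + 3 * x ^ 8 - 2 * x ^ 9 + 2 * x ^ 11 - 3 * x ^ 12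
    + 2 * x ^ 14 - 2 * x ^ 15 + x ^ 16 + s * (x ^ 5 - 2 * x ^ 6 + 4 * x ^ 8 - 5 * x ^ 9 +
    5 * x ^ 11 - 4 * x ^ 12 + 2 * x ^ 14 - x ^ 15) + s ^ 2 * (x ^ 8 - 2 * x ^ 9 + 2 * x ^ 11 -
    x ^ 12)
  let q₀ : B := -1 + 2 * x - 2 * x ^ 2 + 3 * x ^ 4 - 2 * x ^ 5 + 2 * x ^ 7 - 3 * x ^ 8 +
    2 * x ^ 10 - 2 * x ^ 11 + x ^ 12 + s * (x - 2 * x ^ 2 + 4 * x ^ 4 - 5 * x ^ 5 + 5 * x ^ 7 -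
    4 * x ^ 8 + 2 * x ^ 10 - x ^ 11) + s ^ 2 * (x ^ 4 - 2 * x ^ 5 + 2 * x ^ 7 - x ^ 8)
  let q₁ : B := -2 * x ^ 2 + 4 * x ^ 3 - 4 * x ^ 5 + 4 * x ^ 6 - 2 * x ^ 7 - 4 * x ^ 8 +
    6 * x ^ 9 - 2 * x ^ 10 - 2 * x ^ 11 + 4 * x ^ 12 - 2 * x ^ 13 + s * (-2 * x ^ 2 + 6 * x ^ 3
    - 4 * x ^ 4 - 6 * x ^ 5 + 12 * x ^ 6 - 5 * x ^ 7 - 8 * x ^ 8 + 11 * x ^ 9 - 2 * x ^ 10 -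
    5 * x ^ 11 + 4 * x ^ 12 - x ^ 13) + s ^ 2 * (2 * x ^ 3 - 3 * x ^ 4 - 4 * x ^ 5 + 9 * x ^ 6 -
    2 * x ^ 7 - 6 * x ^ 8 + 6 * x ^ 9 - x ^ 10 - 2 * x ^ 11 + x ^ 12) + s ^ 3 * (-x ^ 5 +
    2 * x ^ 6 - 2 * x ^ 8 + x ^ 9)
  let q₂ : B := 2 * x ^ 3 - 4 * x ^ 4 + 2 * x ^ 5 + 2 * x ^ 6 - 6 * x ^ 7 + 4 * x ^ 8 +
    2 * x ^ 9 - 4 * x ^ 10 + 4 * x ^ 11 - 4 * x ^ 13 + 2 * x ^ 14 + s * (x ^ 3 - 4 * x ^ 4 +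
    5 * x ^ 5 + 2 * x ^ 6 - 11 * x ^ 7 + 8 * x ^ 8 + 5 * x ^ 9 - 12 * x ^ 10 + 6 * x ^ 11 +
    4 * x ^ 12 - 6 * x ^ 13 + 2 * x ^ 14) + s ^ 2 * (-x ^ 4 + 2 * x ^ 5 + x ^ 6 - 6 * x ^ 7 +
    6 * x ^ 8 + 2 * x ^ 9 - 9 * x ^ 10 + 4 * x ^ 11 + 3 * x ^ 12 - 2 * x ^ 13) + s ^ 3 * (-x ^ 7
    + 2 * x ^ 8 - 2 * x ^ 10 + x ^ 11)
  let q₃ : B := -x ^ 4 + 2 * x ^ 5 - 2 * x ^ 6 + 3 * x ^ 8 - 2 * x ^ 9 + 2 * x ^ 11 - 3 * x ^ 12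
    + 2 * x ^ 14 - 2 * x ^ 15 + x ^ 16 + s * (x ^ 5 - 2 * x ^ 6 + 4 * x ^ 8 - 5 * x ^ 9 +
    5 * x ^ 11 - 4 * x ^ 12 + 2 * x ^ 14 - x ^ 15) + s ^ 2 * (x ^ 8 - 2 * x ^ 9 + 2 * x ^ 11 -
    x ^ 12)
  refine laurent_split (B := B) (ι := ι) (Dr := u * (u - y) ^ 2 * (u ^ 2 - t * y * u + y ^ 2))
    (Nr := (1 - y ^ 2) ^ 4 * (1 - t * y ^ 2 + y ^ 4) ^ 2 *
        (1 - (t ^ 2 - 2) * y ^ 2 + y ^ 4) * (u ^ 5 - u ^ 4))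
    huu hS hT hu hu' hg hg' hgD hgD' ?_ ?_
    p₀ p₁ p₂ p₃ 0 q₀ q₁ q₂ q₃ 0 ?_
  · rw [← hux, ← hus]
    ring
  · linear_combination -(1 - y ^ 2) ^ 4 * (1 - t * y ^ 2 + y ^ 4) ^ 2 *
      (1 - (t ^ 2 - 2) * y ^ 2 + y ^ 4) * u ^ 4 * huu
  · simp only [map_add, map_sub, map_neg, map_mul, map_pow, map_one, map_zero, map_ofNat, hx, hs,
      p₀, p₁, p₂, p₃, q₀, q₁, q₂, q₃]
    ring

set_option maxHeartbeats 400000 in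
/-- The second elimination: the partial fraction decomposition in the column variable `v`. -/
lemma column_split {R B : Type*} [CommRing R] [CommRing B] {ι : B →+* R}
    {S T : Subring R} {x : B} {y v v' g g' : R}
    (hvv : v * v' = 1) (hS : ∀ b : B, ι b ∈ S) (hT : ∀ b : B, ι b ∈ T)
    (hx : ι x = y) (hv : v ∈ S) (hv' : v' ∈ T)
    (hg : g ∈ S) (hg' : g' ∈ T)
    (hgD : g * ((1 - y * v) * (1 - y ^ 2 * v ^ 2) * (1 - y ^ 2 * v) ^ 2) = 1)
    (hgD' : g' * ((1 - y * v') * (1 - y ^ 2 * v' ^ 2) * (1 - y ^ 2 * v') ^ 2) = 1) :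
    ∃ P ∈ S, ∃ Q ∈ T, ((1 - y) * (1 - y ^ 2) * (1 - y ^ 3) ^ 3 * (1 - y ^ 4) ^ 2 *
        ((1 - v') * (1 + (y ^ 3 - y ^ 5) * (v + v' + 2) - y ^ 8))) * (g * g') =
      (1 - y) ^ 2 * (1 - y ^ 2) * (1 - y ^ 2 - y ^ 3 + 2 * y ^ 4 + 2 * y ^ 5 + 2 * y ^ 6 - y ^ 7 -
        y ^ 8 + y ^ 10) + v * P + v' * Q := by
  have hvx (a : R) : v * (1 - a * v') = v - a := by linear_combination -a * hvv
  have hvx' : v ^ 2 * (1 - y ^ 2 * v' ^ 2) = v ^ 2 - y ^ 2 := by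
    linear_combination -y ^ 2 * (v * v' + 1) * hvv
  have hv1 : v * (1 - v') = v - 1 := by linear_combination -hvv
  have hvs : v * (1 + (y ^ 3 - y ^ 5) * (v + v' + 2) - y ^ 8) =
      v + (y ^ 3 - y ^ 5) * (v ^ 2 + 1 + 2 * v) - y ^ 8 * v := by
    linear_combination (y ^ 3 - y ^ 5) * hvv
  let p₀ : B := x - x ^ 2 - x ^ 4 + x ^ 5 - x ^ 9 + x ^ 10 + x ^ 12 - x ^ 13
  let p₁ : B := x ^ 2 - 3 * x ^ 3 + 2 * x ^ 4 + x ^ 5 - x ^ 6 - 2 * x ^ 7 + 2 * x ^ 8 + x ^ 10 +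
    3 * x ^ 11 - 4 * x ^ 12 - x ^ 13 - x ^ 14 + 2 * x ^ 15
  let p₂ : B := -x ^ 3 + 4 * x ^ 5 - 6 * x ^ 7 - 3 * x ^ 8 + 4 * x ^ 9 + 7 * x ^ 10 + 3 * x ^ 11
    - 6 * x ^ 12 - 8 * x ^ 13 + 2 * x ^ 14 + 4 * x ^ 15 + x ^ 16 - x ^ 18
  let p₃ : B := 2 * x ^ 5 - 3 * x ^ 6 - 3 * x ^ 7 + 3 * x ^ 8 + 8 * x ^ 9 - 2 * x ^ 10 -
    7 * x ^ 11 - 7 * x ^ 12 + 3 * x ^ 13 + 11 * x ^ 14 + x ^ 15 - 5 * x ^ 16 - 4 * x ^ 17 +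
    2 * x ^ 18 + x ^ 19 + x ^ 20 - x ^ 21
  let p₄ : B := -x ^ 7 + 2 * x ^ 8 + x ^ 9 - 3 * x ^ 10 - 3 * x ^ 11 + 4 * x ^ 12 + 3 * x ^ 13 -
    3 * x ^ 15 - 4 * x ^ 16 + 3 * x ^ 17 + 3 * x ^ 18 - x ^ 19 - 2 * x ^ 20 + x ^ 21
  let q₀ : B := -1 + 2 * x + x ^ 2 - 3 * x ^ 3 - 3 * x ^ 4 + 4 * x ^ 5 + 3 * x ^ 6 - 3 * x ^ 8 -
    4 * x ^ 9 + 3 * x ^ 10 + 3 * x ^ 11 - x ^ 12 - 2 * x ^ 13 + x ^ 14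
  let q₁ : B := x ^ 2 - 5 * x ^ 3 + 2 * x ^ 4 + 8 * x ^ 5 + 2 * x ^ 6 - 11 * x ^ 7 - 6 * x ^ 8 +
    4 * x ^ 9 + 9 * x ^ 10 + 5 * x ^ 11 - 10 * x ^ 12 - 4 * x ^ 13 + 4 * x ^ 14 + 3 * x ^ 15 -
    2 * x ^ 16
  let q₂ : B := -x ^ 3 + 6 * x ^ 5 - x ^ 6 - 11 * x ^ 7 + 10 * x ^ 9 + 5 * x ^ 10 - 5 * x ^ 11 -
    10 * x ^ 12 + 11 * x ^ 14 + x ^ 15 - 6 * x ^ 16 + x ^ 18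
  let q₃ : B := 2 * x ^ 5 - 3 * x ^ 6 - 4 * x ^ 7 + 4 * x ^ 8 + 10 * x ^ 9 - 5 * x ^ 10 -
    9 * x ^ 11 - 4 * x ^ 12 + 6 * x ^ 13 + 11 * x ^ 14 - 2 * x ^ 15 - 8 * x ^ 16 - 2 * x ^ 17 +
    5 * x ^ 18 - x ^ 19
  let q₄ : B := -x ^ 7 + 2 * x ^ 8 + x ^ 9 - 3 * x ^ 10 - 3 * x ^ 11 + 4 * x ^ 12 + 3 * x ^ 13 -
    3 * x ^ 15 - 4 * x ^ 16 + 3 * x ^ 17 + 3 * x ^ 18 - x ^ 19 - 2 * x ^ 20 + x ^ 21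
  refine laurent_split (B := B) (ι := ι) (Dr := (v - y) * (v ^ 2 - y ^ 2) * (v - y ^ 2) ^ 2)
    (Nr := (1 - y) * (1 - y ^ 2) * (1 - y ^ 3) ^ 3 * (1 - y ^ 4) ^ 2 * (v ^ 3 * (v - 1) *
      (v + (y ^ 3 - y ^ 5) * (v ^ 2 + 1 + 2 * v) - y ^ 8 * v)))
    hvv hS hT hv hv' hg hg' hgD hgD' ?_ ?_
    p₀ p₁ p₂ p₃ p₄ q₀ q₁ q₂ q₃ q₄ ?_
  · rw [← hvx y, ← hvx (y ^ 2), ← hvx']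
    ring
  · rw [← hv1, ← hvs]
    ring
  · simp only [map_add, map_sub, map_neg, map_mul, map_pow, map_one, map_ofNat, hx,
      p₀, p₁, p₂, p₃, p₄, q₀, q₁, q₂, q₃, q₄]
    ring

/-- The nonnegative power series for both `φ` and `-φ`, that is, those of weight zero. -/
noncomputable abbrev zeroSubring (φ : ℤ × ℤ →+ ℤ) :
    Subring (PowerSeries (AddMonoidAlgebra ℤ (ℤ × ℤ))) :=
  nonnegSubring φ ⊓ nonnegSubring (-φ)

lemma map_mem_zeroSubring (φ : ℤ × ℤ →+ ℤ) (f : PowerSeries ℤ) :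
    PowerSeries.map (algebraMap ℤ _) f ∈ zeroSubring φ :=
  ⟨map_mem_nonnegSubring _ f, map_mem_nonnegSubring _ f⟩

lemma X_mem_zeroSubring (φ : ℤ × ℤ →+ ℤ) : X ∈ zeroSubring φ := by
  simpa only [PowerSeries.map_X] using map_mem_zeroSubring φ X

lemma laurentMonomial_mem_zeroSubring {φ : ℤ × ℤ →+ ℤ} {w : ℤ × ℤ} (hw : φ w = 0) :
    laurentMonomial w ∈ zeroSubring φ :=
  ⟨laurentMonomial_mem hw.ge, laurentMonomial_mem (by simp [hw])⟩

lemma geomSeries_mem_zeroSubring {φ : ℤ × ℤ →+ ℤ} (k : ℕ) {w : ℤ × ℤ} (hw : φ w = 0) :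
    geomSeries k w ∈ zeroSubring φ :=
  ⟨geomSeries_mem k hw.ge, geomSeries_mem k (by simp [hw])⟩

lemma laurentMonomial_mul_neg (w : ℤ × ℤ) : laurentMonomial w * laurentMonomial (-w) = 1 := by
  rw [← laurentMonomial_add, add_neg_cancel, laurentMonomial_zero]

/-- A product of inverses is the inverse of a product. -/
lemma mul_mul_sq_mul_eq_one {R : Type*} [CommRing R] {a b c a' b' c' : R} (ha : a * a' = 1)
    (hb : b * b' = 1) (hc : c * c' = 1) : a * b * c ^ 2 * (a' * b' * c' ^ 2) = 1 := by
  calc _ = (a * a') * (b * b') * (c * c') ^ 2 := by ring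
    _ = 1 := by rw [ha, hb, hc]; ring

lemma exists_row_split :
    ∃ P ∈ nonnegSubring (AddMonoidHom.fst ℤ ℤ), ∃ Q ∈ nonnegSubring (-AddMonoidHom.fst ℤ ℤ),
      ((1 - X ^ 2) ^ 4 *
          (1 - (laurentMonomial (0, 1) + laurentMonomial (0, -1)) * X ^ 2 + X ^ 4) ^ 2 *
          (1 - ((laurentMonomial (0, 1) + laurentMonomial (0, -1)) ^ 2 - 2) * X ^ 2 + X ^ 4) *
          (1 - laurentMonomial (-1, 0))) *
        (geomSeries 1 (1, 1) * geomSeries 1 (1, -1) * geomSeries 1 (1, 0) ^ 2 *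
          (geomSeries 1 (-1, 1) * geomSeries 1 (-1, -1) * geomSeries 1 (-1, 0) ^ 2)) =
      (1 - X) ^ 2 * (1 - (laurentMonomial (0, 1) + laurentMonomial (0, -1)) * X + X ^ 2) *
          (1 + (X ^ 3 - X ^ 5) * (laurentMonomial (0, 1) + laurentMonomial (0, -1) + 2) - X ^ 8) +
        laurentMonomial (1, 0) * P + laurentMonomial (-1, 0) * Q := by
  have hv := laurentMonomial_mul_neg (0, 1)
  have hinv (a : ℤ) : geomSeries 1 (a, 1) * geomSeries 1 (a, -1) * geomSeries 1 (a, 0) ^ 2 *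
      ((1 - X * laurentMonomial (a, 0)) ^ 2 *
        (1 - (laurentMonomial (0, 1) + laurentMonomial (0, -1)) * (X * laurentMonomial (a, 0)) +
          (X * laurentMonomial (a, 0)) ^ 2)) = 1 := by
    have h1 := geomSeries_mul one_pos (a, 1)
    have h2 := geomSeries_mul one_pos (a, -1)
    rw [show (a, (1 : ℤ)) = (a, 0) + (0, 1) by simp, laurentMonomial_add] at h1
    rw [show (a, (-1 : ℤ)) = (a, 0) + (0, -1) by simp, laurentMonomial_add] at h2
    have h := mul_mul_sq_mul_eq_one h1 h2 (geomSeries_mul one_pos (a, 0))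
    simp only [Prod.mk_add_mk, add_zero, zero_add, pow_one, Prod.neg_mk, neg_zero] at h hv
    linear_combination h - geomSeries 1 (a, 1) * geomSeries 1 (a, -1) * geomSeries 1 (a, 0) ^ 2 *
      (1 - X * laurentMonomial (a, 0)) ^ 2 * (X * laurentMonomial (a, 0)) ^ 2 * hv
  refine row_split (ι := (zeroSubring (AddMonoidHom.fst ℤ ℤ)).subtype)
    (x := ⟨X, X_mem_zeroSubring _⟩)
    (s := ⟨_, add_mem (laurentMonomial_mem_zeroSubring (w := (0, 1)) rfl)
      (laurentMonomial_mem_zeroSubring (w := (0, -1)) rfl)⟩)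
    (laurentMonomial_mul_neg (1, 0)) (fun b => b.2.1) (fun b => b.2.2) rfl rfl
    (laurentMonomial_mem (by simp)) (laurentMonomial_mem (by simp)) ?_ ?_ (hinv 1) (hinv (-1))
  all_goals
    refine mul_mem (mul_mem ?_ ?_) (pow_mem ?_ 2) <;> exact geomSeries_mem 1 (by simp)

lemma exists_column_split :
    ∃ P ∈ nonnegSubring (AddMonoidHom.snd ℤ ℤ), ∃ Q ∈ nonnegSubring (-AddMonoidHom.snd ℤ ℤ),
      ((1 - X) * (1 - X ^ 2) * (1 - X ^ 3) ^ 3 * (1 - X ^ 4) ^ 2 *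
          ((1 - laurentMonomial (0, -1)) * (1 + (X ^ 3 - X ^ 5) *
            (laurentMonomial (0, 1) + laurentMonomial (0, -1) + 2) - X ^ 8))) *
        (geomSeries 1 (0, 1) * geomSeries 2 (0, 2) * geomSeries 2 (0, 1) ^ 2 *
          (geomSeries 1 (0, -1) * geomSeries 2 (0, -2) * geomSeries 2 (0, -1) ^ 2)) =
      (1 - X) ^ 2 * (1 - X ^ 2) * (1 - X ^ 2 - X ^ 3 + 2 * X ^ 4 + 2 * X ^ 5 + 2 * X ^ 6 - X ^ 7 -
          X ^ 8 + X ^ 10) +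
        laurentMonomial (0, 1) * P + laurentMonomial (0, -1) * Q := by
  have hinv (a b : ℤ) (hb : b = 2 * a) :
      geomSeries 1 (0, a) * geomSeries 2 (0, b) * geomSeries 2 (0, a) ^ 2 *
      ((1 - X * laurentMonomial (0, a)) * (1 - X ^ 2 * laurentMonomial (0, a) ^ 2) *
        (1 - X ^ 2 * laurentMonomial (0, a)) ^ 2) = 1 := by
    have h := mul_mul_sq_mul_eq_one (geomSeries_mul one_pos (0, a))
      (geomSeries_mul two_pos (0, b)) (geomSeries_mul two_pos (0, a))
    have hb' : laurentMonomial (0, b) = laurentMonomial (0, a) ^ 2 := by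
      rw [hb, two_mul, sq, ← laurentMonomial_add, Prod.mk_add_mk, add_zero]
    rwa [pow_one, hb'] at h
  refine column_split (ι := (zeroSubring (AddMonoidHom.snd ℤ ℤ)).subtype)
    (x := ⟨X, X_mem_zeroSubring _⟩)
    (laurentMonomial_mul_neg (0, 1)) (fun b => b.2.1) (fun b => b.2.2) rfl
    (laurentMonomial_mem (by simp)) (laurentMonomial_mem (by simp)) ?_ ?_ (hinv 1 2 rfl)
    (hinv (-1) (-2) rfl)
  all_goals
    refine mul_mem (mul_mem ?_ ?_) (pow_mem ?_ 2) <;> exact geomSeries_mem _ (by simp)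

lemma prod_geomSeries : ∏ p : Fin 4 × Fin 4, geomSeries 1 (indexWeight p.1, indexWeight p.2) =
    geomSeries 1 (1, 1) * geomSeries 1 (1, -1) * geomSeries 1 (1, 0) ^ 2 *
      (geomSeries 1 (-1, 1) * geomSeries 1 (-1, -1) * geomSeries 1 (-1, 0) ^ 2) *
      (geomSeries 1 (0, 1) * geomSeries 1 (0, -1) * geomSeries 1 0 ^ 2) ^ 2 := by
  simp only [Fintype.prod_prod_type, Fin.prod_univ_four, indexWeight, Matrix.cons_val,
    ← Prod.zero_eq_mk]
  ring

/-- Two successive partial fraction decompositions, with denominators cleared by `D = K * w`. -/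
lemma mul_eq_of_splits {R : Type*} [CommRing R]
    {D K w E c C N k e r z A G u u' v v' P Q P' Q' : R} (hD : D = K * w) (he : e * E = 1)
    (hr : r * c = 1) (hG : e * r = z * G) (hz : z * (w * k) = 1)
    (hrow : E * (1 - u') * A = c * C + u * P + u' * Q)
    (hcol : K * ((1 - v') * C) * G = k * N + v * P' + v' * Q') :
    D * ((1 - u') * (1 - v') * (A * r ^ 2)) = N + u * (D * (1 - v') * e * r ^ 2 * P) +
      u' * (D * (1 - v') * e * r ^ 2 * Q) + v * (w * z * P') + v' * (w * z * Q') := by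
  subst hD
  linear_combination K * w * (1 - v') * e * r ^ 2 * hrow -
    K * w * (1 - u') * (1 - v') * A * r ^ 2 * he + K * w * (1 - v') * e * r * C * hr +
    K * w * (1 - v') * C * hG + w * z * hcol + N * hz

/-- Multiplying by `(1 - u⁻¹) * (1 - v⁻¹)` and taking the constant term extracts the alternating
sum of the four coefficients. -/
lemma constTerm_mul_prod_geomSeries :
    constTerm ((1 - laurentMonomial (-1, 0)) * (1 - laurentMonomial (0, -1)) *
      ∏ p : Fin 4 × Fin 4, geomSeries 1 (indexWeight p.1, indexWeight p.2)) =
    PowerSeries.mk fun n => (fCount 0 0 n : ℤ) - fCount 0 1 n - fCount 1 0 n + fCount 1 1 n := by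
  rw [show ∀ f, (1 - laurentMonomial (-1, 0)) * (1 - laurentMonomial (0, -1)) * f =
      laurentMonomial 0 * f - laurentMonomial (0, -1) * f - laurentMonomial (-1, 0) * f +
        laurentMonomial ((-1, 0) + (0, -1)) * f by
    intro f; rw [laurentMonomial_add, laurentMonomial_zero]; ring]
  ext n
  simp only [map_add, map_sub, coeff_constTerm_laurentMonomial_mul, PowerSeries.coeff_mk,
    Prod.mk_add_mk, Prod.neg_mk, neg_neg, neg_zero, add_zero, zero_add,
    coeff_prod_geomSeries]
  rw [Prod.zero_eq_mk, coeff_prod_geomSeries]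

set_option maxHeartbeats 400000 in
lemma constTerm_denominator_mul : constTerm (PowerSeries.map (algebraMap ℤ _)
      ((1 - X) * (1 - X ^ 2) ^ 4 * (1 - X ^ 3) ^ 3 * (1 - X ^ 4) ^ 2) *
      ((1 - laurentMonomial (-1, 0)) * (1 - laurentMonomial (0, -1)) *
        ∏ p : Fin 4 × Fin 4, geomSeries 1 (indexWeight p.1, indexWeight p.2))) =
    1 - X ^ 2 - X ^ 3 + 2 * X ^ 4 + 2 * X ^ 5 + 2 * X ^ 6 - X ^ 7 - X ^ 8 + X ^ 10 := by
  obtain ⟨P, hP, Q, hQ, hrow⟩ := exists_row_split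
  obtain ⟨P', hP', Q', hQ', hcol⟩ := exists_column_split
  have hz := geomSeries_mul one_pos 0
  have hz₂ := geomSeries_mul two_pos 0
  have ha (j : ℤ) := geomSeries_mul one_pos (0, j)
  have hb (j : ℤ) := geomSeries_mul two_pos (0, j)
  have hv := laurentMonomial_mul_neg (0, 1)
  have hsq (j : ℤ) : laurentMonomial (0, 2 * j) = laurentMonomial (0, j) ^ 2 := by
    rw [two_mul, sq, ← laurentMonomial_add, Prod.mk_add_mk, add_zero]
  have hsq₁ := hsq 1
  have hsq₂ := hsq (-1)
  norm_num at hsq₁ hsq₂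
  rw [laurentMonomial_zero, mul_one, pow_one] at hz
  rw [laurentMonomial_zero, mul_one] at hz₂
  simp only [Prod.neg_mk, neg_zero, pow_one] at hv ha
  have hr : geomSeries 1 (0, 1) * geomSeries 1 (0, -1) * geomSeries 1 0 ^ 2 *
      ((1 - X) ^ 2 * (1 - (laurentMonomial (0, 1) + laurentMonomial (0, -1)) * X + X ^ 2)) = 1 := by
    linear_combination mul_mul_sq_mul_eq_one (ha 1) (ha (-1)) hz -
      geomSeries 1 (0, 1) * geomSeries 1 (0, -1) * geomSeries 1 0 ^ 2 * (1 - X) ^ 2 * X ^ 2 * hv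
  set t := laurentMonomial (0, 1) + laurentMonomial (0, -1) with ht
  have he₁ : geomSeries 2 (0, 1) * geomSeries 2 (0, -1) * (1 - t * X ^ 2 + X ^ 4) = 1 := by
    rw [ht]
    linear_combination hb (-1) + geomSeries 2 (0, -1) * (1 - X ^ 2 * laurentMonomial (0, -1)) *
      hb 1 - geomSeries 2 (0, 1) * geomSeries 2 (0, -1) * X ^ 4 * hv
  have he₂ : geomSeries 2 (0, 2) * geomSeries 2 (0, -2) *
      (1 - (t ^ 2 - 2) * X ^ 2 + X ^ 4) = 1 := by
    have h1 := hb 2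
    have h2 := hb (-2)
    rw [hsq₁] at h1
    rw [hsq₂] at h2
    rw [ht]
    linear_combination h2 + geomSeries 2 (0, -2) *
      (1 - X ^ 2 * laurentMonomial (0, -1) ^ 2) * h1 -
      geomSeries 2 (0, 2) * geomSeries 2 (0, -2) * (2 * X ^ 2 +
        X ^ 4 * (laurentMonomial (0, 1) * laurentMonomial (0, -1) + 1)) * hv
  have he : geomSeries 2 0 ^ 4 * (geomSeries 2 (0, 1) * geomSeries 2 (0, -1)) ^ 2 *
      (geomSeries 2 (0, 2) * geomSeries 2 (0, -2)) *
      ((1 - X ^ 2) ^ 4 * (1 - t * X ^ 2 + X ^ 4) ^ 2 * (1 - (t ^ 2 - 2) * X ^ 2 + X ^ 4)) = 1 := by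
    calc _ = (geomSeries 2 0 * (1 - X ^ 2)) ^ 4 *
          (geomSeries 2 (0, 1) * geomSeries 2 (0, -1) * (1 - t * X ^ 2 + X ^ 4)) ^ 2 *
          (geomSeries 2 (0, 2) * geomSeries 2 (0, -2) *
            (1 - (t ^ 2 - 2) * X ^ 2 + X ^ 4)) := by ring
      _ = 1 := by rw [hz₂, he₁, he₂]; ring
  have key := mul_eq_of_splits
    (D := PowerSeries.map (algebraMap ℤ _)
      ((1 - X) * (1 - X ^ 2) ^ 4 * (1 - X ^ 3) ^ 3 * (1 - X ^ 4) ^ 2))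
    (w := (1 - X ^ 2) ^ 3) (z := geomSeries 1 0 ^ 2 * geomSeries 2 0 ^ 4)
    (by simp only [map_mul, map_sub, map_pow, map_one, PowerSeries.map_X]; ring) he hr (by ring)
    (by
      calc _ = (geomSeries 1 0 * (1 - X)) ^ 2 * (geomSeries 2 0 * (1 - X ^ 2)) ^ 4 := by ring
        _ = 1 := by rw [hz, hz₂]; ring) hrow hcol
  have hfst : PowerSeries.map (algebraMap ℤ _)
      ((1 - X) * (1 - X ^ 2) ^ 4 * (1 - X ^ 3) ^ 3 * (1 - X ^ 4) ^ 2) *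
      (1 - laurentMonomial (0, -1)) *
      (geomSeries 2 0 ^ 4 * (geomSeries 2 (0, 1) * geomSeries 2 (0, -1)) ^ 2 *
        (geomSeries 2 (0, 2) * geomSeries 2 (0, -2))) *
      (geomSeries 1 (0, 1) * geomSeries 1 (0, -1) * geomSeries 1 0 ^ 2) ^ 2 ∈
        zeroSubring (AddMonoidHom.fst ℤ ℤ) := by
    have hg (k : ℕ) (j : ℤ) : geomSeries k (0, j) ∈ zeroSubring (AddMonoidHom.fst ℤ ℤ) :=
      geomSeries_mem_zeroSubring k rfl
    have hm : laurentMonomial (0, -1) ∈ zeroSubring (AddMonoidHom.fst ℤ ℤ) :=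
      laurentMonomial_mem_zeroSubring rfl
    exact mul_mem (mul_mem (mul_mem (map_mem_zeroSubring _ _) (sub_mem (one_mem _) hm))
      (mul_mem (mul_mem (pow_mem (hg 2 0) 4) (pow_mem (mul_mem (hg 2 1) (hg 2 (-1))) 2))
        (mul_mem (hg 2 2) (hg 2 (-2)))))
      (pow_mem (mul_mem (mul_mem (hg 1 1) (hg 1 (-1))) (pow_mem (hg 1 0) 2)) 2)
  have hsnd : (1 - X ^ 2) ^ 3 * (geomSeries 1 0 ^ 2 * geomSeries 2 0 ^ 4) ∈
      zeroSubring (AddMonoidHom.snd ℤ ℤ) := by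
    have hg (k : ℕ) : geomSeries k 0 ∈ zeroSubring (AddMonoidHom.snd ℤ ℤ) :=
      geomSeries_mem_zeroSubring k rfl
    have hm := X_mem_zeroSubring (AddMonoidHom.snd ℤ ℤ)
    exact mul_mem (pow_mem (sub_mem (one_mem _) (pow_mem hm 2)) 3)
      (mul_mem (pow_mem (hg 1) 2) (pow_mem (hg 2) 4))
  rw [prod_geomSeries, key, map_add, map_add, map_add, map_add,
    constTerm_laurentMonomial_mul (φ := AddMonoidHom.fst ℤ ℤ) (by simp) (mul_mem hfst.1 hP),
    constTerm_laurentMonomial_mul (φ := -AddMonoidHom.fst ℤ ℤ) (by simp) (mul_mem hfst.2 hQ),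
    constTerm_laurentMonomial_mul (φ := AddMonoidHom.snd ℤ ℤ) (by simp) (mul_mem hsnd.1 hP'),
    constTerm_laurentMonomial_mul (φ := -AddMonoidHom.snd ℤ ℤ) (by simp) (mul_mem hsnd.2 hQ'),
    add_zero, add_zero, add_zero, add_zero]
  refine Eq.trans (congrArg constTerm ?_) (constTerm_map _)
  simp only [map_add, map_sub, map_mul, map_pow, map_one, map_ofNat, PowerSeries.map_X]

/-- In `ℤ[[x]]`,
`Σₙ (f(0,0,n) − f(0,1,n) − f(1,0,n) + f(1,1,n)) xⁿ`
`= (1 − x² − x³ + 2x⁴ + 2x⁵ + 2x⁶ − x⁷ − x⁸ + x¹⁰) / ((1−x)(1−x²)⁴(1−x³)³(1−x⁴)²)`,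
stated by multiplying both sides with the denominator (which is invertible in `ℤ[[x]]`). -/
theorem stmt14 :
    (PowerSeries.mk fun n => (fCount 0 0 n : ℤ) - fCount 0 1 n - fCount 1 0 n + fCount 1 1 n) *
      ((1 - X) * (1 - X ^ 2) ^ 4 * (1 - X ^ 3) ^ 3 * (1 - X ^ 4) ^ 2) =
    1 - X ^ 2 - X ^ 3 + 2 * X ^ 4 + 2 * X ^ 5 + 2 * X ^ 6 - X ^ 7 - X ^ 8 + X ^ 10 := by
  rw [← constTerm_denominator_mul, constTerm_map_mul, constTerm_mul_prod_geomSeries, mul_comm]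
end
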